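/- Let N ≥ 2 and let X ⊆ ℂ^N be a connected open set admitting a C^∞ exhaustion function ρ : X → ℝ whose Levi form has at least two positive eigenvalues at every point of X_c := {x ∈ X : ρ(x) > c}, for some c ∈ ℝ. Let D ⊂ ℂ be a bounded connected smoothly bounded domain and let f : D̄ → X be of class C² on D̄ and holomorphic in D, with f(∂D) ⊆ X_c. Given finitely many points z₁,…,z_l ∈ D and k ∈ ℕ, there is a sequence of holomorphic maps g_ν : D → X such that each g_ν is proper, each g_ν is homotopic to f|_D through continuous maps D → X, each g_ν agrees with f to order k at each point z_j, and g_ν converges to f uniformly on every compact subset of D as ν → ∞. (This is the main theorem of the paper specialized to X a domain in ℂ^N and D a planar domain.) -/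

import Mathlib

open Set Filter Complex Metric

noncomputable section

abbrev Cn (N : ℕ) := EuclideanSpace ℂ (Fin N)

/-- The Levi form of a `C²` function `ρ` at `x` in direction `v`:
`(1/4)(H_x(v,v) + H_x(iv,iv))` where `H_x` is the real Hessian of `ρ` at `x`. -/
def LeviForm {N : ℕ} (ρ : Cn N → ℝ) (x v : Cn N) : ℝ :=
  (1 / 4) * (iteratedFDeriv ℝ 2 ρ x ![v, v] +
    iteratedFDeriv ℝ 2 ρ x ![Complex.I • v, Complex.I • v])

/-- The Levi form of `ρ` has at least two positive eigenvalues at `x`. -/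
def TwoPosEigen {N : ℕ} (ρ : Cn N → ℝ) (x : Cn N) : Prop :=
  ∃ W : Submodule ℂ (Cn N), Module.finrank ℂ W = 2 ∧
    ∀ v ∈ W, v ≠ 0 → 0 < LeviForm ρ x v

/-- A bounded (connected) open set `D ⊆ ℂ` is smoothly bounded. -/
def SmoothlyBounded (D : Set ℂ) : Prop :=
  ∃ V : Set ℂ, IsOpen V ∧ frontier D ⊆ V ∧
    ∃ v : ℂ → ℝ, ContDiffOn ℝ (⊤ : ℕ∞) v V ∧
      D ∩ V = {z ∈ V | v z < 0} ∧
      frontier D = {z ∈ V | v z = 0} ∧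
      ∀ z ∈ frontier D, fderiv ℝ v z ≠ 0

/-- `f` is of class `C^r` on `D̄` and holomorphic in `D`: continuous on `D̄`,
holomorphic on `D`, and all derivatives of order `≤ r` extend continuously to `D̄`. -/
def ClassA {F : Type*} [NormedAddCommGroup F] [NormedSpace ℂ F] (r : ℕ) (D : Set ℂ)
    (f : ℂ → F) : Prop :=
  ContinuousOn f (closure D) ∧ DifferentiableOn ℂ f D ∧
  ∀ k ≤ r, ∃ g : ℂ → F, ContinuousOn g (closure D) ∧ EqOn g (iteratedDeriv k f) D

/-- `f` and `g` are homotopic through continuous maps `D → X`. -/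
def HomotopicIn {N : ℕ} (X : Set (Cn N)) (D : Set ℂ) (f g : ℂ → Cn N) : Prop :=
  ∃ H : ℝ × ℂ → Cn N, ContinuousOn H (Icc (0:ℝ) 1 ×ˢ D) ∧
    (∀ s ∈ Icc (0:ℝ) 1, ∀ z ∈ D, H (s, z) ∈ X) ∧
    (∀ z ∈ D, H (0, z) = f z) ∧ (∀ z ∈ D, H (1, z) = g z)

/-- The quadratic polynomial disc through the origin. -/
def pd {N : ℕ} (v w : Cn N) (ζ : ℂ) : Cn N := ζ • v + ζ ^ 2 • w

lemma cplx_smul_eq {N : ℕ} (t : ℂ) (a : Cn N) : t • a = t.re • a + t.im • (I • a) := by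
  conv_lhs => rw [← Complex.re_add_im t]
  rw [add_smul, mul_smul]; rfl

/-- `∂`-part of a real-linear functional. -/
def dpart {N : ℕ} (l : Cn N →L[ℝ] ℝ) (a : Cn N) : ℂ := ⟨l a, - l (I • a)⟩

lemma dpart_re {N : ℕ} (l : Cn N →L[ℝ] ℝ) (a : Cn N) (t : ℂ) :
    l (t • a) = (t * dpart l a).re := by
  rw [cplx_smul_eq t a]
  simp [dpart]

lemma dpart_smul {N : ℕ} (l : Cn N →L[ℝ] ℝ) (a : Cn N) (t : ℂ) :
    dpart l (t • a) = t * dpart l a := by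
  apply Complex.ext
  · rw [← dpart_re]; rfl
  · have := dpart_re l a (I * t)
    rw [mul_smul] at this
    simp [dpart] at this ⊢
    linarith

lemma dpart_add {N : ℕ} (l : Cn N →L[ℝ] ℝ) (a b : Cn N) :
    dpart l (a + b) = dpart l a + dpart l b := by
  apply Complex.ext
  · simp [dpart]
  · simp [dpart]; ring

/-- `∂∂`-part of a real bilinear form. -/
def qpart {N : ℕ} (B : Cn N →L[ℝ] Cn N →L[ℝ] ℝ) (a b : Cn N) : ℂ :=
  ⟨(B a b - B (I • a) (I • b)) / 2, -(B (I • a) b + B a (I • b)) / 2⟩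

lemma qpart_add_left {N : ℕ} (B : Cn N →L[ℝ] Cn N →L[ℝ] ℝ) (a a' b : Cn N) :
    qpart B (a + a') b = qpart B a b + qpart B a' b := by
  apply Complex.ext <;> simp [qpart] <;> ring

lemma qpart_add_right {N : ℕ} (B : Cn N →L[ℝ] Cn N →L[ℝ] ℝ) (a b b' : Cn N) :
    qpart B a (b + b') = qpart B a b + qpart B a b' := by
  apply Complex.ext <;> simp [qpart] <;> ring

lemma I_smul_I_smul {N : ℕ} (a : Cn N) : I • I • a = -a := by
  rw [← mul_smul, I_mul_I, neg_one_smul]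

lemma I_smul_real {N : ℕ} (t : ℝ) (a : Cn N) : I • t • a = t • I • a := smul_comm _ _ _

lemma qpart_smul_left {N : ℕ} (B : Cn N →L[ℝ] Cn N →L[ℝ] ℝ) (a b : Cn N) (t : ℂ) :
    qpart B (t • a) b = t * qpart B a b := by
  rw [cplx_smul_eq t a]
  apply Complex.ext <;>
    simp [qpart, I_smul_I_smul, I_smul_real] <;> ring

lemma qpart_smul_right {N : ℕ} (B : Cn N →L[ℝ] Cn N →L[ℝ] ℝ) (a b : Cn N) (t : ℂ) :
    qpart B a (t • b) = t * qpart B a b := by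
  rw [cplx_smul_eq t b]
  apply Complex.ext <;>
    simp [qpart, I_smul_I_smul, I_smul_real] <;> ring

lemma qpart_diag {N : ℕ} (B : Cn N →L[ℝ] Cn N →L[ℝ] ℝ) (hB : ∀ a b, B a b = B b a)
    (v : Cn N) (η : ℂ) :
    B (η • v) (η • v) =
      (B v v + B (I • v) (I • v)) / 2 * ‖η‖ ^ 2 + (η ^ 2 * qpart B v v).re := by
  rw [cplx_smul_eq η v, Complex.sq_norm, Complex.normSq_apply]
  simp [qpart, hB (I • v) v, pow_two]
  ring

/-- Algebraic selection of the disc. -/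
lemma disc_alg {N : ℕ} (l : Cn N →L[ℝ] ℝ) (B : Cn N →L[ℝ] Cn N →L[ℝ] ℝ)
    (hB : ∀ a b, B a b = B b a) (W : Submodule ℂ (Cn N)) (hW : Module.finrank ℂ W = 2)
    (hpos : ∀ v ∈ W, v ≠ 0 → 0 < B v v + B (I • v) (I • v)) :
    ∃ v w : Cn N, (∀ η : ℂ, l (η • v) = 0) ∧ ∃ m : ℝ, 0 < m ∧
      ∀ η : ℂ, B (η • v) (η • v) + 2 * l (η ^ 2 • w) = m * ‖η‖ ^ 2 := by
  have : ∃ e1 ∈ W, ∃ e2 ∈ W, ∀ a b : ℂ, a • e1 + b • e2 = 0 → a = 0 ∧ b = 0 := by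
    let bs := Module.finBasisOfFinrankEq ℂ W hW
    refine ⟨bs 0, (bs 0).2, bs 1, (bs 1).2, fun a b h => ?_⟩
    have h2 := bs.linearIndependent
    rw [Fintype.linearIndependent_iff] at h2
    have h3 := h2 ![a, b] (by
      rw [Fin.sum_univ_two]
      exact Subtype.ext h)
    exact ⟨h3 0, h3 1⟩
  obtain ⟨e1, h1, e2, h2, hind⟩ := this
  by_cases hd : ∀ a, dpart l a = 0
  · -- critical
    have : ∃ v ∈ W, v ≠ 0 ∧ qpart B v v = 0 := by
      by_cases hq : qpart B e2 e2 = 0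
      · refine ⟨e2, h2, ?_, hq⟩
        intro h
        have := (hind 0 1 (by simp [h])).2
        exact one_ne_zero this
      · obtain ⟨t, ht⟩ : ∃ t : ℂ, qpart B e2 e2 * (t * t)
            + (qpart B e1 e2 + qpart B e2 e1) * t + qpart B e1 e1 = 0 := by
          obtain ⟨s, hs⟩ := IsAlgClosed.exists_pow_nat_eq
            (discrim (qpart B e2 e2) (qpart B e1 e2 + qpart B e2 e1) (qpart B e1 e1))
            (n := 2) (by norm_num)
          exact exists_quadratic_eq_zero hq ⟨s, by rw [← hs]; ring⟩
        refine ⟨e1 + t • e2, W.add_mem h1 (W.smul_mem t h2), ?_, ?_⟩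
        · intro h
          have := (hind 1 t (by simpa using h)).1
          exact one_ne_zero this
        · rw [qpart_add_left, qpart_add_right, qpart_add_right, qpart_smul_left,
            qpart_smul_left, qpart_smul_right, qpart_smul_right]
          linear_combination ht
    obtain ⟨v, hv, hv0, hq⟩ := this
    refine ⟨v, 0, fun η => by rw [dpart_re, hd]; simp, _, half_pos (hpos v hv hv0), ?_⟩
    intro η
    rw [qpart_diag B hB, hq]
    simp
  · push Not at hd
    obtain ⟨a, ha⟩ := hd
    have : ∃ v ∈ W, v ≠ 0 ∧ dpart l v = 0 := by
      by_cases h0 : dpart l e1 = 0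
      · refine ⟨e1, h1, ?_, h0⟩
        intro h
        exact one_ne_zero (hind 1 0 (by simp [h])).1
      · refine ⟨dpart l e2 • e1 + (-dpart l e1) • e2,
          W.add_mem (W.smul_mem _ h1) (W.smul_mem _ h2), ?_, ?_⟩
        · intro h
          exact h0 (by simpa using (hind _ _ h).2)
        · rw [dpart_add, dpart_smul, dpart_smul]; ring
    obtain ⟨v, hv, hv0, hdv⟩ := this
    refine ⟨v, (-(qpart B v v) / 2 / dpart l a) • a,
      fun η => by rw [dpart_re, hdv]; simp, _, half_pos (hpos v hv hv0), ?_⟩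
    intro η
    rw [qpart_diag B hB, dpart_re l, dpart_smul]
    have : η ^ 2 * (-(qpart B v v) / 2 / dpart l a * dpart l a)
      = ((-1/2 : ℝ) : ℂ) * (η ^ 2 * qpart B v v) := by
      field_simp; push_cast; ring
    rw [this, Complex.re_ofReal_mul]
    ring

lemma second_order_lower {g g' g'' : ℝ → ℝ} {κ : ℝ}
    (h1 : ∀ t ∈ Icc (0:ℝ) 1, HasDerivAt g (g' t) t)
    (h2 : ∀ t ∈ Icc (0:ℝ) 1, HasDerivAt g' (g'' t) t)
    (h3 : ∀ t ∈ Icc (0:ℝ) 1, κ ≤ g'' t) : g 0 + g' 0 + κ / 2 ≤ g 1 := by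
  have key : ∀ (a a' : ℝ → ℝ), (∀ t ∈ Icc (0:ℝ) 1, HasDerivAt a (a' t) t) →
      (∀ t ∈ Icc (0:ℝ) 1, 0 ≤ a' t) → ∀ t ∈ Icc (0:ℝ) 1, a 0 ≤ a t := by
    intro a a' ha hp t ht
    have : MonotoneOn a (Icc 0 1) := by
      apply monotoneOn_of_deriv_nonneg (convex_Icc 0 1)
      · exact fun x hx => (ha x hx).continuousAt.continuousWithinAt
      · intro x hx; exact (ha x (interior_subset hx)).differentiableAt.differentiableWithinAt
      · intro x hx; rw [(ha x (interior_subset hx)).deriv]; exact hp x (interior_subset hx)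
    exact this (by simp) ht ht.1
  have s1 := key (fun t => g' t - g' 0 - κ * t) (fun t => g'' t - κ)
    (fun t ht => by
      have := ((h2 t ht).sub_const (g' 0)).sub ((hasDerivAt_id t).const_mul κ)
      rw [mul_one] at this
      exact this)
    (fun t ht => by linarith [h3 t ht])
  have s2 := key (fun t => g t - g' 0 * t - κ / 2 * t ^ 2) (fun t => g' t - g' 0 - κ * t)
    (fun t ht => by
      have := ((h1 t ht).sub ((hasDerivAt_id t).const_mul (g' 0))).sub
        (((hasDerivAt_id t).pow 2).const_mul (κ / 2))
      have e : g' t - g' 0 - κ * t = g' t - g' 0 * 1 - κ / 2 * (↑2 * id t ^ (2 - 1) * 1) := by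
        simp; ring
      rw [e]
      exact this)
    (fun t ht => by have := s1 t ht; simp at this; linarith) 1 (by simp)
  simp at s2
  linarith

set_option maxHeartbeats 1000000 in
lemma disc_local {N : ℕ} {X : Set (Cn N)} (hX : IsOpen X) {ρ : Cn N → ℝ}
    (hρ : ContDiffOn ℝ (⊤ : ℕ∞) ρ X) {x0 : Cn N} (hx0 : x0 ∈ X) (h2 : TwoPosEigen ρ x0)
    {r0 : ℝ} (hr0 : 0 < r0) :
    ∃ σ > 0, ∃ r > 0, ∃ v w : Cn N, ‖v‖ ≤ r0 ∧ ‖w‖ ≤ r0 ∧ ∀ y ∈ ball x0 r,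
      (∀ ζ : ℂ, ‖ζ‖ ≤ 2 → y + pd v w ζ ∈ X) ∧
      ∃ c : ℂ, ‖c‖ ≤ σ / 8 ∧
        ∀ ζ : ℂ, ‖ζ‖ ≤ 2 → ρ y + (c * ζ).re + σ * ‖ζ‖ ^ 2 ≤ ρ (y + pd v w ζ) := by
  have hcd : ∀ x ∈ X, ContDiffAt ℝ (⊤ : ℕ∞) ρ x := fun x hx => hρ.contDiffAt (hX.mem_nhds hx)
  set d1 := fderiv ℝ ρ with hd1
  set d2 := fderiv ℝ d1 with hd2
  have hD1 : ∀ x ∈ X, HasFDerivAt ρ (d1 x) x := fun x hx =>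
    ((hcd x hx).differentiableAt (by simp)).hasFDerivAt
  have hcd1 : ContDiffOn ℝ 1 d1 X := hρ.fderiv_of_isOpen hX (by
    rw [one_add_one_eq_two]; exact WithTop.coe_le_coe.2 le_top)
  have hD2 : ∀ x ∈ X, HasFDerivAt d1 (d2 x) x := fun x hx =>
    ((hcd1.contDiffAt (hX.mem_nhds hx)).differentiableAt (by simp)).hasFDerivAt
  have hc1 : ContinuousOn d1 X := hcd1.continuousOn
  have hc2 : ContinuousOn d2 X := (hcd1.fderiv_of_isOpen hX (m := 0) (by simp)).continuousOn
  obtain ⟨W, hW, hpos⟩ := h2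
  have hsymm : ∀ a b, d2 x0 a b = d2 x0 b a := by
    have := (hcd x0 hx0).isSymmSndFDerivAt (by
      simp only [minSmoothness_of_isRCLikeNormedField]
      exact WithTop.coe_le_coe.2 le_top)
    exact fun a b => this.eq a b
  obtain ⟨v, w, hv, m, hm, hvw⟩ := disc_alg (d1 x0) (d2 x0) hsymm W hW (by
    intro v hv hv0
    have := hpos v hv hv0
    simp only [LeviForm, iteratedFDeriv_two_apply] at this
    simp at this
    linarith)
  -- the function F
  let F : (Cn N × ℝ) × ℂ → ℝ := fun p =>
    d2 p.1.1 (p.2 • v + (p.1.2 * p.2 ^ 2 : ℂ) • w) (p.2 • v + (p.1.2 * p.2 ^ 2 : ℂ) • w)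
      + 2 * d1 p.1.1 (p.2 ^ 2 • w)
  have hF : ∀ u : ℂ, ContinuousAt F ((x0, 0), u) := by
    intro u
    have a1 : ContinuousAt (fun p : (Cn N × ℝ) × ℂ => d2 p.1.1) ((x0, 0), u) :=
      ContinuousAt.comp (f := fun p : (Cn N × ℝ) × ℂ => p.1.1) (g := d2)
        (hc2.continuousAt (hX.mem_nhds hx0)) (by fun_prop)
    have a2 : ContinuousAt (fun p : (Cn N × ℝ) × ℂ => d1 p.1.1) ((x0, 0), u) :=
      ContinuousAt.comp (f := fun p : (Cn N × ℝ) × ℂ => p.1.1) (g := d1)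
        (hc1.continuousAt (hX.mem_nhds hx0)) (by fun_prop)
    have a3 : ContinuousAt (fun p : (Cn N × ℝ) × ℂ =>
      p.2 • v + (p.1.2 * p.2 ^ 2 : ℂ) • w) ((x0, 0), u) := by fun_prop
    have a4 : ContinuousAt (fun p : (Cn N × ℝ) × ℂ => p.2 ^ 2 • w) ((x0, 0), u) := by fun_prop
    exact ((a1.clm_apply a3).clm_apply a3).add ((a2.clm_apply a4).const_mul 2)
  have hev : ∀ᶠ p : Cn N × ℝ in nhds (x0, 0), ∀ u ∈ sphere (0:ℂ) 1, m / 2 < F (p, u) := by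
    apply (isCompact_sphere (0:ℂ) 1).eventually_forall_of_forall_eventually
    intro u hu
    apply (hF u).eventually (lt_mem_nhds _)
    have := hvw u
    simp only [mem_sphere_iff_norm, sub_zero] at hu
    simp only [F]
    simp [hu] at this ⊢
    rw [this]; linarith
  obtain ⟨r1, hr1, hr1F⟩ := Metric.eventually_nhds_iff_ball.1
    (hev.and ((hX.mem_nhds hx0 |> fun h => (continuous_fst.tendsto (x0, (0:ℝ))).eventually h)))
  -- choose s
  obtain ⟨s, hs, hs1, hsr, hsv, hsw⟩ : ∃ s > 0, s ≤ 1 ∧ 4 * s < r1 ∧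
      s * (4 * (‖v‖ + ‖w‖) + 1) < r1 / 2 ∧ s * (‖v‖ + ‖w‖) ≤ r0 := by
    have hp : 0 < 4 * (‖v‖ + ‖w‖) + 1 := by positivity
    refine ⟨min (min 1 (r1 / 8)) (min (r1 / 4 / (4 * (‖v‖ + ‖w‖) + 1))
      (r0 / (4 * (‖v‖ + ‖w‖) + 1))), by positivity, ?_, ?_, ?_, ?_⟩
    · exact (min_le_left _ _).trans (min_le_left _ _)
    · have := (min_le_left _ (min (r1 / 4 / (4 * (‖v‖ + ‖w‖) + 1))
        (r0 / (4 * (‖v‖ + ‖w‖) + 1)))).trans (min_le_right 1 (r1 / 8))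
      linarith
    · have := (min_le_right (min 1 (r1 / 8)) _).trans
        (min_le_left (r1 / 4 / (4 * (‖v‖ + ‖w‖) + 1)) (r0 / (4 * (‖v‖ + ‖w‖) + 1)))
      rw [le_div_iff₀ hp] at this
      linarith
    · have := (min_le_right (min 1 (r1 / 8)) _).trans
        (min_le_right (r1 / 4 / (4 * (‖v‖ + ‖w‖) + 1)) (r0 / (4 * (‖v‖ + ‖w‖) + 1)))
      rw [le_div_iff₀ hp] at this
      refine le_trans ?_ this
      apply mul_le_mul_of_nonneg_left
      · linarith [norm_nonneg v, norm_nonneg w]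
      · positivity
  have hcev : ∀ᶠ y in nhds x0, ‖dpart (d1 y) v‖ < s * m / 32 := by
    have : ContinuousAt (fun y => ‖dpart (d1 y) v‖) x0 := by
      have e : (fun y => ‖dpart (d1 y) v‖)
        = fun y => ‖((d1 y v : ℝ) : ℂ) - ((d1 y (I • v) : ℝ) : ℂ) * I‖ := by
        ext y; congr 1; apply Complex.ext <;> simp [dpart]
      rw [e]
      have := hc1.continuousAt (hX.mem_nhds hx0)
      have b1 := this.clm_apply (continuousAt_const (y := v))
      have b2 := this.clm_apply (continuousAt_const (y := I • v))
      exact ((Complex.continuous_ofReal.continuousAt.comp b1).sub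
        ((Complex.continuous_ofReal.continuousAt.comp b2).mul_const I)).norm
    apply this.eventually (gt_mem_nhds _)
    have z1 : dpart (d1 x0) v = 0 := by
      apply Complex.ext
      · simpa [dpart] using hv 1
      · simpa [dpart] using hv I
    show ‖dpart (d1 x0) v‖ < s * m / 32
    rw [z1]; simp; positivity
  obtain ⟨r2, hr2, hr2c⟩ := Metric.eventually_nhds_iff_ball.1 hcev
  refine ⟨s ^ 2 * m / 4, by positivity, min r2 (r1 / 2), by positivity, s • v, s ^ 2 • w,
    ?_, ?_, ?_⟩
  · rw [norm_smul, Real.norm_of_nonneg hs.le]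
    nlinarith [norm_nonneg w]
  · rw [norm_smul, Real.norm_of_nonneg (by positivity)]
    nlinarith [norm_nonneg v, norm_nonneg w, mul_nonneg hs.le (norm_nonneg w)]
  intro y hy
  have hyr2 : y ∈ ball x0 r2 := ball_subset_ball (min_le_left _ _) hy
  have hyr1 : y ∈ ball x0 (r1 / 2) := ball_subset_ball (min_le_right _ _) hy
  have hin : ∀ ζ : ℂ, ‖ζ‖ ≤ 2 → y + pd (s • v) (s ^ 2 • w) ζ ∈ ball x0 r1 := by
    intro ζ hζ
    rw [mem_ball, dist_eq_norm] at hyr1 ⊢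
    have e1 : ‖pd (s • v) (s ^ 2 • w) ζ‖ ≤ s * (4 * (‖v‖ + ‖w‖) + 1) := by
      unfold pd
      refine (norm_add_le _ _).trans ?_
      rw [norm_smul, norm_smul, norm_smul, norm_smul, norm_pow, norm_pow,
        Real.norm_of_nonneg hs.le]
      have e2 : ‖ζ‖ ^ 2 ≤ 4 := by nlinarith [norm_nonneg ζ]
      have e3 : s ^ 2 ≤ s := by nlinarith
      have : ‖ζ‖ * (s * ‖v‖) ≤ 2 * (s * ‖v‖) := by gcongr
      have : ‖ζ‖ ^ 2 * (s ^ 2 * ‖w‖) ≤ 4 * (s * ‖w‖) := by gcongr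
      nlinarith [mul_nonneg hs.le (norm_nonneg v)]
    calc ‖y + pd (s • v) (s ^ 2 • w) ζ - x0‖ ≤ ‖y - x0‖ + ‖pd (s • v) (s ^ 2 • w) ζ‖ := by
          rw [add_sub_right_comm]; exact norm_add_le _ _
      _ < r1 := by linarith
  have hmem : ∀ p ∈ ball x0 r1, ∀ τ : ℝ, |τ| < r1 → (p, τ) ∈ ball (x0, (0:ℝ)) r1 := by
    intro p hp τ hτ
    rw [mem_ball, Prod.dist_eq]
    simpa using ⟨hp, hτ⟩
  have hinX : ∀ p ∈ ball x0 r1, p ∈ X := fun p hp =>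
    (hr1F _ (hmem p hp 0 (by simpa using hr1))).2
  refine ⟨fun ζ hζ => hinX _ (hin ζ hζ), s * dpart (d1 y) v, ?_, ?_⟩
  · rw [norm_mul, Complex.norm_real, Real.norm_of_nonneg hs.le]
    have := hr2c y hyr2
    nlinarith
  intro ζ hζ
  by_cases hζ0 : ζ = 0
  · simp [hζ0, pd]
  have hζp : 0 < ‖ζ‖ := norm_pos_iff.2 hζ0
  let γ : ℝ → Cn N := fun t => y + (t • (ζ • s • v) + t ^ 2 • (ζ ^ 2 • s ^ 2 • w))
  let γ' : ℝ → Cn N := fun t => ζ • s • v + (2 * t) • (ζ ^ 2 • s ^ 2 • w)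
  have hγe : ∀ t : ℝ, γ t = y + pd (s • v) (s ^ 2 • w) ((t:ℂ) * ζ) := by
    intro t
    simp only [γ, pd, mul_pow, mul_smul]
    norm_cast
  have hγ : ∀ t, HasDerivAt γ (γ' t) t := by
    intro t
    have := (((hasDerivAt_id t).smul_const (ζ • s • v)).add
      (((hasDerivAt_id t).pow 2).smul_const (ζ ^ 2 • s ^ 2 • w))).const_add y
    have e : γ' t = (1:ℝ) • ζ • s • v + (↑2 * id t ^ (2 - 1) * 1) • ζ ^ 2 • s ^ 2 • w := by
      simp [γ']
    rw [e]
    exact this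
  have hγ2 : ∀ t, HasDerivAt γ' ((2:ℝ) • (ζ ^ 2 • s ^ 2 • w)) t := by
    intro t
    have := (((hasDerivAt_id t).const_mul 2).smul_const (ζ ^ 2 • s ^ 2 • w)).const_add (ζ • s • v)
    rw [mul_one] at this
    exact this
  have hγin : ∀ t ∈ Icc (0:ℝ) 1, γ t ∈ ball x0 r1 := by
    intro t ht
    rw [hγe]
    apply hin
    rw [norm_mul, Complex.norm_real, Real.norm_of_nonneg ht.1]
    nlinarith [ht.2]
  have main := second_order_lower (g := fun t => ρ (γ t)) (g' := fun t => d1 (γ t) (γ' t))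
    (g'' := fun t => d2 (γ t) (γ' t) (γ' t) + d1 (γ t) ((2:ℝ) • (ζ ^ 2 • s ^ 2 • w)))
    (κ := s ^ 2 * ‖ζ‖ ^ 2 * (m / 2))
    (fun t ht => (hD1 _ (hinX _ (hγin t ht))).comp_hasDerivAt t (hγ t))
    (fun t ht => by
      have a := (hD2 _ (hinX _ (hγin t ht))).comp_hasDerivAt t (hγ t)
      exact a.clm_apply (hγ2 t))
    (fun t ht => by
      set u : ℂ := ζ / ‖ζ‖ with hu
      have hζu : ζ = (‖ζ‖ : ℂ) * u := by
        rw [hu]; field_simp [Complex.ofReal_ne_zero.2 hζp.ne']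
      have hFu := (hr1F (γ t, 2 * t * s * ‖ζ‖) (hmem _ (hγin t ht) _ (by
        rw [abs_of_nonneg (by have := ht.1; positivity)]
        have : t * s * ‖ζ‖ ≤ 1 * s * 2 := by
          have := ht.2; have := ht.1
          gcongr
        linarith))).1 u (by
          rw [mem_sphere_iff_norm, sub_zero, hu, norm_div]
          simp [hζp.ne'])
      have eA : γ' t = (s * ‖ζ‖) • (u • v + (((2 * t * s * ‖ζ‖ : ℝ) : ℂ) * u ^ 2 : ℂ) • w) := by
        simp only [γ']
        nth_rw 1 [hζu]
        nth_rw 2 [hζu]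
        ext j
        simp
        ring
      have eB : (2:ℝ) • (ζ ^ 2 • s ^ 2 • w) = (2 * (s * ‖ζ‖) ^ 2) • (u ^ 2 • w) := by
        nth_rw 1 [hζu]
        ext j
        simp
        ring
      simp only [F] at hFu
      rw [eA, eB]
      simp only [map_smul, _root_.smul_apply, smul_eq_mul]
      nlinarith [mul_lt_mul_of_pos_left hFu (by positivity : 0 < (s * ‖ζ‖) ^ 2)])
  have e0 : γ 0 = y := by simp [γ]
  have e1 : γ 1 = y + pd (s • v) (s ^ 2 • w) ζ := by rw [hγe]; simp
  have e2 : d1 y (γ' 0) = (s * dpart (d1 y) v * ζ).re := by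
    have : γ' 0 = (s * ζ : ℂ) • v := by
      simp only [γ']; ext j; simp; ring
    rw [this, dpart_re]; congr 1; ring
  simp only [e0, e1, e2] at main
  linarith

lemma disc_unif {N : ℕ} {X : Set (Cn N)} (hX : IsOpen X) {ρ : Cn N → ℝ}
    (hρ : ContDiffOn ℝ (⊤ : ℕ∞) ρ X) {L : Set (Cn N)} (hL : IsCompact L) (hLX : L ⊆ X)
    (h2 : ∀ x ∈ L, TwoPosEigen ρ x) {r0 : ℝ} (hr0 : 0 < r0) :
    ∃ σ > 0, ∃ r > 0, ∀ x ∈ L, ∃ v w : Cn N, ‖v‖ ≤ r0 ∧ ‖w‖ ≤ r0 ∧ ∀ y ∈ ball x r,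
      (∀ ζ : ℂ, ‖ζ‖ ≤ 2 → y + pd v w ζ ∈ X) ∧
      (∀ ζ : ℂ, 2 / 5 ≤ ‖ζ‖ → ‖ζ‖ ≤ 2 → ρ y + σ ≤ ρ (y + pd v w ζ)) ∧
      ∃ c : ℂ, ∀ ζ : ℂ, ‖ζ‖ ≤ 2 → 0 ≤ (c * ζ).re →
        ρ y + σ * ‖ζ‖ ^ 2 ≤ ρ (y + pd v w ζ) := by
  refine hL.induction_on (p := fun S => ∃ σ > 0, ∃ r > 0, ∀ x ∈ S, ∃ v w : Cn N,
      ‖v‖ ≤ r0 ∧ ‖w‖ ≤ r0 ∧ ∀ y ∈ ball x r,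
      (∀ ζ : ℂ, ‖ζ‖ ≤ 2 → y + pd v w ζ ∈ X) ∧
      (∀ ζ : ℂ, 2 / 5 ≤ ‖ζ‖ → ‖ζ‖ ≤ 2 → ρ y + σ ≤ ρ (y + pd v w ζ)) ∧
      ∃ c : ℂ, ∀ ζ : ℂ, ‖ζ‖ ≤ 2 → 0 ≤ (c * ζ).re →
        ρ y + σ * ‖ζ‖ ^ 2 ≤ ρ (y + pd v w ζ)) ?_ ?_ ?_ ?_
  · exact ⟨1, one_pos, 1, one_pos, by simp⟩
  · rintro S T hST ⟨σ, hσ, r, hr, h⟩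
    exact ⟨σ, hσ, r, hr, fun x hx => h x (hST hx)⟩
  · rintro S T ⟨σ, hσ, r, hr, h⟩ ⟨σ', hσ', r', hr', h'⟩
    have gen : ∀ (σ σ1 r r1 : ℝ) (x : Cn N), σ1 ≤ σ → r1 ≤ r → (∃ v w : Cn N,
      ‖v‖ ≤ r0 ∧ ‖w‖ ≤ r0 ∧ ∀ y ∈ ball x r,
      (∀ ζ : ℂ, ‖ζ‖ ≤ 2 → y + pd v w ζ ∈ X) ∧
      (∀ ζ : ℂ, 2 / 5 ≤ ‖ζ‖ → ‖ζ‖ ≤ 2 → ρ y + σ ≤ ρ (y + pd v w ζ)) ∧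
      ∃ c : ℂ, ∀ ζ : ℂ, ‖ζ‖ ≤ 2 → 0 ≤ (c * ζ).re →
        ρ y + σ * ‖ζ‖ ^ 2 ≤ ρ (y + pd v w ζ)) → ∃ v w : Cn N,
      ‖v‖ ≤ r0 ∧ ‖w‖ ≤ r0 ∧ ∀ y ∈ ball x r1,
      (∀ ζ : ℂ, ‖ζ‖ ≤ 2 → y + pd v w ζ ∈ X) ∧
      (∀ ζ : ℂ, 2 / 5 ≤ ‖ζ‖ → ‖ζ‖ ≤ 2 → ρ y + σ1 ≤ ρ (y + pd v w ζ)) ∧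
      ∃ c : ℂ, ∀ ζ : ℂ, ‖ζ‖ ≤ 2 → 0 ≤ (c * ζ).re →
        ρ y + σ1 * ‖ζ‖ ^ 2 ≤ ρ (y + pd v w ζ) := by
      rintro σ σ1 r r1 x h1 h2 ⟨v, w, hv, hw, h⟩
      refine ⟨v, w, hv, hw, fun y hy => ?_⟩
      obtain ⟨a1, a2, c, a3⟩ := h y (ball_subset_ball h2 hy)
      refine ⟨a1, fun ζ z1 z2 => by linarith [a2 ζ z1 z2], c, fun ζ z1 z2 => ?_⟩
      have := a3 ζ z1 z2
      nlinarith [sq_nonneg ‖ζ‖]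
    refine ⟨min σ σ', by positivity, min r r', by positivity, ?_⟩
    rintro x (hx | hx)
    · exact gen _ _ _ _ x (min_le_left _ _) (min_le_left _ _) (h x hx)
    · exact gen _ _ _ _ x (min_le_right _ _) (min_le_right _ _) (h' x hx)
  · intro x hx
    obtain ⟨σ, hσ, r, hr, v, w, hv, hw, h⟩ := disc_local hX hρ (hLX hx) (h2 x hx) hr0
    refine ⟨ball x (r / 2), mem_nhdsWithin_of_mem_nhds (ball_mem_nhds _ (half_pos hr)),
      σ / 10, by positivity, r / 2, by positivity, ?_⟩
    intro x' hx'
    refine ⟨v, w, hv, hw, fun y hy => ?_⟩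
    have hyx : y ∈ ball x r := by
      rw [mem_ball] at hx' hy ⊢
      linarith [dist_triangle y x' x]
    obtain ⟨a1, c, hc, a2⟩ := h y hyx
    refine ⟨a1, fun ζ z1 z2 => ?_, c, fun ζ z1 z2 => ?_⟩
    · have := a2 ζ z2
      have e1 : -(σ / 8 * ‖ζ‖) ≤ (c * ζ).re := by
        have := Complex.abs_re_le_norm (c * ζ)
        rw [norm_mul] at this
        have e : ‖c‖ * ‖ζ‖ ≤ σ / 8 * ‖ζ‖ := by gcongr
        linarith [neg_abs_le (c * ζ).re]
      have : σ / 10 ≤ σ * (‖ζ‖ ^ 2 - ‖ζ‖ / 8) := by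
        have : 1 / 10 ≤ ‖ζ‖ ^ 2 - ‖ζ‖ / 8 := by nlinarith
        nlinarith
      nlinarith
    · have := a2 ζ z1
      nlinarith [sq_nonneg ‖ζ‖, mul_nonneg hσ.le (sq_nonneg ‖ζ‖)]


/-- real part of `(z - q) * conj n`. -/
def nre (n q z : ℂ) : ℝ := (z - q).re * n.re + (z - q).im * n.im
/-- imaginary part of `(z - q) * conj n`. -/
def nim (n q z : ℂ) : ℝ := (z - q).im * n.re - (z - q).re * n.im

structure Geo (D : Set ℂ) (A B r1 : ℝ) (n : ℂ → ℂ) : Prop where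
  A_ge : 1 ≤ A
  B_nonneg : 0 ≤ B
  r1_pos : 0 < r1
  norm_n : ∀ q ∈ frontier D, ‖n q‖ = 1
  lip : ∀ q ∈ frontier D, ∀ q' ∈ frontier D, ‖n q - n q'‖ ≤ B * ‖q - q'‖
  upper : ∀ q ∈ frontier D, ∀ z ∈ closure D, nre (n q) q z ≤ A * ‖z - q‖ ^ 2
  bd : ∀ q ∈ frontier D, ∀ z ∈ frontier D, |nre (n q) q z| ≤ A * ‖z - q‖ ^ 2
  inner : ∀ q ∈ frontier D, ∀ z, ‖z - q‖ < r1 → nre (n q) q z < -(A * ‖z - q‖ ^ 2) → z ∈ D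

lemma nre_nim_sq {n q z : ℂ} (hn : ‖n‖ = 1) : nre n q z ^ 2 + nim n q z ^ 2 = ‖z - q‖ ^ 2 := by
  have : n.re * n.re + n.im * n.im = 1 := by
    rw [← Complex.normSq_apply, ← Complex.sq_norm, hn]; norm_num
  rw [Complex.sq_norm, Complex.normSq_apply]
  unfold nre nim
  linear_combination ((z - q).re ^ 2 + (z - q).im ^ 2) * this

lemma abs_nre_le {n q z : ℂ} (hn : ‖n‖ = 1) : |nre n q z| ≤ ‖z - q‖ := by
  apply abs_le_of_sq_le_sq _ (norm_nonneg _)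
  nlinarith [nre_nim_sq (q := q) (z := z) hn]

lemma abs_nim_le {n q z : ℂ} (hn : ‖n‖ = 1) : |nim n q z| ≤ ‖z - q‖ := by
  apply abs_le_of_sq_le_sq _ (norm_nonneg _)
  nlinarith [nre_nim_sq (q := q) (z := z) hn]

lemma norm_le_nre_nim {n q z : ℂ} (hn : ‖n‖ = 1) : ‖z - q‖ ≤ |nre n q z| + |nim n q z| := by
  have h := nre_nim_sq (q := q) (z := z) hn
  refine abs_le_of_sq_le_sq' ?_ (by positivity) |>.2
  rw [← h]
  nlinarith [sq_abs (nre n q z), sq_abs (nim n q z), abs_nonneg (nre n q z),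
    abs_nonneg (nim n q z), mul_nonneg (abs_nonneg (nre n q z)) (abs_nonneg (nim n q z))]


/-- gradient of `v` as a complex number -/
def grd (l : ℂ →L[ℝ] ℝ) : ℂ := ⟨l 1, l I⟩

lemma grd_apply (l : ℂ →L[ℝ] ℝ) (w : ℂ) : l w = w.re * (grd l).re + w.im * (grd l).im := by
  have : w = w.re • (1:ℂ) + w.im • I := by
    apply Complex.ext <;> simp
  conv_lhs => rw [this]
  rw [map_add, map_smul, map_smul]; simp [grd]

lemma grd_sub_le (l l' : ℂ →L[ℝ] ℝ) : ‖grd l - grd l'‖ ≤ 2 * ‖l - l'‖ := by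
  have e1 : (grd l - grd l').re = (l - l') 1 := by simp [grd]
  have e2 : (grd l - grd l').im = (l - l') I := by simp [grd]
  have h1 := (l - l').le_opNorm 1
  have h2 := (l - l').le_opNorm I
  have := Complex.norm_le_abs_re_add_abs_im (grd l - grd l')
  rw [e1, e2] at this
  simp only [Real.norm_eq_abs, norm_one, Complex.norm_I, mul_one] at h1 h2
  linarith

lemma geo_exists {D : Set ℂ} (hDo : IsOpen D) (hDb : Bornology.IsBounded D)
    (h : SmoothlyBounded D) : ∃ A B r1 n, Geo D A B r1 n := by
  obtain ⟨V, hVo, hfV, v, hv, hDV, hfr, hd⟩ := h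
  have hcf : IsCompact (frontier D) := by
    refine Metric.isCompact_of_isClosed_isBounded isClosed_frontier
      (hDb.closure.subset frontier_subset_closure)
  obtain ⟨s, hs, hsV⟩ := hcf.exists_cthickening_subset_open hVo hfV
  have hcK : IsCompact (cthickening s (frontier D)) := hcf.cthickening
  set d1 := fderiv ℝ v with hd1
  set d2 := fderiv ℝ d1 with hd2
  have hcd1 : ContDiffOn ℝ 1 d1 V := hv.fderiv_of_isOpen hVo (by
    rw [one_add_one_eq_two]; exact WithTop.coe_le_coe.2 le_top)
  have hD1 : ∀ x ∈ V, HasFDerivAt v (d1 x) x := fun x hx =>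
    ((hv.contDiffAt (hVo.mem_nhds hx)).differentiableAt (by simp)).hasFDerivAt
  have hD2 : ∀ x ∈ V, HasFDerivAt d1 (d2 x) x := fun x hx =>
    ((hcd1.contDiffAt (hVo.mem_nhds hx)).differentiableAt (by simp)).hasFDerivAt
  have hc1 : ContinuousOn d1 V := hcd1.continuousOn
  have hc2 : ContinuousOn d2 V := (hcd1.fderiv_of_isOpen hVo (m := 0) (by simp)).continuousOn
  obtain ⟨C, hC⟩ : ∃ C, ∀ x ∈ cthickening s (frontier D), ‖d2 x‖ ≤ C := by
    have hc2n := (hcd1.fderiv_of_isOpen hVo (m := 0) (by simp)).continuousOn.norm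
    obtain ⟨C, hC⟩ := hcK.bddAbove_image (hc2n.mono hsV)
    exact ⟨C, fun x hx => hC (mem_image_of_mem _ hx)⟩
  have hballV : ∀ q ∈ frontier D, ∀ z, ‖z - q‖ < s → z ∈ cthickening s (frontier D) := by
    intro q hq z hz
    exact closedBall_subset_cthickening hq s (by rw [mem_closedBall, dist_eq_norm]; exact hz.le)
  have hgc : ContinuousOn (fun q => ‖grd (d1 q)‖) (frontier D) := by
    apply ContinuousOn.norm
    rw [Metric.continuousOn_iff]
    intro b hb ε hε
    obtain ⟨δ, hδ, h⟩ := Metric.continuousOn_iff.1 (hc1.mono hfV) b hb (ε / 2) (half_pos hε)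
    refine ⟨δ, hδ, fun a ha hab => ?_⟩
    have := h a ha hab
    rw [dist_eq_norm] at this ⊢
    linarith [grd_sub_le (d1 a) (d1 b)]
  have hgne : ∀ q ∈ frontier D, 0 < ‖grd (d1 q)‖ := by
    intro q hq
    rw [norm_pos_iff]
    intro h0
    apply hd q hq
    ext w
    have := grd_apply (d1 q) w
    rw [h0] at this
    simpa using this
  obtain ⟨c0, hc0, hc0g⟩ : ∃ c0 > 0, ∀ q ∈ frontier D, c0 ≤ ‖grd (d1 q)‖ := by
    rcases (frontier D).eq_empty_or_nonempty with he | hne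
    · exact ⟨1, one_pos, by simp [he]⟩
    · obtain ⟨q0, hq0, hm⟩ := hcf.exists_isMinOn hne hgc
      exact ⟨_, hgne q0 hq0, fun q hq => hm hq⟩
  have hC0 : 0 ≤ |C| := abs_nonneg C
  have hlip : ∀ q ∈ frontier D, ∀ z, ‖z - q‖ < s → ‖d1 z - d1 q‖ ≤ |C| * ‖z - q‖ := by
    intro q hq z hz
    apply (convex_ball q s).norm_image_sub_le_of_norm_hasFDerivWithin_le (f' := d2)
      (fun x hx => (hD2 x (hsV (hballV q hq x (by
        rwa [mem_ball, dist_eq_norm] at hx)))).hasFDerivWithinAt)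
      (fun x hx => (hC x (hballV q hq x (by
        rwa [mem_ball, dist_eq_norm] at hx))).trans (le_abs_self C))
      (by simpa using hs) (by rwa [mem_ball, dist_eq_norm])
  have htay : ∀ q ∈ frontier D, ∀ z, ‖z - q‖ < s →
      |v z - d1 q (z - q)| ≤ |C| * ‖z - q‖ ^ 2 := by
    intro q hq z hz
    have hvq : v q = 0 := by rw [hfr] at hq; exact hq.2
    have := (convex_closedBall q ‖z - q‖).norm_image_sub_le_of_norm_hasFDerivWithin_le'
      (f := v) (f' := d1) (φ := d1 q) (C := |C| * ‖z - q‖) (x := q) (y := z)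
      (fun x hx => (hD1 x (hsV (hballV q hq x (by
        rw [mem_closedBall, dist_eq_norm] at hx; linarith)))).hasFDerivWithinAt)
      (fun x hx => by
        rw [mem_closedBall, dist_eq_norm] at hx
        refine (hlip q hq x (by linarith)).trans ?_
        gcongr)
      (by simp) (by simp [dist_eq_norm])
    rw [hvq, sub_zero, Real.norm_eq_abs] at this
    linarith
  let n : ℂ → ℂ := fun q => grd (d1 q) / ‖grd (d1 q)‖
  have hnre : ∀ q ∈ frontier D, ∀ z, d1 q (z - q) = ‖grd (d1 q)‖ * nre (n q) q z := by
    intro q hq z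
    have := (hgne q hq).ne'
    rw [grd_apply]
    simp only [nre, n, Complex.div_ofReal_re, Complex.div_ofReal_im]
    field_simp
  have hn1 : ∀ q ∈ frontier D, ‖n q‖ = 1 := by
    intro q hq
    simp only [n, norm_div, Complex.norm_real, norm_norm]
    exact div_self (hgne q hq).ne'
  have hA : |C| ≤ c0 * (|C| / c0 + 1 / s + 1) := by
    rw [mul_add, mul_add, mul_div_cancel₀ _ hc0.ne']
    have : 0 ≤ c0 * (1 / s) := by positivity
    linarith
  have hA2 : ∀ z q : ℂ, s ≤ ‖z - q‖ → ‖z - q‖ ≤ (|C| / c0 + 1 / s + 1) * ‖z - q‖ ^ 2 := by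
    intro z q hz
    have h1 : 1 ≤ (1 / s) * ‖z - q‖ := by rw [one_div, inv_mul_eq_div, le_div_iff₀ hs]; linarith
    have h2 : 0 ≤ |C| / c0 := by positivity
    have h3 : 0 ≤ ‖z - q‖ := norm_nonneg _
    nlinarith [mul_nonneg h2 (sq_nonneg ‖z - q‖), sq_nonneg ‖z - q‖]
  have hcl : ∀ z ∈ closure D, z ∈ V → v z ≤ 0 := by
    intro z hz hzV
    by_cases hzf : z ∈ frontier D
    · rw [hfr] at hzf; exact hzf.2.le
    · have : z ∈ D := by
        rw [frontier, hDo.interior_eq] at hzf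
        by_contra h
        exact hzf ⟨hz, h⟩
      have : z ∈ D ∩ V := ⟨this, hzV⟩
      rw [hDV] at this; exact this.2.le
  refine ⟨|C| / c0 + 1 / s + 1, 4 * |C| / c0 + 2 / s, s, n, ?_, by positivity, hs, hn1,
    ?_, ?_, ?_, ?_⟩
  · have : 0 ≤ |C| / c0 + 1 / s := by positivity
    linarith
  · intro q hq q' hq'
    by_cases hqq : ‖q - q'‖ < s
    · have e1 := hlip q' hq' q hqq
      have e2 := grd_sub_le (d1 q) (d1 q')
      have g1 := hc0g q hq
      have p1 := hgne q hq
      have p2 := hgne q' hq'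
      have e3 : n q - n q' = (grd (d1 q) - grd (d1 q')) / ‖grd (d1 q)‖
          + (((‖grd (d1 q')‖ - ‖grd (d1 q)‖ : ℝ) : ℂ) / ‖grd (d1 q)‖) * n q' := by
        have p1' : (‖grd (d1 q)‖ : ℂ) ≠ 0 := by exact_mod_cast p1.ne'
        have p2' : (‖grd (d1 q')‖ : ℂ) ≠ 0 := by exact_mod_cast p2.ne'
        simp only [n]
        push_cast
        field_simp
        ring
      have e4 : ‖n q - n q'‖ ≤ 2 * ‖grd (d1 q) - grd (d1 q')‖ / ‖grd (d1 q)‖ := by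
        rw [e3]
        refine (norm_add_le _ _).trans ?_
        rw [norm_mul, hn1 q' hq', mul_one, norm_div, norm_div, Complex.norm_real,
          Complex.norm_real, norm_norm, ← add_div]
        gcongr
        have := abs_norm_sub_norm_le (grd (d1 q')) (grd (d1 q))
        rw [norm_sub_rev] at this
        rw [Real.norm_eq_abs]
        linarith
      have e5 : 2 * ‖grd (d1 q) - grd (d1 q')‖ / ‖grd (d1 q)‖ ≤ (4 * |C| / c0) * ‖q - q'‖ := by
        rw [div_mul_eq_mul_div]
        have e6 : 2 * ‖grd (d1 q) - grd (d1 q')‖ ≤ 4 * |C| * ‖q - q'‖ := by linarith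
        exact div_le_div₀ (by positivity) e6 hc0 g1
      have : 0 ≤ 2 / s * ‖q - q'‖ := by positivity
      linarith
    · push Not at hqq
      have e1 : ‖n q - n q'‖ ≤ 2 := by
        refine (norm_sub_le _ _).trans ?_
        rw [hn1 q hq, hn1 q' hq']; norm_num
      have e2 : 2 ≤ 2 / s * ‖q - q'‖ := by
        rw [div_mul_eq_mul_div, le_div_iff₀ hs]; linarith
      have : 0 ≤ 4 * |C| / c0 * ‖q - q'‖ := by positivity
      linarith
  · intro q hq z hz
    by_cases hzs : ‖z - q‖ < s
    · have e1 := (abs_le.1 (htay q hq z hzs)).1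
      have e2 := hcl z hz (hsV (hballV q hq z hzs))
      rw [hnre q hq] at e1
      have p1 := hgne q hq
      have g1 := hc0g q hq
      by_contra hcon
      push Not at hcon
      have k1 := mul_lt_mul_of_pos_left hcon p1
      have k2 : |C| * ‖z - q‖ ^ 2 ≤ ‖grd (d1 q)‖ * ((|C| / c0 + 1 / s + 1) * ‖z - q‖ ^ 2) := by
        rw [← mul_assoc]
        gcongr
        exact hA.trans (by gcongr)
      linarith
    · exact (le_abs_self _).trans ((abs_nre_le (hn1 q hq)).trans (hA2 z q (not_lt.1 hzs)))
  · intro q hq z hz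
    by_cases hzs : ‖z - q‖ < s
    · have e1 := htay q hq z hzs
      have e2 : v z = 0 := by rw [hfr] at hz; exact hz.2
      rw [hnre q hq, e2, zero_sub, abs_neg, abs_mul, abs_norm] at e1
      have p1 := hgne q hq
      have g1 := hc0g q hq
      by_contra hcon
      push Not at hcon
      have k1 := mul_lt_mul_of_pos_left hcon p1
      have k2 : |C| * ‖z - q‖ ^ 2 ≤ ‖grd (d1 q)‖ * ((|C| / c0 + 1 / s + 1) * ‖z - q‖ ^ 2) := by
        rw [← mul_assoc]
        gcongr
        exact hA.trans (by gcongr)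
      linarith
    · exact (abs_nre_le (hn1 q hq)).trans (hA2 z q (not_lt.1 hzs))
  · intro q hq z hzs hlt
    have hzV := hsV (hballV q hq z hzs)
    have e1 := (abs_le.1 (htay q hq z hzs)).2
    rw [hnre q hq] at e1
    have p1 := hgne q hq
    have g1 := hc0g q hq
    have k1 := mul_lt_mul_of_pos_left hlt p1
    have k2 : |C| * ‖z - q‖ ^ 2 ≤ ‖grd (d1 q)‖ * ((|C| / c0 + 1 / s + 1) * ‖z - q‖ ^ 2) := by
      rw [← mul_assoc]
      gcongr
      exact hA.trans (by gcongr)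
    have : z ∈ {z ∈ V | v z < 0} := ⟨hzV, by linarith⟩
    rw [← hDV] at this
    exact this.1

/-- existence of boundary points with prescribed tangential coordinate -/
lemma Geo.cross {D : Set ℂ} (G_open : IsOpen D) {A B r1 : ℝ} {n : ℂ → ℂ} (G : Geo D A B r1 n) {q : ℂ}
    (hq : q ∈ frontier D) {β : ℝ} (hβ : 0 < β) (hβ1 : 2 * A * β < 1) (hβ2 : 2 * β < r1)
    {s : ℝ} (hs : |s| ≤ β) : ∃ z ∈ frontier D, nim (n q) q z = s ∧ ‖z - q‖ ≤ 2 * β := by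
  have hn := G.norm_n q hq
  have hnn : (n q).re * (n q).re + (n q).im * (n q).im = 1 := by
    rw [← Complex.normSq_apply, ← Complex.sq_norm, hn]; norm_num
  let γ : ℝ → ℂ := fun x => q + (⟨x, s⟩ : ℂ) * n q
  have hγre : ∀ x, nre (n q) q (γ x) = x := by
    intro x; simp [nre, γ]; linear_combination x * hnn
  have hγim : ∀ x, nim (n q) q (γ x) = s := by
    intro x; simp [nim, γ]; linear_combination s * hnn
  have hγn : ∀ x, ‖γ x - q‖ ^ 2 = x ^ 2 + s ^ 2 := by
    intro x; rw [← nre_nim_sq hn, hγre, hγim]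
  have hγc : Continuous γ := by
    have : γ = fun x : ℝ => q + ((x:ℂ) + (s:ℂ) * I) * n q := by
      ext x
      simp only [γ]
      congr 2
      apply Complex.ext <;> simp
    rw [this]; fun_prop
  have hs2 : s ^ 2 ≤ β ^ 2 := sq_le_sq' (by linarith [(abs_le.1 hs).1]) (abs_le.1 hs).2
  have hnb : ∀ x, |x| ≤ β → ‖γ x - q‖ ≤ 2 * β := by
    intro x hx
    have hx2 : x ^ 2 ≤ β ^ 2 := sq_le_sq' (by linarith [(abs_le.1 hx).1]) (abs_le.1 hx).2
    by_contra hc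
    push Not at hc
    nlinarith [hγn x, norm_nonneg (γ x - q)]
  have hA := G.A_ge
  have hin : γ (-β) ∈ D := by
    apply G.inner q hq
    · exact (hnb _ (by rw [abs_neg, abs_of_pos hβ])).trans_lt hβ2
    · rw [hγre, hγn]; nlinarith
  have hout : γ β ∉ D := by
    intro h
    have := G.upper q hq _ (subset_closure h)
    rw [hγre, hγn] at this
    nlinarith
  have hpre : IsPreconnected (γ '' Icc (-β) β) :=
    isPreconnected_Icc.image γ hγc.continuousOn
  obtain ⟨z, ⟨x, hx, rfl⟩, hzf⟩ : ((γ '' Icc (-β) β) ∩ frontier D).Nonempty := by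
    by_contra hemp
    rw [not_nonempty_iff_eq_empty] at hemp
    have hsub := (isPreconnected_iff_subset_of_disjoint.1 hpre) D (closure D)ᶜ
      G_open isClosed_closure.isOpen_compl (by
        intro z hz
        by_cases hzD : z ∈ D
        · exact Or.inl hzD
        · refine Or.inr fun hzc => ?_
          have : z ∈ (γ '' Icc (-β) β) ∩ frontier D :=
            ⟨hz, by rw [frontier, G_open.interior_eq]; exact ⟨hzc, hzD⟩⟩
          rw [hemp] at this; exact this)
      (by
        ext z; simp only [mem_inter_iff, mem_compl_iff, mem_empty_iff_false, iff_false]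
        rintro ⟨-, h1, h2⟩
        exact h2 (subset_closure h1))
    rcases hsub with h | h
    · exact hout (h ⟨β, by simp [hβ.le], rfl⟩)
    · exact h ⟨-β, by simp [hβ.le], rfl⟩ (subset_closure hin)
  exact ⟨γ x, hzf, hγim x, hnb x (abs_le.2 ⟨hx.1, hx.2⟩)⟩

/-- local coordinate mapping `D` into the upper half plane -/
def om (r0 : ℝ) (n q z : ℂ) : ℂ := -I * (z - q) / (q + r0 * n - z)

lemma om_facts {A r0 : ℝ} (hr : 0 < r0) (hA : 4 * A * r0 = 1) {n q z : ℂ} (hn : ‖n‖ = 1)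
    (hu : nre n q z ≤ A * ‖z - q‖ ^ 2) :
    r0 ≤ ‖q + r0 * n - z‖ ∧ ‖om r0 n q z‖ = ‖z - q‖ / ‖q + r0 * n - z‖ ∧
    3 / 4 * ‖om r0 n q z‖ ^ 2 ≤ (om r0 n q z).im ∧
    (om r0 n q z).re = r0 * nim n q z / ‖q + r0 * n - z‖ ^ 2 ∧
    (-(A * ‖z - q‖ ^ 2) ≤ nre n q z → (om r0 n q z).im ≤ 5 / 4 * ‖om r0 n q z‖ ^ 2) := by
  have hnn : n.re * n.re + n.im * n.im = 1 := by
    rw [← Complex.normSq_apply, ← Complex.sq_norm, hn]; norm_num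
  have hS : ‖q + r0 * n - z‖ ^ 2 = r0 ^ 2 - 2 * r0 * nre n q z + ‖z - q‖ ^ 2 := by
    rw [Complex.sq_norm, Complex.sq_norm, Complex.normSq_apply, Complex.normSq_apply]
    simp [nre]
    linear_combination r0 ^ 2 * hnn
  have h1 : r0 ≤ ‖q + r0 * n - z‖ := by
    by_contra hc
    push Not at hc
    have : 2 * r0 * nre n q z ≤ 2 * r0 * (A * ‖z - q‖ ^ 2) := by gcongr
    have e : 2 * r0 * (A * ‖z - q‖ ^ 2) = ‖z - q‖ ^ 2 / 2 := by
      linear_combination ‖z - q‖ ^ 2 / 2 * hA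
    nlinarith [norm_nonneg (q + r0 * n - z), sq_nonneg ‖z - q‖]
  have hSp : 0 < ‖q + r0 * n - z‖ := hr.trans_le h1
  have h2 : ‖om r0 n q z‖ = ‖z - q‖ / ‖q + r0 * n - z‖ := by simp [om]
  have him : (om r0 n q z).im = (‖z - q‖ ^ 2 - r0 * nre n q z) / ‖q + r0 * n - z‖ ^ 2 := by
    rw [om, Complex.div_im, ← Complex.sq_norm, ← sub_div]
    congr 1
    rw [Complex.sq_norm, Complex.normSq_apply]
    simp [nre]
    ring
  have hre : (om r0 n q z).re = r0 * nim n q z / ‖q + r0 * n - z‖ ^ 2 := by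
    rw [om, Complex.div_re, ← Complex.sq_norm, ← add_div]
    congr 1
    simp [nim]
    ring
  refine ⟨h1, h2, ?_, hre, ?_⟩
  · rw [him, h2, div_pow, mul_div_assoc']
    gcongr
    have : r0 * nre n q z ≤ r0 * (A * ‖z - q‖ ^ 2) := by gcongr
    have e : r0 * (A * ‖z - q‖ ^ 2) = ‖z - q‖ ^ 2 / 4 := by
      linear_combination ‖z - q‖ ^ 2 / 4 * hA
    linarith
  · intro hl
    rw [him, h2, div_pow, mul_div_assoc']
    gcongr
    have : r0 * (-(A * ‖z - q‖ ^ 2)) ≤ r0 * nre n q z := by gcongr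
    have e : r0 * (A * ‖z - q‖ ^ 2) = ‖z - q‖ ^ 2 / 4 := by
      linear_combination ‖z - q‖ ^ 2 / 4 * hA
    linarith

lemma om_lip {D : Set ℂ} {A B r1 : ℝ} {n : ℂ → ℂ} (G : Geo D A B r1 n) {r0 : ℝ} (hr : 0 < r0)
    (hA : 4 * A * r0 = 1) {q q' z : ℂ} (hq : q ∈ frontier D) (hq' : q' ∈ frontier D)
    (hz : z ∈ closure D) :
    ‖om r0 (n q) q z - om r0 (n q') q' z‖ ≤ (2 * B + 1 / r0) * ‖q - q'‖ := by
  obtain ⟨h1, -⟩ := om_facts hr hA (G.norm_n q hq) (G.upper q hq z hz)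
  obtain ⟨h1', -⟩ := om_facts hr hA (G.norm_n q' hq') (G.upper q' hq' z hz)
  set a := q + r0 * n q - z with ha
  set a' := q' + r0 * n q' - z with ha'
  have a0 : a ≠ 0 := norm_pos_iff.1 (hr.trans_le h1)
  have a0' : a' ≠ 0 := norm_pos_iff.1 (hr.trans_le h1')
  have e : om r0 (n q) q z - om r0 (n q') q' z
      = -I * r0 * ((n q - n q') / a + n q' * (a' - a) / (a * a')) := by
    have e1 : om r0 (n q) q z = I - I * r0 * n q / a := by
      rw [om, ← ha, eq_sub_iff_add_eq, ← add_div, div_eq_iff a0, ha]; ring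
    have e2 : om r0 (n q') q' z = I - I * r0 * n q' / a' := by
      rw [om, ← ha', eq_sub_iff_add_eq, ← add_div, div_eq_iff a0', ha']; ring
    rw [e1, e2]
    field_simp
    ring
  have hl := G.lip q hq q' hq'
  have haa : ‖a' - a‖ ≤ ‖q - q'‖ + r0 * (B * ‖q - q'‖) := by
    have : a' - a = -(q - q') - r0 * (n q - n q') := by rw [ha, ha']; ring
    rw [this]
    refine (norm_sub_le _ _).trans ?_
    rw [norm_neg, norm_mul, Complex.norm_real, Real.norm_of_nonneg hr.le]
    gcongr
  rw [e, norm_mul, norm_mul, norm_neg, Complex.norm_I, one_mul, Complex.norm_real,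
    Real.norm_of_nonneg hr.le]
  have k1 : ‖(n q - n q') / a‖ ≤ B * ‖q - q'‖ / r0 := by
    have := G.B_nonneg
    rw [norm_div]; gcongr
  have k2 : ‖n q' * (a' - a) / (a * a')‖ ≤ (‖q - q'‖ + r0 * (B * ‖q - q'‖)) / (r0 * r0) := by
    have := G.B_nonneg
    rw [norm_div, norm_mul, norm_mul, G.norm_n q' hq', one_mul]
    gcongr
  calc r0 * ‖(n q - n q') / a + n q' * (a' - a) / (a * a')‖
      ≤ r0 * (B * ‖q - q'‖ / r0 + (‖q - q'‖ + r0 * (B * ‖q - q'‖)) / (r0 * r0)) := by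
        gcongr
        exact (norm_add_le _ _).trans (add_le_add k1 k2)
    _ = (2 * B + 1 / r0) * ‖q - q'‖ := by field_simp; ring


/-- inverse Joukowski map on the upper half plane -/
def jk (ζ : ℂ) : ℂ := ζ * (1 + exp (log (1 - (ζ ^ 2)⁻¹) / 2))

lemma jk_slit {ζ : ℂ} (h : 0 < ζ.im) : 1 - (ζ ^ 2)⁻¹ ∈ slitPlane := by
  have h0 : ζ ≠ 0 := by rintro rfl; simp at h
  rw [mem_slitPlane_iff]
  by_contra hc
  push Not at hc
  obtain ⟨h1, h2⟩ := hc
  set w := (ζ ^ 2)⁻¹ with hw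
  have hwi : w.im = 0 := by simpa using h2
  have hwr : 1 ≤ w.re := by simpa using h1
  have hw' : w = (w.re : ℂ) := by apply Complex.ext <;> simp [hwi]
  have e : ζ ^ 2 * (w.re : ℂ) = 1 := by
    rw [← hw', hw]; field_simp
  have e1 := congrArg Complex.re e
  have e2 := congrArg Complex.im e
  simp [pow_two] at e1 e2
  rcases e2 with e2 | e2
  · have : ζ.re * ζ.im = 0 := by linarith
    rcases mul_eq_zero.1 this with h3 | h3
    · rw [h3] at e1; nlinarith
    · linarith
  · linarith

lemma jk_diff {ζ : ℂ} (h : 0 < ζ.im) : DifferentiableAt ℂ jk ζ := by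
  have h0 : ζ ≠ 0 := by rintro rfl; simp at h
  unfold jk
  have h1 := jk_slit h
  have : DifferentiableAt ℂ (fun ζ : ℂ => log (1 - (ζ ^ 2)⁻¹)) ζ := by
    have hd : DifferentiableAt ℂ (fun ζ : ℂ => 1 - (ζ ^ 2)⁻¹) ζ :=
      (differentiableAt_const _).sub ((differentiableAt_id.pow 2).inv (pow_ne_zero 2 h0))
    exact hd.clog h1
  exact differentiableAt_id.mul ((this.div_const 2).cexp.const_add 1)

lemma jk_facts {ζ : ℂ} (h : 0 < ζ.im) :
    jk ζ ≠ 0 ∧ jk ζ + (jk ζ)⁻¹ = 2 * ζ ∧ 1 < ‖jk ζ‖ ∧ 0 < (jk ζ).im := by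
  have h0 : ζ ≠ 0 := by rintro rfl; simp at h
  have hsl := jk_slit h
  set w := 1 - (ζ ^ 2)⁻¹ with hw
  have hw0 : w ≠ 0 := slitPlane_ne_zero hsl
  set s := exp (log w / 2) with hs
  have hs2 : s ^ 2 = w := by
    rw [hs, ← Complex.exp_nat_mul]
    have : ((2:ℕ):ℂ) * (log w / 2) = log w := by push_cast; ring
    rw [this, Complex.exp_log hw0]
  have hsre : 0 < s.re := by
    rw [hs, Complex.exp_re]
    apply mul_pos (Real.exp_pos _)
    apply Real.cos_pos_of_mem_Ioo
    have e : (log w / 2).im = w.arg / 2 := by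
      have : log w / 2 = ((1 / 2 : ℝ) : ℂ) * log w := by push_cast; ring
      rw [this, Complex.im_ofReal_mul, Complex.log_im]; ring
    rw [e]
    have a1 := Complex.neg_pi_lt_arg w
    have a2 := (Complex.arg_le_pi w).lt_of_ne (mem_slitPlane_iff_arg.1 hsl).1
    constructor <;> linarith
  have hj : jk ζ = ζ * (1 + s) := rfl
  have hj2 : jk ζ * (ζ * (1 - s)) = 1 := by
    rw [hj]
    have : ζ * (1 + s) * (ζ * (1 - s)) = ζ ^ 2 * (1 - s ^ 2) := by ring
    rw [this, hs2, hw]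
    field_simp
    ring
  have hj0 : jk ζ ≠ 0 := by intro h; rw [h] at hj2; simp at hj2
  have hinv : (jk ζ)⁻¹ = ζ * (1 - s) := by
    rw [inv_eq_iff_eq_inv]; exact eq_inv_of_mul_eq_one_left hj2
  have hsum : jk ζ + (jk ζ)⁻¹ = 2 * ζ := by rw [hinv, hj]; ring
  have hlt : ‖1 - s‖ < ‖1 + s‖ := by
    apply lt_of_pow_lt_pow_left₀ 2 (norm_nonneg _)
    rw [Complex.sq_norm, Complex.sq_norm, Complex.normSq_apply, Complex.normSq_apply]
    simp
    nlinarith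
  have hn : 1 < ‖jk ζ‖ := by
    have e1 : ‖(jk ζ)⁻¹‖ < ‖jk ζ‖ := by
      rw [hinv, hj, norm_mul, norm_mul]
      exact mul_lt_mul_of_pos_left hlt (norm_pos_iff.2 h0)
    rw [norm_inv] at e1
    have p := norm_pos_iff.2 hj0
    by_contra hc
    push Not at hc
    have := (one_le_inv₀ p).2 hc
    linarith
  refine ⟨hj0, hsum, hn, ?_⟩
  have e := congrArg Complex.im hsum
  rw [Complex.add_im, Complex.inv_im, ← Complex.sq_norm] at e
  simp at e
  have hR : 1 < ‖jk ζ‖ ^ 2 := by nlinarith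
  have : (jk ζ).im * (1 - (‖jk ζ‖ ^ 2)⁻¹) = 2 * ζ.im := by rw [← e]; ring
  have hp : 0 < 1 - (‖jk ζ‖ ^ 2)⁻¹ := by
    have := inv_lt_one_of_one_lt₀ hR
    linarith
  by_contra hc
  push Not at hc
  nlinarith

lemma jk_re {ζ : ℂ} (h : 0 < ζ.im) : (0 < (jk ζ).re ↔ 0 < ζ.re) ∧ ((jk ζ).re < 0 ↔ ζ.re < 0) := by
  obtain ⟨h0, h1, h2, h3⟩ := jk_facts h
  have e := congrArg Complex.re h1
  rw [Complex.add_re, Complex.inv_re, ← Complex.sq_norm] at e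
  simp at e
  have : (jk ζ).re * (1 + (‖jk ζ‖ ^ 2)⁻¹) = 2 * ζ.re := by rw [← e]; ring
  have hp : 0 < 1 + (‖jk ζ‖ ^ 2)⁻¹ := by positivity
  constructor
  · constructor
    · intro h; nlinarith [mul_pos h hp]
    · intro h; by_contra hc; push Not at hc; nlinarith [mul_nonneg (neg_nonneg.2 hc) hp.le]
  · constructor
    · intro h; nlinarith [mul_pos (neg_pos.2 h) hp]
    · intro h; by_contra hc; push Not at hc; nlinarith [mul_nonneg hc hp.le]

lemma jk_sub {ζ : ℂ} (h : 0 < ζ.im) : ‖jk ζ - 2 * ζ‖ ≤ 1 := by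
  obtain ⟨h0, h1, h2, h3⟩ := jk_facts h
  rw [← h1, sub_add_cancel_left, norm_neg, norm_inv]
  exact inv_le_one_of_one_le₀ h2.le

lemma jk_sin {ζ : ℂ} (h : 0 < ζ.im) :
    Real.sin (jk ζ).arg * (‖jk ζ‖ - 1) ≤ 2 * ζ.im := by
  obtain ⟨h0, h1, h2, h3⟩ := jk_facts h
  have e := congrArg Complex.im h1
  rw [Complex.add_im, Complex.inv_im, ← Complex.sq_norm] at e
  simp at e
  rw [Complex.sin_arg]
  set R := ‖jk ζ‖
  have hR : 0 < R := by linarith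
  rw [← e]
  have : -(jk ζ).im / R ^ 2 ≥ -(jk ζ).im / R := by
    rw [ge_iff_le, neg_div, neg_div, neg_le_neg_iff]
    apply div_le_div_of_nonneg_left h3.le hR
    nlinarith
  have e2 : (jk ζ).im / R * (R - 1) = (jk ζ).im + -(jk ζ).im / R := by field_simp; ring
  linarith

lemma jk_norm_lower {ζ : ℂ} (h : 0 < ζ.im) : 2 * ‖ζ‖ ≤ ‖jk ζ‖ + 1 := by
  have := norm_sub_norm_le (2 * ζ) (jk ζ)
  rw [norm_sub_rev, norm_mul] at this
  have h2 := jk_sub h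
  simp at this
  linarith

lemma arg_uhp {w : ℂ} (h : 0 < w.im) : 0 < w.arg ∧ w.arg < Real.pi := by
  constructor
  · apply lt_of_le_of_ne (Complex.arg_nonneg_iff.2 h.le)
    intro h0
    have := (Complex.arg_eq_zero_iff.1 h0.symm).2
    linarith
  · rw [Complex.arg_lt_pi_iff]; right; exact h.ne'

lemma arg_gt_half {w : ℂ} (h : 0 < w.im) (hr : w.re < 0) : Real.pi / 2 < w.arg := by
  by_contra hc
  push Not at hc
  have := (Complex.arg_le_pi_div_two_iff.1 hc)
  rcases this with h1 | h1 <;> linarith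

lemma arg_lt_half {w : ℂ} (h : 0 < w.im) (hr : 0 < w.re) : w.arg < Real.pi / 2 :=
  Complex.arg_lt_pi_div_two_iff.2 (Or.inl hr)

/-- The arc function in terms of the two Joukowski values. -/
def arcE (lam : ℝ) (J1 J2 : ℂ) : ℂ :=
  exp ((lam : ℂ) * ((log J2 - log J1) / (Real.pi * I) - 1))

lemma arcE_eq (lam : ℝ) (J1 J2 : ℂ) :
    arcE lam J1 J2 = (Real.exp (lam * ((J2.arg - J1.arg) / Real.pi - 1)) : ℂ) *
      exp (((lam / Real.pi * (Real.log ‖J1‖ - Real.log ‖J2‖) : ℝ) : ℂ) * I) := by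
  rw [arcE, Complex.ofReal_exp, ← Complex.exp_add]
  congr 1
  have hpi : (Real.pi : ℂ) ≠ 0 := by exact_mod_cast Real.pi_ne_zero
  have e : ∀ J : ℂ, log J = (Real.log ‖J‖ : ℂ) + (J.arg : ℂ) * I := fun J => rfl
  rw [e J1, e J2]
  push_cast
  field_simp
  ring_nf
  simp only [I_sq]
  ring

lemma arcE_norm (lam : ℝ) (J1 J2 : ℂ) :
    ‖arcE lam J1 J2‖ = Real.exp (lam * ((J2.arg - J1.arg) / Real.pi - 1)) := by
  rw [arcE_eq, norm_mul, Complex.norm_exp_ofReal_mul_I, mul_one, Complex.norm_real,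
    Real.norm_of_nonneg (Real.exp_pos _).le]

lemma arcE_le_one {lam : ℝ} (hl : 0 ≤ lam) {J1 J2 : ℂ} (h1 : 0 < J1.im) (h2 : 0 < J2.im) :
    ‖arcE lam J1 J2‖ ≤ 1 := by
  rw [arcE_norm, Real.exp_le_one_iff]
  apply mul_nonpos_of_nonneg_of_nonpos hl
  have := (arg_uhp h1).1
  have := (arg_uhp h2).2
  rw [sub_nonpos, div_le_one Real.pi_pos]
  linarith

lemma arcE_small {lam : ℝ} (hl : 0 ≤ lam) {J1 J2 : ℂ} (h : J2.arg - J1.arg ≤ Real.pi / 2) :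
    ‖arcE lam J1 J2‖ ≤ Real.exp (-lam / 2) := by
  rw [arcE_norm, Real.exp_le_exp]
  have : (J2.arg - J1.arg) / Real.pi ≤ 1 / 2 := by
    rw [div_le_iff₀ Real.pi_pos]; linarith
  nlinarith

lemma arcE_small_close {lam : ℝ} (hl : 0 ≤ lam) {J1 J2 : ℂ} (h1 : 0 < J1.im) (h2 : 0 < J2.im)
    (h : ‖J2 - J1‖ < ‖J1‖) : ‖arcE lam J1 J2‖ ≤ Real.exp (-lam / 2) := by
  apply arcE_small hl
  by_contra hc
  push Not at hc
  obtain ⟨a1, b1⟩ := arg_uhp h1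
  obtain ⟨a2, b2⟩ := arg_uhp h2
  have hcos : Real.cos (J2.arg - J1.arg) ≤ 0 :=
    Real.cos_nonpos_of_pi_div_two_le_of_le hc.le (by linarith)
  have n1 : 0 < ‖J1‖ := norm_pos_iff.2 (by rintro rfl; simp at h1)
  have n2 : 0 < ‖J2‖ := norm_pos_iff.2 (by rintro rfl; simp at h2)
  have e : ‖J2 - J1‖ ^ 2 = ‖J2‖ ^ 2 + ‖J1‖ ^ 2 - 2 * (‖J2‖ * ‖J1‖ * Real.cos (J2.arg - J1.arg)) := by
    rw [Real.cos_sub]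
    have c1 := Complex.norm_mul_cos_arg J1
    have c2 := Complex.norm_mul_cos_arg J2
    have s1 := Complex.norm_mul_sin_arg J1
    have s2 := Complex.norm_mul_sin_arg J2
    have : ‖J2‖ * ‖J1‖ * (Real.cos J2.arg * Real.cos J1.arg + Real.sin J2.arg * Real.sin J1.arg)
      = J2.re * J1.re + J2.im * J1.im := by
      rw [← c1, ← c2, ← s1, ← s2]; ring
    rw [this, Complex.sq_norm, Complex.sq_norm, Complex.sq_norm, Complex.normSq_apply,
      Complex.normSq_apply, Complex.normSq_apply]
    simp; ring
  have : ‖J2‖ * ‖J1‖ * Real.cos (J2.arg - J1.arg) ≤ 0 :=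
    mul_nonpos_of_nonneg_of_nonpos (by positivity) hcos
  nlinarith [norm_nonneg (J2 - J1)]

/-- Phase control -/
lemma arcE_ray {lam : ℝ} (hl : 0 ≤ lam) {J1 J2 : ℂ} (h1 : 0 < J1.im) (h2 : 0 < J2.im)
    {θ ε : ℝ} (h : lam / Real.pi * |Real.log ‖J1‖ - Real.log ‖J2‖ - θ| ≤ ε) :
    ∃ r ∈ Icc (0:ℝ) 1, ‖arcE lam J1 J2 - exp (((lam / Real.pi * θ : ℝ) : ℂ) * I) * r‖ ≤ ε := by
  refine ⟨‖arcE lam J1 J2‖, ⟨norm_nonneg _, arcE_le_one hl h1 h2⟩, ?_⟩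
  have hle := arcE_le_one hl h1 h2
  rw [arcE_norm] at hle ⊢
  rw [arcE_eq]
  set E := Real.exp (lam * ((J2.arg - J1.arg) / Real.pi - 1)) with hE
  have hE0 : 0 ≤ E := (Real.exp_pos _).le
  set a := lam / Real.pi * (Real.log ‖J1‖ - Real.log ‖J2‖)
  set b := lam / Real.pi * θ
  have e1 : (E:ℂ) * exp ((a:ℂ) * I) - exp ((b:ℂ) * I) * E
      = E * (exp ((b:ℂ) * I) * (exp (I * ((a - b : ℝ) : ℂ)) - 1)) := by
    have : exp ((a:ℂ) * I) = exp ((b:ℂ) * I) * exp (I * ((a - b : ℝ) : ℂ)) := by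
      rw [← Complex.exp_add]; congr 1; push_cast; ring
    rw [this]; ring
  rw [e1, norm_mul, norm_mul, Complex.norm_exp_ofReal_mul_I, one_mul, Complex.norm_real,
    Real.norm_of_nonneg hE0]
  have e2 : ‖exp (I * ((a - b : ℝ) : ℂ)) - 1‖ ≤ |a - b| := by
    have := Real.norm_exp_I_mul_ofReal_sub_one_le (x := a - b)
    simpa using this
  have e3 : |a - b| = lam / Real.pi * |Real.log ‖J1‖ - Real.log ‖J2‖ - θ| := by
    have : a - b = lam / Real.pi * (Real.log ‖J1‖ - Real.log ‖J2‖ - θ) := by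
      simp only [a, b]; ring
    rw [this, abs_mul, abs_of_nonneg (div_nonneg hl Real.pi_pos.le)]
  calc E * _ ≤ 1 * |a - b| := by gcongr
    _ ≤ ε := by rw [one_mul, e3]; exact h

lemma arcE_big {lam s : ℝ} (hl : 0 ≤ lam) {J1 J2 : ℂ} (h1 : 0 < J1.im) (h2 : 0 < J2.im)
    (s1 : Real.sin J1.arg ≤ s) (s2 : Real.sin J2.arg ≤ s) (a1 : J1.arg ≤ Real.pi / 2)
    (a2 : Real.pi / 2 ≤ J2.arg) (hs : lam * s ≤ 1 / 2) : 1 / 2 ≤ ‖arcE lam J1 J2‖ := by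
  obtain ⟨p1, q1⟩ := arg_uhp h1
  obtain ⟨p2, q2⟩ := arg_uhp h2
  have k1 := Real.mul_le_sin p1.le a1
  have k2 := Real.mul_le_sin (x := Real.pi - J2.arg) (by linarith) (by linarith)
  rw [Real.sin_pi_sub] at k2
  rw [arcE_norm]
  have e : (J2.arg - J1.arg) / Real.pi - 1 ≥ -s := by
    have : (J2.arg - J1.arg) / Real.pi - 1
      = -(2 / Real.pi * J1.arg + 2 / Real.pi * (Real.pi - J2.arg)) / 2 := by
      have := Real.pi_ne_zero
      field_simp; ring
    rw [this]; linarith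
  have : lam * ((J2.arg - J1.arg) / Real.pi - 1) ≥ -(1/2) := by nlinarith
  calc (1:ℝ) / 2 ≤ -(1/2) + 1 := by norm_num
    _ ≤ lam * ((J2.arg - J1.arg) / Real.pi - 1) + 1 := by linarith
    _ ≤ _ := Real.add_one_le_exp _


lemma om_zlip {r0 : ℝ} (hr : 0 < r0) {n q z z' : ℂ} (hn : ‖n‖ = 1)
    (h1 : r0 ≤ ‖q + r0 * n - z‖) (h2 : r0 ≤ ‖q + r0 * n - z'‖) :
    ‖om r0 n q z - om r0 n q z'‖ ≤ ‖z - z'‖ / r0 := by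
  have n1 : q + r0 * n - z ≠ 0 := by
    intro h; rw [h, norm_zero] at h1; linarith
  have n2 : q + r0 * n - z' ≠ 0 := by
    intro h; rw [h, norm_zero] at h2; linarith
  have : om r0 n q z - om r0 n q z' =
      (-I * n) * ((z - z') * r0) / ((q + r0 * n - z) * (q + r0 * n - z')) := by
    unfold om; field_simp; ring
  rw [this, norm_div, norm_mul, norm_mul, norm_mul, norm_mul, hn, norm_neg, Complex.norm_I,
    Complex.norm_real, Real.norm_of_nonneg hr.le]
  rw [div_le_div_iff₀ (by positivity) hr]
  have : r0 * r0 ≤ ‖q + r0 * n - z‖ * ‖q + r0 * n - z'‖ := by gcongr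
  nlinarith [norm_nonneg (z - z')]

lemma za_norm {w a : ℂ} {τ : ℝ} (hτ : 0 < τ) (ha : ‖a‖ ≤ 7 / 2) (hi : 0 < (w / τ + a).im) :
    ‖w‖ ≤ τ * (‖jk (w / τ + a)‖ + 8) / 2 := by
  have h1 := jk_norm_lower hi
  have hτ' : (τ:ℂ) ≠ 0 := by exact_mod_cast hτ.ne'
  have e : w = τ * ((w / τ + a) - a) := by field_simp; ring
  have h2 : ‖w‖ ≤ τ * (‖w / τ + a‖ + ‖a‖) := by
    conv_lhs => rw [e]
    rw [norm_mul, Complex.norm_real, Real.norm_of_nonneg hτ.le]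
    gcongr; exact norm_sub_le _ _
  have : τ * (‖w / τ + a‖ + ‖a‖) ≤ τ * ((‖jk (w / τ + a)‖ + 1) / 2 + 7 / 2) := by
    gcongr; linarith
  linarith

lemma za_im {w a : ℂ} {τ : ℝ} : (w / τ + a).im = w.im / τ + a.im := by
  rw [Complex.add_im, Complex.div_ofReal_im]

lemma za_re {w a : ℂ} {τ : ℝ} : (w / τ + a).re = w.re / τ + a.re := by
  rw [Complex.add_re, Complex.div_ofReal_re]

lemma za_sin {w a : ℂ} {τ ν m0 : ℝ} (hτ : 0 < τ) (hν : 0 < ν) (hν1 : ν ≤ 1) (ha : ‖a‖ ≤ 7 / 2)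
    (hi : 0 < (w / τ + a).im)
    (hw : w.im ≤ 5 / 4 * ‖w‖ ^ 2) (hm : ‖w‖ ≤ m0) (hy : a.im ≤ m0)
    (hR : 1 + ν ≤ ‖jk (w / τ + a)‖) :
    Real.sin (jk (w / τ + a)).arg ≤ 15 * m0 / ν := by
  have h1 := za_norm hτ ha hi
  have h2 := jk_sin hi
  rw [za_im] at h2
  set R := ‖jk (w / τ + a)‖
  set s := Real.sin (jk (w / τ + a)).arg
  have h3 : w.im / τ ≤ 5 / 8 * m0 * (R + 8) := by
    rw [div_le_iff₀ hτ]
    have : ‖w‖ ^ 2 ≤ m0 * (τ * (R + 8) / 2) := by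
      rw [sq]; gcongr; exact (norm_nonneg w).trans hm
    nlinarith
  have hm0 : 0 ≤ m0 := (norm_nonneg w).trans hm
  have h4 : ν * (R + 8) ≤ 10 * (R - 1) := by nlinarith
  have h5 : ν * (s * (R - 1)) ≤ 15 * m0 * (R - 1) := by
    have a1 : s * (R - 1) ≤ 5 / 4 * m0 * (R + 8) + 2 * m0 := by linarith
    have a2 : ν * (s * (R - 1)) ≤ ν * (5 / 4 * m0 * (R + 8) + 2 * m0) := by gcongr
    have a3 : m0 * (ν * (R + 8)) ≤ m0 * (10 * (R - 1)) := by gcongr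
    have a4 : m0 * ν ≤ m0 * (R - 1) := by gcongr; linarith
    nlinarith
  rw [le_div_iff₀ hν]
  have hR1 : 0 < R - 1 := by linarith
  have : s * ν * (R - 1) ≤ 15 * m0 * (R - 1) := by linarith
  exact le_of_mul_le_mul_right this hR1

lemma za_zone {w : ℂ} {τ : ℝ} (h1 : |w.re| ≤ 3 * τ) (h0 : 0 ≤ w.im) (hw : w.im ≤ 5 / 4 * ‖w‖ ^ 2)
    (hm : ‖w‖ ≤ 2 / 5) : ‖w‖ ≤ 6 * τ := by
  have := Complex.norm_le_abs_re_add_abs_im w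
  rw [abs_of_nonneg h0] at this
  nlinarith [norm_nonneg w]

lemma log_close {ζ ζ' : ℂ} {Q ν : ℝ} (h : 0 < ζ.im) (h' : 0 < ζ'.im) (hν : 0 < ν)
    (hd : 2 * ‖ζ - ζ'‖ + 2 ≤ Q) (hb : Q + Q / ν + 1 ≤ 2 * ‖ζ'‖) :
    |Real.log ‖jk ζ‖ - Real.log ‖jk ζ'‖| ≤ ν := by
  have e1 := jk_sub h
  have e2 := jk_sub h'
  have d : ‖jk ζ - jk ζ'‖ ≤ Q := by
    have : jk ζ - jk ζ' = (jk ζ - 2 * ζ) - (jk ζ' - 2 * ζ') + 2 * (ζ - ζ') := by ring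
    rw [this]
    refine (norm_add_le _ _).trans ?_
    have := norm_sub_le (jk ζ - 2 * ζ) (jk ζ' - 2 * ζ')
    rw [norm_mul]; simp; linarith
  have hb' : Q + Q / ν ≤ ‖jk ζ'‖ := by
    have := norm_sub_norm_le (2 * ζ') (jk ζ')
    rw [norm_sub_rev, norm_mul] at this
    simp at this; linarith
  have d2 := abs_norm_sub_norm_le (jk ζ) (jk ζ')
  set a := ‖jk ζ‖
  set b := ‖jk ζ'‖
  have hd2 := abs_le.1 (d2.trans d)
  have hQ : 0 < Q := by linarith [norm_nonneg (ζ - ζ')]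
  have hQν : 0 < Q / ν := by positivity
  have ha : Q / ν ≤ a := by linarith
  have hbb : Q / ν ≤ b := by linarith
  have ha0 : 0 < a := by linarith
  have hb0 : 0 < b := by linarith
  have key : ∀ x y : ℝ, 0 < x → 0 < y → Q / ν ≤ y → x - y ≤ Q → Real.log x - Real.log y ≤ ν := by
    intro x y hx hy hy2 hxy
    rw [← Real.log_div hx.ne' hy.ne']
    refine (Real.log_le_sub_one_of_pos (by positivity)).trans ?_
    rw [div_sub_one hy.ne', div_le_iff₀ hy]
    have : Q ≤ y * ν := (div_le_iff₀ hν).1 hy2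
    linarith
  rw [abs_le]
  constructor
  · have := key b a hb0 ha0 ha (by linarith); linarith
  · exact key a b ha0 hb0 hbb (by linarith)


lemma om_pt {D : Set ℂ} {A B r1 r0 RD : ℝ} {n : ℂ → ℂ} (G : Geo D A B r1 n) (hr : 0 < r0)
    (hA : 4 * A * r0 = 1) (hRD : ∀ q ∈ frontier D, ∀ z ∈ closure D, ‖q + r0 * n q - z‖ ≤ RD)
    {q z : ℂ} (hq : q ∈ frontier D) (hz : z ∈ closure D) :
    r0 ≤ ‖q + r0 * n q - z‖ ∧ ‖z - q‖ ≤ RD * ‖om r0 (n q) q z‖ ∧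
    r0 * ‖om r0 (n q) q z‖ ≤ ‖z - q‖ ∧ 0 ≤ (om r0 (n q) q z).im ∧
    (z ∈ frontier D → (om r0 (n q) q z).im ≤ 5 / 4 * ‖om r0 (n q) q z‖ ^ 2) := by
  obtain ⟨f1, f2, f3, -, f5⟩ := om_facts hr hA (G.norm_n q hq) (G.upper q hq z hz)
  have hp : 0 < ‖q + r0 * n q - z‖ := lt_of_lt_of_le hr f1
  refine ⟨f1, ?_, ?_, le_trans (by positivity) f3, ?_⟩
  · rw [f2]
    calc ‖z - q‖ = ‖q + r0 * n q - z‖ * (‖z - q‖ / ‖q + r0 * n q - z‖) := by field_simp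
      _ ≤ _ := by gcongr; exact hRD q hq z hz
  · rw [f2]
    calc r0 * (‖z - q‖ / ‖q + r0 * n q - z‖) ≤ ‖q + r0 * n q - z‖ * (‖z - q‖ / ‖q + r0 * n q - z‖) := by
          gcongr
      _ = _ := by field_simp
  · intro hzf
    exact f5 (abs_le.1 (G.bd q hq z hzf)).1

lemma om_diff {r0 : ℝ} {n q z : ℂ} (hr : 0 < r0) (h1 : r0 ≤ ‖q + r0 * n - z‖) :
    DifferentiableAt ℂ (om r0 n q) z := by
  have n1 : q + r0 * n - z ≠ 0 := by
    intro h; rw [h, norm_zero] at h1; linarith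
  unfold om
  exact ((differentiableAt_id.sub_const q).const_mul (-I)).div
    (differentiableAt_id.const_sub _) n1

set_option maxHeartbeats 2000000 in
lemma arc {D : Set ℂ} {A B r1 r0 RD : ℝ} {n : ℂ → ℂ} (G : Geo D A B r1 n) (hr : 0 < r0)
    (hA : 4 * A * r0 = 1) (hRD0 : 0 < RD)
    (hRD : ∀ q ∈ frontier D, ∀ z ∈ closure D, ‖q + r0 * n q - z‖ ≤ RD)
    {p p' : ℂ} (hp : p ∈ frontier D) (hp' : p' ∈ frontier D) (hne : p ≠ p')
    {lam ν m0 ε t : ℝ} (hl : 0 ≤ lam) (hν : 0 < ν) (hν1 : ν ≤ 1) (hm0 : 0 < m0) (hm1 : m0 ≤ 2 / 5)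
    (hlν : lam * ν ≤ ε) (hlm : 30 * m0 * lam ≤ ν) (hle : Real.exp (-lam / 2) ≤ ε) (ht : 0 < t) :
    ∃ h : ℂ → ℂ, ∃ e1 e2 : ℂ, (∀ z ∈ closure D, DifferentiableAt ℂ h z) ∧ ‖e1‖ = 1 ∧ ‖e2‖ = 1 ∧
      (∀ z ∈ closure D, ‖h z‖ ≤ 1) ∧
      (∀ z ∈ closure D, RD * (2 * B + 1 / r0 + 1) * ‖p - p'‖ ≤ ‖z - p‖ →
        ‖h z‖ ≤ Real.exp (-lam / 2)) ∧
      (∀ z ∈ closure D, ((om r0 (n p) p z).re ≤ 0 ∨ 0 ≤ (om r0 (n p') p' z).re) →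
        ‖h z‖ ≤ Real.exp (-lam / 2)) ∧
      (∀ z ∈ frontier D, 0 ≤ (om r0 (n p) p z).re → (om r0 (n p') p' z).re ≤ 0 →
        ‖om r0 (n p) p z‖ ≤ m0 → ‖om r0 (n p') p' z‖ ≤ m0 →
        1 / 2 ≤ ‖h z‖ ∨ (‖z - p‖ < t ∧ ∃ r ∈ Icc (0:ℝ) 1, ‖h z - e1 * r‖ ≤ ε) ∨
          (‖z - p'‖ < t ∧ ∃ r ∈ Icc (0:ℝ) 1, ‖h z - e2 * r‖ ≤ ε)) := by
  have hfc : frontier D ⊆ closure D := frontier_subset_closure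
  set δ := ‖p - p'‖ with hδ
  have hδ0 : 0 < δ := norm_pos_iff.2 (sub_ne_zero.2 hne)
  set Q := 10 * RD / r0 + 2 with hQ
  have hQ0 : 0 < Q := by positivity
  obtain ⟨τ, hτ, t1, t2, t3⟩ : ∃ τ : ℝ, 0 < τ ∧ 12 * τ < δ ∧ 6 * τ * RD < t ∧
      RD * τ * (Q + Q / ν + 8) ≤ 2 * δ := by
    have hk : 0 < RD * (Q + Q / ν + 8) := by positivity
    refine ⟨min (δ / 24) (min (t / (12 * RD)) (δ / (RD * (Q + Q / ν + 8)))), by positivity, ?_, ?_, ?_⟩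
    · have := min_le_left (δ / 24) (min (t / (12 * RD)) (δ / (RD * (Q + Q / ν + 8))))
      linarith
    · have := (min_le_right (δ / 24) (min (t / (12 * RD)) (δ / (RD * (Q + Q / ν + 8))))).trans
        (min_le_left _ _)
      rw [le_div_iff₀ (by positivity)] at this
      linarith
    · have := (min_le_right (δ / 24) (min (t / (12 * RD)) (δ / (RD * (Q + Q / ν + 8))))).trans
        (min_le_right _ _)
      rw [le_div_iff₀ hk] at this
      linarith
  set y0 := min m0 (1 / 2) with hy0
  have hy0p : 0 < y0 := by positivity
  have hy0m : y0 ≤ m0 := min_le_left _ _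
  have hy0h : y0 ≤ 1 / 2 := min_le_right _ _
  set a1 : ℂ := ⟨-3, y0⟩ with ha1
  set a2 : ℂ := ⟨3, y0⟩ with ha2
  have na1 : ‖a1‖ ≤ 7 / 2 := by
    refine (Complex.norm_le_abs_re_add_abs_im a1).trans ?_
    simp only [ha1, abs_of_pos hy0p]; norm_num; linarith
  have na2 : ‖a2‖ ≤ 7 / 2 := by
    refine (Complex.norm_le_abs_re_add_abs_im a2).trans ?_
    simp only [ha2, abs_of_pos hy0p]; norm_num; linarith
  set w1 : ℂ → ℂ := fun z => om r0 (n p) p z with hw1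
  set w2 : ℂ → ℂ := fun z => om r0 (n p') p' z with hw2
  have F1 := fun z hz => om_pt G hr hA hRD hp (z := z) hz
  have F2 := fun z hz => om_pt G hr hA hRD hp' (z := z) hz
  have i1 : ∀ z ∈ closure D, 0 < (w1 z / τ + a1).im := by
    intro z hz
    rw [za_im]
    have := (F1 z hz).2.2.2.1
    have : 0 ≤ (w1 z).im / τ := div_nonneg this hτ.le
    have : a1.im = y0 := rfl
    linarith
  have i2 : ∀ z ∈ closure D, 0 < (w2 z / τ + a2).im := by
    intro z hz
    rw [za_im]
    have := (F2 z hz).2.2.2.1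
    have : 0 ≤ (w2 z).im / τ := div_nonneg this hτ.le
    have : a2.im = y0 := rfl
    linarith
  set J1 : ℂ → ℂ := fun z => jk (w1 z / τ + a1) with hJ1
  set J2 : ℂ → ℂ := fun z => jk (w2 z / τ + a2) with hJ2
  have K1 := fun z hz => jk_facts (i1 z hz)
  have K2 := fun z hz => jk_facts (i2 z hz)
  have hc : ∀ z ∈ closure D, ((w1 z).re ≤ 0 ∨ 0 ≤ (w2 z).re) →
        ‖arcE lam (J1 z) (J2 z)‖ ≤ Real.exp (-lam / 2) := by
    intro z hz h
    apply arcE_small hl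
    rcases h with h | h
    · have : (w1 z / τ + a1).re < 0 := by
        rw [za_re]
        have : (w1 z).re / τ ≤ 0 := div_nonpos_of_nonpos_of_nonneg h hτ.le
        have : a1.re = -3 := rfl
        linarith
      have := arg_gt_half (K1 z hz).2.2.2 ((jk_re (i1 z hz)).2.2 this)
      have := (arg_uhp (K2 z hz).2.2.2).2
      simp only [hJ1, hJ2]; linarith
    · have : 0 < (w2 z / τ + a2).re := by
        rw [za_re]
        have : 0 ≤ (w2 z).re / τ := div_nonneg h hτ.le
        have : a2.re = 3 := rfl
        linarith
      have := arg_lt_half (K2 z hz).2.2.2 ((jk_re (i2 z hz)).1.2 this)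
      have := (arg_uhp (K1 z hz).2.2.2).1
      simp only [hJ1, hJ2]; linarith
  refine ⟨fun z => arcE lam (J1 z) (J2 z),
    exp (((lam / Real.pi * (-Real.log ‖J2 p‖) : ℝ) : ℂ) * I),
    exp (((lam / Real.pi * (Real.log ‖J1 p'‖) : ℝ) : ℂ) * I), ?_, Complex.norm_exp_ofReal_mul_I _,
    Complex.norm_exp_ofReal_mul_I _, ?_, ?_, hc, ?_⟩
  · intro z hz
    have d1 : DifferentiableAt ℂ J1 z := by
      have : DifferentiableAt ℂ (fun z => w1 z / τ + a1) z :=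
        ((om_diff hr (F1 z hz).1).div_const _).add_const _
      exact (jk_diff (i1 z hz)).comp z this
    have d2 : DifferentiableAt ℂ J2 z := by
      have : DifferentiableAt ℂ (fun z => w2 z / τ + a2) z :=
        ((om_diff hr (F2 z hz).1).div_const _).add_const _
      exact (jk_diff (i2 z hz)).comp z this
    have s1 : J1 z ∈ slitPlane := by
      rw [mem_slitPlane_iff]; right; exact (K1 z hz).2.2.2.ne'
    have s2 : J2 z ∈ slitPlane := by
      rw [mem_slitPlane_iff]; right; exact (K2 z hz).2.2.2.ne'
    unfold arcE
    exact ((((d2.clog s2).sub (d1.clog s1)).div_const _).sub_const _).const_mul _ |>.cexp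
  · intro z hz
    exact arcE_le_one hl (K1 z hz).2.2.2 (K2 z hz).2.2.2
  · intro z hz hzp
    apply arcE_small_close hl (K1 z hz).2.2.2 (K2 z hz).2.2.2
    have hlip := om_lip G hr hA hp' hp hz
    rw [norm_sub_rev p' p, ← hδ] at hlip
    have hbig : (2 * B + 1 / r0 + 1) * δ ≤ ‖w1 z‖ := by
      have := (F1 z hz).2.1
      have h2 : RD * ((2 * B + 1 / r0 + 1) * δ) ≤ RD * ‖w1 z‖ := by
        rw [← mul_assoc]; exact hzp.trans this
      exact le_of_mul_le_mul_left h2 hRD0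
    have e1 := jk_sub (i1 z hz)
    have e2 := jk_sub (i2 z hz)
    have b1 : ‖w1 z‖ / τ - 7 / 2 ≤ ‖w1 z / τ + a1‖ := by
      have := norm_sub_le (w1 z / τ + a1) a1
      rw [add_sub_cancel_right, norm_div, Complex.norm_real, Real.norm_of_nonneg hτ.le] at this
      linarith
    have b2 : 2 * ‖w1 z / τ + a1‖ - 1 ≤ ‖J1 z‖ := by
      have := norm_sub_norm_le (2 * (w1 z / τ + a1)) (J1 z)
      rw [norm_sub_rev, norm_mul] at this
      simp at this; linarith
    have b3 : ‖(w2 z / τ + a2) - (w1 z / τ + a1)‖ ≤ ‖w2 z - w1 z‖ / τ + 6 := by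
      have : (w2 z / τ + a2) - (w1 z / τ + a1) = (w2 z - w1 z) / τ + 6 := by
        have : a2 - a1 = 6 := by
          apply Complex.ext
          · simp [ha1, ha2]; norm_num
          · simp [ha1, ha2]
        rw [← this]; ring
      rw [this]
      refine (norm_add_le _ _).trans ?_
      rw [norm_div, Complex.norm_real, Real.norm_of_nonneg hτ.le]; simp
    have b4 : ‖J2 z - J1 z‖ ≤ 2 * ‖(w2 z / τ + a2) - (w1 z / τ + a1)‖ + 2 := by
      have : J2 z - J1 z = (J2 z - 2 * (w2 z / τ + a2)) - (J1 z - 2 * (w1 z / τ + a1))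
        + 2 * ((w2 z / τ + a2) - (w1 z / τ + a1)) := by ring
      rw [this]
      refine (norm_add_le _ _).trans ?_
      have := norm_sub_le (J2 z - 2 * (w2 z / τ + a2)) (J1 z - 2 * (w1 z / τ + a1))
      rw [norm_mul]; simp; linarith
    have b5 : ‖w2 z - w1 z‖ / τ + 12 < ‖w1 z‖ / τ := by
      rw [← sub_pos]
      have : ‖w1 z‖ / τ - (‖w2 z - w1 z‖ / τ + 12) = (‖w1 z‖ - ‖w2 z - w1 z‖ - 12 * τ) / τ := by
        field_simp; ring
      rw [this]
      apply div_pos _ hτ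
      have : (2 * B + 1 / r0 + 1) * δ = (2 * B + 1 / r0) * δ + δ := by ring
      linarith
    linarith
  · intro z hzf hs1 hs2 hz1 hz2
    have hz := hfc hzf
    obtain ⟨f1, f2, f3, f4, f5⟩ := F1 z hz
    obtain ⟨g1, g2, g3, g4, g5⟩ := F2 z hz
    replace f5 := f5 hzf
    replace g5 := g5 hzf
    have zone1 : ‖w1 z‖ ≤ 6 * τ → ‖z - p‖ < t := by
      intro h
      calc ‖z - p‖ ≤ RD * ‖w1 z‖ := f2
        _ ≤ RD * (6 * τ) := by gcongr
        _ < t := by linarith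
    have zone2 : ‖w2 z‖ ≤ 6 * τ → ‖z - p'‖ < t := by
      intro h
      calc ‖z - p'‖ ≤ RD * ‖w2 z‖ := g2
        _ ≤ RD * (6 * τ) := by gcongr
        _ < t := by linarith
    have hpi : lam / Real.pi * (2 * ν) ≤ ε := by
      rw [div_mul_eq_mul_div, div_le_iff₀ Real.pi_pos]
      have : 0 ≤ lam * ν := by positivity
      nlinarith [Real.pi_gt_three]
    have hlp : 0 ≤ lam / Real.pi := by positivity
    have logb : ∀ R : ℝ, 1 < R → R < 1 + ν → |Real.log R| ≤ ν := by
      intro R hR hR2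
      rw [abs_of_nonneg (Real.log_nonneg hR.le)]
      have := Real.log_le_sub_one_of_pos (lt_trans one_pos hR)
      linarith
    have smallray : ∀ e : ℂ, ‖arcE lam (J1 z) (J2 z)‖ ≤ Real.exp (-lam / 2) →
        ∃ r ∈ Icc (0:ℝ) 1, ‖arcE lam (J1 z) (J2 z) - e * r‖ ≤ ε := by
      intro e h
      refine ⟨0, by simp, ?_⟩
      simpa using h.trans hle
    have zqb : 2 * δ ≤ RD * (2 * ‖w1 p'‖) ∧ 2 * δ ≤ RD * (2 * ‖w2 p‖) := by
      constructor
      · have := (F1 p' (hfc hp')).2.1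
        rw [norm_sub_rev, ← hδ] at this
        linarith
      · have := (F2 p (hfc hp)).2.1
        rw [← hδ] at this
        linarith
    have wb : ∀ w a : ℂ, ‖a‖ ≤ 7 / 2 → 2 * δ ≤ RD * (2 * ‖w‖) → Q + Q / ν + 1 ≤ 2 * ‖w / τ + a‖ := by
      intro w a ha hw
      have := norm_sub_le (w / τ + a) a
      rw [add_sub_cancel_right, norm_div, Complex.norm_real, Real.norm_of_nonneg hτ.le] at this
      have h2 : Q + Q / ν + 8 ≤ 2 * ‖w‖ / τ := by
        rw [le_div_iff₀ hτ]
        have : RD * (τ * (Q + Q / ν + 8)) ≤ RD * (2 * ‖w‖) := by rw [← mul_assoc]; linarith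
        have := le_of_mul_le_mul_left this hRD0
        linarith
      have h3 : 2 * ‖w‖ / τ = 2 * (‖w‖ / τ) := by ring
      linarith
    have db : ∀ u u' a : ℂ, ∀ d : ℝ, ‖u - u'‖ ≤ d / r0 → d ≤ RD * (5 * τ) →
        2 * ‖(u / τ + a) - (u' / τ + a)‖ + 2 ≤ Q := by
      intro u u' a d h1 h2
      have : (u / τ + a) - (u' / τ + a) = (u - u') / τ := by ring
      rw [this, norm_div, Complex.norm_real, Real.norm_of_nonneg hτ.le]
      have : ‖u - u'‖ / τ ≤ 5 * RD / r0 := by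
        rw [div_le_iff₀ hτ]
        refine h1.trans ?_
        rw [div_le_iff₀ hr]
        have : 5 * RD / r0 * τ * r0 = RD * (5 * τ) := by field_simp
        linarith
      rw [hQ]
      have : 10 * RD / r0 = 2 * (5 * RD / r0) := by ring
      linarith
    by_cases hR1 : ‖J1 z‖ < 1 + ν
    · right; left
      have hw := za_norm hτ na1 (i1 z hz)
      have hw5 : ‖w1 z‖ ≤ 5 * τ := by
        have : ‖jk (w1 z / τ + a1)‖ ≤ 2 := by
          have : ‖jk (w1 z / τ + a1)‖ < 1 + ν := hR1
          linarith
        nlinarith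
      refine ⟨zone1 (by linarith), ?_⟩
      apply arcE_ray hl (K1 z hz).2.2.2 (K2 z hz).2.2.2
      refine le_trans (mul_le_mul_of_nonneg_left ?_ hlp) hpi
      have hz5 : ‖z - p‖ ≤ RD * (5 * τ) := f2.trans (by gcongr)
      have l1 := logb _ (K1 z hz).2.2.1 hR1
      have l2 := log_close (i2 z hz) (i2 p (hfc hp)) hν
        (db (w2 z) (w2 p) a2 _ (om_zlip hr (G.norm_n p' hp') g1 (F2 p (hfc hp)).1) hz5)
        (wb (w2 p) a2 na2 zqb.2)
      have := abs_sub (Real.log ‖J1 z‖) (Real.log ‖J2 z‖ - Real.log ‖J2 p‖)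
      have e : Real.log ‖J1 z‖ - Real.log ‖J2 z‖ - -Real.log ‖J2 p‖ =
        Real.log ‖J1 z‖ - (Real.log ‖J2 z‖ - Real.log ‖J2 p‖) := by ring
      rw [e]
      exact this.trans (by simp only [hJ1, hJ2] at l1 l2 ⊢; linarith)
    by_cases hR2 : ‖J2 z‖ < 1 + ν
    · right; right
      have hw := za_norm hτ na2 (i2 z hz)
      have hw5 : ‖w2 z‖ ≤ 5 * τ := by
        have : ‖jk (w2 z / τ + a2)‖ ≤ 2 := by
          have : ‖jk (w2 z / τ + a2)‖ < 1 + ν := hR2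
          linarith
        nlinarith
      refine ⟨zone2 (by linarith), ?_⟩
      apply arcE_ray hl (K1 z hz).2.2.2 (K2 z hz).2.2.2
      refine le_trans (mul_le_mul_of_nonneg_left ?_ hlp) hpi
      have hz5 : ‖z - p'‖ ≤ RD * (5 * τ) := g2.trans (by gcongr)
      have l1 := logb _ (K2 z hz).2.2.1 hR2
      have l2 := log_close (i1 z hz) (i1 p' (hfc hp')) hν
        (db (w1 z) (w1 p') a1 _ (om_zlip hr (G.norm_n p hp) f1 (F1 p' (hfc hp')).1) hz5)
        (wb (w1 p') a1 na1 zqb.1)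
      have := abs_sub (Real.log ‖J1 z‖ - Real.log ‖J1 p'‖) (Real.log ‖J2 z‖)
      have e : Real.log ‖J1 z‖ - Real.log ‖J2 z‖ - Real.log ‖J1 p'‖ =
        (Real.log ‖J1 z‖ - Real.log ‖J1 p'‖) - Real.log ‖J2 z‖ := by ring
      rw [e]
      exact this.trans (by simp only [hJ1, hJ2] at l1 l2 ⊢; linarith)
    push Not at hR1 hR2
    have s1 := za_sin hτ hν hν1 na1 (i1 z hz) f5 hz1 hy0m hR1
    have s2 := za_sin hτ hν hν1 na2 (i2 z hz) g5 hz2 hy0m hR2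
    by_cases q1 : Real.pi / 2 < (J1 z).arg
    · right; left
      have hre : (w1 z).re ≤ 3 * τ := by
        by_contra hcon
        push Not at hcon
        have : 0 < (w1 z / τ + a1).re := by
          rw [za_re]
          have : 3 < (w1 z).re / τ := by rwa [lt_div_iff₀ hτ]
          have : a1.re = -3 := rfl
          linarith
        have := arg_lt_half (K1 z hz).2.2.2 ((jk_re (i1 z hz)).1.2 this)
        simp only [hJ1] at q1
        linarith
      refine ⟨zone1 (za_zone (by rw [abs_of_nonneg hs1]; exact hre) f4 f5 (hz1.trans hm1)),
        smallray _ (arcE_small hl ?_)⟩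
      have := (arg_uhp (K2 z hz).2.2.2).2
      simp only [hJ2]; linarith
    by_cases q2 : (J2 z).arg < Real.pi / 2
    · right; right
      have hre : -(3 * τ) ≤ (w2 z).re := by
        by_contra hcon
        push Not at hcon
        have : (w2 z / τ + a2).re < 0 := by
          rw [za_re]
          have : (w2 z).re / τ < -3 := by rw [div_lt_iff₀ hτ]; linarith
          have : a2.re = 3 := rfl
          linarith
        have := arg_gt_half (K2 z hz).2.2.2 ((jk_re (i2 z hz)).2.2 this)
        simp only [hJ2] at q2
        linarith
      refine ⟨zone2 (za_zone (by rw [abs_of_nonpos hs2]; linarith) g4 g5 (hz2.trans hm1)),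
        smallray _ (arcE_small hl ?_)⟩
      have := (arg_uhp (K1 z hz).2.2.2).1
      simp only [hJ1]; linarith
    left
    push Not at q1 q2
    apply arcE_big hl (K1 z hz).2.2.2 (K2 z hz).2.2.2 s1 s2 q1 q2
    rw [mul_div_assoc', div_le_iff₀ hν]
    linarith


lemma nim_sub (n q z z' : ℂ) : nim n q z - nim n q z' = nim n z' z := by
  unfold nim; simp; ring

lemma nim_sub_n {n n' q z : ℂ} : |nim n q z - nim n' q z| ≤ ‖n - n'‖ * ‖z - q‖ := by
  have : nim n q z - nim n' q z = ((z - q) * (starRingEnd ℂ) (n - n')).im := by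
    unfold nim; simp; ring
  rw [this]
  refine (Complex.abs_im_le_norm _).trans ?_
  rw [norm_mul, RCLike.norm_conj, mul_comm]

/-- The sign lemma for boundary points near `q`. -/
lemma Geo.sign {D : Set ℂ} {A B r1 : ℝ} {n : ℂ → ℂ} (G : Geo D A B r1 n) {κ : ℝ} (hκB : B * κ ≤ 1 / 4)
    (hκA : 2 * A * κ ≤ 1 / 4) {q z z' : ℂ} (hq : q ∈ frontier D) (hz : z ∈ frontier D)
    (hz' : z' ∈ frontier D) (h1 : ‖z - q‖ ≤ κ) (h2 : ‖z' - q‖ ≤ κ) :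
    ‖z - z'‖ ≤ 2 * |nim (n q) q z - nim (n q) q z'| ∧
    (nim (n q) q z' ≤ nim (n q) q z → 0 ≤ nim (n z') z' z) ∧
    (nim (n q) q z ≤ nim (n q) q z' → nim (n z') z' z ≤ 0) := by
  rw [nim_sub]
  have a1 := nim_sub_n (n := n z') (n' := n q) (q := z') (z := z)
  have a2 : ‖n z' - n q‖ * ‖z - z'‖ ≤ 1 / 4 * ‖z - z'‖ := by
    gcongr
    refine (G.lip z' hz' q hq).trans (le_trans ?_ hκB)
    have := G.B_nonneg
    gcongr
  have a3 : |nre (n z') z' z| ≤ 1 / 4 * ‖z - z'‖ := by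
    refine (G.bd z' hz' z hz).trans ?_
    have : ‖z - z'‖ ≤ 2 * κ := by
      have := norm_sub_le (z - q) (z' - q)
      rw [sub_sub_sub_cancel_right] at this; linarith
    have hA := G.A_ge
    have : A * ‖z - z'‖ ≤ 1 / 4 := by nlinarith
    nlinarith [norm_nonneg (z - z')]
  have a4 := norm_le_nre_nim (q := z') (z := z) (G.norm_n z' hz')
  have hd := nim_sub (n q) q z z'
  have b := abs_le.1 (a1.trans a2)
  have hn := norm_nonneg (z - z')
  refine ⟨?_, ?_, ?_⟩
  · have := abs_sub_abs_le_abs_sub (nim (n z') z' z) (nim (n q) z' z)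
    linarith
  · intro h
    by_contra hc
    push Not at hc
    rw [abs_of_neg hc] at a4
    linarith
  · intro h
    by_contra hc
    push Not at hc
    rw [abs_of_pos hc] at a4
    linarith

lemma grid_M {c ε : ℝ} (hε : 0 < ε) :
    ∀ᶠ M : ℕ in atTop, c * (2 * Real.log (M / ε) * (2 * Real.log (M / ε) + 1)) ≤ ε * M := by
  have hx : Tendsto (fun M : ℕ => (M : ℝ) / ε) atTop atTop :=
    tendsto_natCast_atTop_atTop.atTop_div_const hε
  obtain ⟨C, hC, hcC⟩ : ∃ C : ℝ, 0 < C ∧ c ≤ C := ⟨max c 1, by positivity, le_max_left _ _⟩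
  have h := (Real.isLittleO_pow_log_id_atTop (n := 2)).def (c := ε ^ 2 / (6 * C)) (by positivity)
  have h1 : ∀ᶠ x : ℝ in atTop, 1 ≤ Real.log x := Real.tendsto_log_atTop.eventually_ge_atTop 1
  have h2 : ∀ᶠ x : ℝ in atTop, 0 ≤ x := eventually_ge_atTop 0
  filter_upwards [hx.eventually h, hx.eventually h1, hx.eventually h2] with M a b b2
  set L := Real.log (M / ε)
  simp only [id, Real.norm_eq_abs, abs_of_nonneg b2] at a
  rw [abs_of_nonneg (by positivity)] at a
  have e : ε ^ 2 / (6 * C) * (M / ε) = ε * M / (6 * C) := by field_simp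
  rw [e, le_div_iff₀ (by positivity)] at a
  calc c * (2 * L * (2 * L + 1)) ≤ C * (2 * L * (2 * L + 1)) := by gcongr
    _ ≤ C * (6 * L ^ 2) := by
      have : 2 * L * (2 * L + 1) ≤ 6 * L ^ 2 := by nlinarith
      exact mul_le_mul_of_nonneg_left this hC.le
    _ ≤ _ := by linarith

lemma card_near {M : ℕ} {x : ℕ → ℂ} {w : ℂ} {ℓ c : ℝ} (hℓ : 0 < ℓ) (hc : 0 ≤ c)
    (hx : ∀ i < M, ∀ j < M, i ≤ j → (j - i : ℝ) * ℓ ≤ ‖x i - x j‖)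
    [DecidablePred fun i => ‖w - x i‖ < c * ℓ] :
    (((Finset.range M).filter (fun i => ‖w - x i‖ < c * ℓ)).card : ℝ) ≤ 2 * c + 2 := by
  set S := (Finset.range M).filter (fun i => ‖w - x i‖ < c * ℓ) with hS
  rcases S.eq_empty_or_nonempty with h | h
  · rw [h]; simp; linarith
  set a := S.min' h with ha
  have haS : a ∈ S := S.min'_mem h
  have sub : S ⊆ Finset.Icc a (a + ⌊2 * c⌋₊) := by
    intro j hj
    have haj : a ≤ j := S.min'_le j hj
    rw [Finset.mem_Icc]
    refine ⟨haj, ?_⟩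
    simp only [hS, Finset.mem_filter, Finset.mem_range] at haS hj
    have := hx a haS.1 j hj.1 haj
    have t : ‖x a - x j‖ ≤ ‖w - x j‖ + ‖w - x a‖ := by
      have := norm_sub_le (w - x j) (w - x a)
      rwa [sub_sub_sub_cancel_left] at this
    have : (j - a : ℝ) * ℓ ≤ (2 * c) * ℓ := by linarith [hj.2, haS.2]
    have := le_of_mul_le_mul_right this hℓ
    have h3 : ((j - a : ℕ) : ℝ) ≤ 2 * c := by rw [Nat.cast_sub haj]; exact this
    have := Nat.le_floor h3
    omega
  have h1 := Finset.card_le_card sub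
  rw [Nat.card_Icc] at h1
  have h2 : (S.card : ℝ) ≤ (⌊2 * c⌋₊ : ℝ) + 1 := by
    have : S.card ≤ ⌊2 * c⌋₊ + 1 := by omega
    exact_mod_cast this
  have := Nat.floor_le (a := 2 * c) (by positivity)
  linarith

set_option maxHeartbeats 2000000 in
lemma grid {D : Set ℂ} (hDo : IsOpen D) (hDb : Bornology.IsBounded D) (hSB : SmoothlyBounded D) :
    ∃ N1 : ℝ, 0 < N1 ∧ ∀ q ∈ frontier D, ∃ β > 0, ∀ d > 0, ∀ ε > 0, ε ≤ 1 → ∃ M : ℕ, 0 < M ∧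
      ∃ x : ℕ → ℂ, (∀ i ≤ M, x i ∈ frontier D) ∧ (∀ i ≤ M, ∀ j ≤ M, x i = x j → i = j) ∧
      (∀ i < M, ‖x i - x (i + 1)‖ ≤ d) ∧
      ∀ t > 0, ∃ h : ℕ → ℂ → ℂ, ∃ e1 e2 : ℕ → ℂ,
        (∀ i < M, (∀ z ∈ closure D, DifferentiableAt ℂ (h i) z) ∧ ‖e1 i‖ = 1 ∧ ‖e2 i‖ = 1 ∧
          (∀ z ∈ closure D, ‖h i z‖ ≤ 1) ∧
          (∀ z ∈ closure D, d ≤ ‖z - x i‖ → ‖h i z‖ ≤ ε / M)) ∧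
        (∀ z ∈ closure D, ∑ i ∈ Finset.range M, ‖h i z‖ ≤ N1) ∧
        (∀ z ∈ frontier D, (β ≤ ‖z - q‖ ∧ ∀ i < M, ‖h i z‖ ≤ ε / M) ∨
          ∃ i0 < M, (∀ i < M, i ≠ i0 → ‖h i z‖ ≤ ε / M) ∧ ‖z - x i0‖ ≤ d ∧
            (1 / 2 ≤ ‖h i0 z‖ ∨ (‖z - x i0‖ < t ∧ ∃ r ∈ Icc (0:ℝ) 1, ‖h i0 z - e1 i0 * r‖ ≤ ε) ∨
              (‖z - x (i0 + 1)‖ < t ∧ ∃ r ∈ Icc (0:ℝ) 1, ‖h i0 z - e2 i0 * r‖ ≤ ε))) := by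
  obtain ⟨A, B, r1, n, G⟩ := geo_exists hDo hDb hSB
  have hfc : frontier D ⊆ closure D := frontier_subset_closure
  have hA1 := G.A_ge
  have hB0 := G.B_nonneg
  have hr1 := G.r1_pos
  set r0 := 1 / (4 * A) with hr0
  have hr : 0 < r0 := by positivity
  have hA : 4 * A * r0 = 1 := by rw [hr0]; field_simp
  obtain ⟨R, hR⟩ := hDb.closure.exists_norm_le
  obtain ⟨RD, hRD0, hRD⟩ : ∃ RD : ℝ, 0 < RD ∧
      ∀ q ∈ frontier D, ∀ z ∈ closure D, ‖q + r0 * n q - z‖ ≤ RD := by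
    refine ⟨2 * |R| + r0, by positivity, fun q hq z hz => ?_⟩
    have h1 := hR q (hfc hq)
    have h2 := hR z hz
    have h3 : ‖(r0:ℂ) * n q‖ = r0 := by
      rw [norm_mul, G.norm_n q hq, Complex.norm_real, Real.norm_of_nonneg hr.le, mul_one]
    have := norm_sub_le (q + r0 * n q) z
    have := norm_add_le q (r0 * n q)
    linarith [le_abs_self R]
  set C1 := RD * (2 * B + 1 / r0 + 1) with hC1
  have hC10 : 0 < C1 := by positivity
  refine ⟨4 * C1 + 3, by positivity, fun q hq => ?_⟩
  set κ := 1 / (8 * (A + B)) with hκ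
  have hκ0 : 0 < κ := by positivity
  have hκe : (A + B) * κ = 1 / 8 := by rw [hκ]; field_simp
  have hκB : B * κ ≤ 1 / 4 := by nlinarith
  have hκA : 2 * A * κ ≤ 1 / 4 := by nlinarith
  set β := min (κ / 8) (r1 / 4) with hβ
  have hβ0 : 0 < β := by positivity
  have hβκ : β ≤ κ / 8 := min_le_left _ _
  have hβr : β ≤ r1 / 4 := min_le_right _ _
  refine ⟨β, hβ0, fun d hd ε hε hε1 => ?_⟩
  set nq := n q with hnq
  have hnn := G.norm_n q hq
  have evl : ∀ y : ℝ, 0 < y → ∀ᶠ M : ℕ in atTop, 2 * β / M ≤ y := by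
    intro y hy
    have := tendsto_const_div_atTop_nhds_zero_nat (2 * β)
    exact (this.eventually (gt_mem_nhds hy)).mono fun _ h => le_of_lt h
  obtain ⟨M, m1, m2, m3, m4, m5, m6⟩ := (grid_M (c := 30 * (4 * β / r0)) hε |>.and <|
    (eventually_gt_atTop 0).and <| (evl (r0 / 5) (by positivity)).and <| (evl (d / 2) (by positivity)).and <|
    (evl (d / (2 * C1)) (by positivity)).and (evl ((κ - 2 * β) / (2 * C1))
      (div_pos (by linarith) (by positivity)))).exists
  have hM : (0:ℝ) < M := by exact_mod_cast m2
  set ℓ := 2 * β / M with hℓ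
  have hℓ0 : 0 < ℓ := by positivity
  have hMℓ : M * ℓ = 2 * β := by rw [hℓ]; field_simp
  -- the grid points
  have hx : ∀ i : ℕ, ∃ z, i ≤ M → z ∈ frontier D ∧ nim nq q z = -β + i * ℓ ∧ ‖z - q‖ ≤ 2 * β := by
    intro i
    by_cases hi : i ≤ M
    · have : |-β + i * ℓ| ≤ β := by
        have h1 : (i:ℝ) * ℓ ≤ M * ℓ := by gcongr
        have h2 : 0 ≤ (i:ℝ) * ℓ := by positivity
        rw [abs_le]; constructor <;> linarith
      obtain ⟨z, hz1, hz2, hz3⟩ := G.cross hDo hq hβ0 (by nlinarith) (by linarith) this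
      exact ⟨z, fun _ => ⟨hz1, hz2, hz3⟩⟩
    · exact ⟨0, fun h => absurd h hi⟩
  choose x hx using hx
  have hxd : ∀ i ≤ M, ∀ j ≤ M, i ≤ j → (j - i : ℝ) * ℓ ≤ ‖x i - x j‖ := by
    intro i hi j hj hij
    have := abs_nim_le (q := x i) (z := x j) hnn
    rw [← nim_sub _ q, (hx i hi).2.1, (hx j hj).2.1, norm_sub_rev] at this
    refine le_trans ?_ this
    refine le_trans (le_of_eq ?_) (le_abs_self _)
    ring
  have hxu : ∀ i < M, ‖x i - x (i + 1)‖ ≤ 2 * ℓ := by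
    intro i hi
    have := (G.sign hκB hκA hq (hx i hi.le).1 (hx (i+1) hi).1 (by linarith [(hx i hi.le).2.2])
      (by linarith [(hx (i+1) hi).2.2])).1
    rw [(hx i hi.le).2.1, (hx (i+1) hi).2.1] at this
    refine this.trans (le_of_eq ?_)
    have : -β + i * ℓ - (-β + ((i + 1 : ℕ) : ℝ) * ℓ) = -ℓ := by push_cast; ring
    rw [this, abs_neg, abs_of_pos hℓ0]
  have hinj : ∀ i ≤ M, ∀ j ≤ M, x i = x j → i = j := by
    intro i hi j hj hij
    have h1 := (hx i hi).2.1
    rw [hij, (hx j hj).2.1] at h1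
    have : (j : ℝ) * ℓ = i * ℓ := by linarith
    have := mul_right_cancel₀ hℓ0.ne' this
    exact_mod_cast this.symm
  refine ⟨M, m2, x, fun i hi => (hx i hi).1, hinj, fun i hi => (hxu i hi).trans (by linarith),
    fun t ht => ?_⟩
  have hM1 : (1:ℝ) ≤ M := by exact_mod_cast m2
  set lam := 2 * Real.log (M / ε) with hlam
  have hl : 0 ≤ lam := by
    have : 0 ≤ Real.log (M / ε) := Real.log_nonneg (by rw [le_div_iff₀ hε]; linarith)
    positivity
  have hexp : Real.exp (-lam / 2) = ε / M := by
    have : -lam / 2 = -Real.log (M / ε) := by rw [hlam]; ring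
    rw [this, Real.exp_neg, Real.exp_log (by positivity), inv_div]
  set ν := ε / (lam + 1) with hν
  have hν0 : 0 < ν := by positivity
  have hν1 : ν ≤ 1 := by rw [hν, div_le_one (by positivity)]; linarith
  have hlν : lam * ν ≤ ε := by
    rw [hν, mul_div_assoc', div_le_iff₀ (by positivity)]; nlinarith
  set m0 := 2 * ℓ / r0 with hm0
  have hm00 : 0 < m0 := by positivity
  have hm01 : m0 ≤ 2 / 5 := by rw [hm0, div_le_iff₀ hr]; linarith
  have hlm : 30 * m0 * lam ≤ ν := by
    rw [hν, le_div_iff₀ (by positivity)]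
    have e : 30 * m0 * lam * (lam + 1) = 30 * (4 * β / r0) * (lam * (lam + 1)) / M := by
      rw [hm0, hℓ]; field_simp; ring
    rw [e, div_le_iff₀ hM]; exact m1
  have hle : Real.exp (-lam / 2) ≤ ε := by
    rw [hexp, div_le_iff₀ hM]; nlinarith
  have harc : ∀ i : ℕ, ∃ h : ℂ → ℂ, ∃ e1 e2 : ℂ, i < M → _ := fun i => by
    by_cases hi : i < M
    · have hne : x i ≠ x (i + 1) := fun h => by
        have := hinj i hi.le (i + 1) hi h; omega
      obtain ⟨h, e1, e2, H⟩ := arc G hr hA hRD0 hRD (hx i hi.le).1 (hx (i + 1) hi).1 hne hl hν0 hν1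
        hm00 hm01 hlν hlm hle ht
      exact ⟨h, e1, e2, fun _ => H⟩
    · exact ⟨0, 0, 0, fun h => absurd h hi⟩
  choose h e1 e2 H using harc
  have far : ∀ i < M, ∀ z ∈ closure D, 2 * C1 * ℓ ≤ ‖z - x i‖ → ‖h i z‖ ≤ ε / M := by
    intro i hi z hz hd
    rw [← hexp]
    apply (H i hi).2.2.2.2.1 z hz
    refine le_trans ?_ hd
    have := hxu i hi
    calc C1 * ‖x i - x (i + 1)‖ ≤ C1 * (2 * ℓ) := by gcongr
      _ = _ := by ring
  have resign : ∀ i ≤ M, ∀ z ∈ frontier D, ‖z - q‖ ≤ κ →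
      (-β + i * ℓ ≤ nim nq q z → 0 ≤ (om r0 (n (x i)) (x i) z).re) ∧
      (nim nq q z ≤ -β + i * ℓ → (om r0 (n (x i)) (x i) z).re ≤ 0) := by
    intro i hi z hz hzκ
    have hs := (G.sign hκB hκA hq hz (hx i hi).1 hzκ (by linarith [(hx i hi).2.2])).2
    rw [← (hx i hi).2.1]
    have hom := (om_facts hr hA (G.norm_n _ (hx i hi).1) (G.upper _ (hx i hi).1 z (hfc hz))).2.2.2.1
    rw [hom]
    constructor
    · intro h
      have := hs.1 h
      positivity
    · intro h
      apply div_nonpos_of_nonpos_of_nonneg _ (by positivity)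
      exact mul_nonpos_of_nonneg_of_nonpos hr.le (hs.2 h)
  refine ⟨h, e1, e2, ?_, ?_, ?_⟩
  · intro i hi
    obtain ⟨a1, a2, a3, a4, -⟩ := H i hi
    refine ⟨a1, a2, a3, a4, fun z hz hzd => far i hi z hz (le_trans ?_ hzd)⟩
    rw [le_div_iff₀ (by positivity)] at m5; linarith
  · intro z hz
    classical
    have hcard := card_near (M := M) (x := x) (w := z) (ℓ := ℓ) (c := 2 * C1) hℓ0 (by positivity)
      (fun i hi j hj hij => hxd i hi.le j hj.le hij)
    rw [← Finset.sum_filter_add_sum_filter_not (Finset.range M) (fun i => ‖z - x i‖ < 2 * C1 * ℓ)]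
    have s1 : ∑ i ∈ (Finset.range M).filter (fun i => ‖z - x i‖ < 2 * C1 * ℓ), ‖h i z‖ ≤
        2 * (2 * C1) + 2 := by
      refine le_trans ?_ hcard
      rw [← nsmul_one]
      apply Finset.sum_le_card_nsmul
      intro i hi
      simp only [Finset.mem_filter, Finset.mem_range] at hi
      exact (H i hi.1).2.2.2.1 z hz
    have s2 : ∑ i ∈ (Finset.range M).filter (fun i => ¬ ‖z - x i‖ < 2 * C1 * ℓ), ‖h i z‖ ≤ 1 := by
      calc _ ≤ ∑ i ∈ (Finset.range M).filter (fun i => ¬ ‖z - x i‖ < 2 * C1 * ℓ), ε / M := by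
            apply Finset.sum_le_sum
            intro i hi
            simp only [Finset.mem_filter, Finset.mem_range, not_lt] at hi
            exact far i hi.1 z hz hi.2
        _ ≤ ∑ i ∈ Finset.range M, ε / M := by
            apply Finset.sum_le_sum_of_subset_of_nonneg (Finset.filter_subset _ _)
            intros; positivity
        _ = ε := by simp; field_simp
        _ ≤ 1 := hε1
    linarith
  · intro z hz
    have hzc := hfc hz
    by_cases hzκ : κ < ‖z - q‖
    · left
      refine ⟨by linarith, fun i hi => far i hi z hzc ?_⟩
      have h1 := norm_sub_norm_le (z - q) (x i - q)
      rw [sub_sub_sub_cancel_right] at h1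
      have h2 := (hx i hi.le).2.2
      rw [le_div_iff₀ (by positivity)] at m6
      linarith
    push Not at hzκ
    set s := nim nq q z with hs
    by_cases hlo : s < -β
    · left
      constructor
      · have := abs_nim_le (q := q) (z := z) hnn
        have := neg_abs_le (nim (n q) q z)
        simp only [hs, hnq] at hlo
        linarith
      · intro i hi
        rw [← hexp]
        apply (H i hi).2.2.2.2.2.1 z hzc
        left
        apply (resign i hi.le z hz hzκ).2
        have : 0 ≤ (i:ℝ) * ℓ := by positivity
        linarith
    by_cases hhi : β ≤ s
    · left
      constructor
      · have := abs_nim_le (q := q) (z := z) hnn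
        have := le_abs_self (nim (n q) q z)
        simp only [hs, hnq] at hhi
        linarith
      · intro i hi
        rw [← hexp]
        apply (H i hi).2.2.2.2.2.1 z hzc
        right
        apply (resign (i+1) hi z hz hzκ).1
        have : ((i + 1 : ℕ):ℝ) * ℓ ≤ M * ℓ := by gcongr; exact hi
        linarith
    right
    push Not at hlo hhi
    set i0 := ⌊(s + β) / ℓ⌋₊ with hi0
    have hnn0 : 0 ≤ (s + β) / ℓ := div_nonneg (by linarith) hℓ0.le
    have f1 : (i0:ℝ) * ℓ ≤ s + β := by
      have := Nat.floor_le hnn0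
      rwa [le_div_iff₀ hℓ0] at this
    have f2 : s + β < ((i0 + 1 : ℕ) : ℝ) * ℓ := by
      have := Nat.lt_floor_add_one ((s + β) / ℓ)
      rw [div_lt_iff₀ hℓ0] at this
      push_cast; exact this
    have hi0M : i0 < M := by
      have : (i0:ℝ) * ℓ < M * ℓ := by linarith
      have := lt_of_mul_lt_mul_right this hℓ0.le
      exact_mod_cast this
    have near : ∀ i ≤ M, |s - (-β + i * ℓ)| ≤ ℓ → ‖z - x i‖ ≤ 2 * ℓ := by
      intro i hi h
      have := (G.sign hκB hκA hq hz (hx i hi).1 hzκ (by linarith [(hx i hi).2.2])).1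
      rw [(hx i hi).2.1] at this
      linarith
    have n1 : ‖z - x i0‖ ≤ 2 * ℓ := by
      apply near i0 hi0M.le
      push_cast at f2
      rw [abs_le]; constructor <;> nlinarith
    have n2 : ‖z - x (i0 + 1)‖ ≤ 2 * ℓ := by
      apply near (i0 + 1) hi0M
      push_cast at f2 ⊢
      rw [abs_le]; constructor <;> nlinarith
    refine ⟨i0, hi0M, ?_, by linarith, ?_⟩
    · intro i hi hne
      rw [← hexp]
      apply (H i hi).2.2.2.2.2.1 z hzc
      rcases lt_or_gt_of_ne hne with hlt | hgt
      · right
        apply (resign (i+1) hi z hz hzκ).1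
        have : ((i + 1 : ℕ):ℝ) * ℓ ≤ i0 * ℓ := by gcongr; exact hlt
        linarith
      · left
        apply (resign i hi.le z hz hzκ).2
        have : ((i0 + 1 : ℕ):ℝ) * ℓ ≤ i * ℓ := by gcongr; exact hgt
        linarith
    · have ombd : ∀ i ≤ M, ‖z - x i‖ ≤ 2 * ℓ → ‖om r0 (n (x i)) (x i) z‖ ≤ m0 := by
        intro i hi h
        have := (om_pt G hr hA hRD (hx i hi).1 hzc).2.2.1
        rw [hm0, le_div_iff₀ hr]
        linarith
      exact (H i0 hi0M).2.2.2.2.2.2 z hz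
        ((resign i0 hi0M.le z hz hzκ).1 (by linarith))
        ((resign (i0 + 1) hi0M z hz hzκ).2 (by linarith))
        (ombd i0 hi0M.le n1) (ombd (i0 + 1) hi0M n2)


set_option maxHeartbeats 1000000 in
lemma bump0 {D : Set ℂ} (hDo : IsOpen D) (hDb : Bornology.IsBounded D) (hSB : SmoothlyBounded D)
    {p : ℂ} (hp : p ∈ frontier D) {ε d : ℝ} (hε : 0 < ε) (hd : 0 < d) :
    ∃ b : ℂ → ℂ, (∀ z ∈ closure D, DifferentiableAt ℂ b z ∧ ‖b z‖ ≤ 1 ∧ ‖b z - (‖b z‖ : ℂ)‖ ≤ ε ∧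
      (d ≤ ‖z - p‖ → ‖b z‖ ≤ ε)) ∧ b p = 1 := by
  obtain ⟨A, B, r1, n, G⟩ := geo_exists hDo hDb hSB
  have hfc : frontier D ⊆ closure D := frontier_subset_closure
  have hA1 := G.A_ge
  set r0 := 1 / (4 * A) with hr0
  have hr : 0 < r0 := by positivity
  have hA : 4 * A * r0 = 1 := by rw [hr0]; field_simp
  obtain ⟨R, hR⟩ := hDb.closure.exists_norm_le
  obtain ⟨RD, hRD0, hRD⟩ : ∃ RD : ℝ, 0 < RD ∧
      ∀ q ∈ frontier D, ∀ z ∈ closure D, ‖q + r0 * n q - z‖ ≤ RD := by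
    refine ⟨2 * |R| + r0, by positivity, fun q hq z hz => ?_⟩
    have h1 := hR q (hfc hq)
    have h2 := hR z hz
    have h3 : ‖(r0:ℂ) * n q‖ = r0 := by
      rw [norm_mul, G.norm_n q hq, Complex.norm_real, Real.norm_of_nonneg hr.le, mul_one]
    have := norm_sub_le (q + r0 * n q) z
    have := norm_add_le q (r0 * n q)
    linarith [le_abs_self R]
  set α := ε / 2 with hα
  have hα0 : 0 < α := by positivity
  set Y := Real.exp (-Real.log ε / α) with hY
  have hY0 : 0 < Y := Real.exp_pos _
  set τ := d / (RD * (Y + 1)) with hτ'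
  have hτ : 0 < τ := by positivity
  set u : ℂ → ℂ := fun z => 1 - I * om r0 (n p) p z / τ with hu
  have ure : ∀ z ∈ closure D, 1 ≤ (u z).re := by
    intro z hz
    have := (om_pt G hr hA hRD hp hz).2.2.2.1
    have e : (u z).re = 1 + (om r0 (n p) p z).im / τ := by
      simp only [hu, Complex.sub_re, Complex.one_re, Complex.div_ofReal_re]
      simp; ring
    rw [e]
    have : 0 ≤ (om r0 (n p) p z).im / τ := by positivity
    linarith
  have un : ∀ z ∈ closure D, 1 ≤ ‖u z‖ := fun z hz =>
    (ure z hz).trans (Complex.re_le_norm _)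
  refine ⟨fun z => exp (-α * log (u z)), fun z hz => ?_, ?_⟩
  · have us : u z ∈ slitPlane := by
      rw [mem_slitPlane_iff]; left; linarith [ure z hz]
    have e : exp (-α * log (u z)) = (Real.exp (-α * Real.log ‖u z‖) : ℂ) *
        exp (I * ((-α * (u z).arg : ℝ) : ℂ)) := by
      rw [Complex.ofReal_exp, ← Complex.exp_add]
      congr 1
      conv_lhs => rw [← Complex.re_add_im (log (u z)), Complex.log_re, Complex.log_im]
      push_cast; ring
    have en : ‖exp (-α * log (u z))‖ = Real.exp (-α * Real.log ‖u z‖) := by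
      rw [e, norm_mul, Complex.norm_real, Real.norm_of_nonneg (Real.exp_pos _).le, mul_comm I,
        Complex.norm_exp_ofReal_mul_I, mul_one]
    have le1 : Real.exp (-α * Real.log ‖u z‖) ≤ 1 := by
      rw [Real.exp_le_one_iff]
      have := Real.log_nonneg (un z hz)
      nlinarith
    refine ⟨?_, ?_, ?_, ?_⟩
    · have : DifferentiableAt ℂ u z :=
        (((om_diff hr (om_pt G hr hA hRD hp hz).1).const_mul I).div_const _).const_sub 1
      exact ((this.clog us).const_mul _).cexp
    · rw [en]; exact le1
    · beta_reduce
      rw [en, e]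
      have : (Real.exp (-α * Real.log ‖u z‖) : ℂ) * exp (I * ((-α * (u z).arg : ℝ) : ℂ)) -
        (Real.exp (-α * Real.log ‖u z‖) : ℂ) = (Real.exp (-α * Real.log ‖u z‖) : ℂ) *
          (exp (I * ((-α * (u z).arg : ℝ) : ℂ)) - 1) := by ring
      rw [this, norm_mul, Complex.norm_real, Real.norm_of_nonneg (Real.exp_pos _).le]
      have h1 := Real.norm_exp_I_mul_ofReal_sub_one_le (x := -α * (u z).arg)
      have h2 : |(u z).arg| ≤ 2 := by
        have : |(u z).arg| ≤ Real.pi / 2 := Complex.abs_arg_le_pi_div_two_iff.2 (by linarith [ure z hz])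
        linarith [Real.pi_le_four]
      have h3 : ‖-α * (u z).arg‖ ≤ ε := by
        rw [norm_mul, norm_neg, Real.norm_of_nonneg hα0.le, Real.norm_eq_abs]
        nlinarith
      calc _ ≤ 1 * ε := mul_le_mul le1 (h1.trans h3) (norm_nonneg _) zero_le_one
        _ = ε := one_mul _
    · intro hzd
      rw [en]
      have h1 : Y ≤ ‖u z‖ := by
        have h2 : Y + 1 ≤ ‖om r0 (n p) p z‖ / τ := by
          rw [le_div_iff₀ hτ]
          have := (om_pt G hr hA hRD hp hz).2.1
          have e : RD * ((Y + 1) * τ) = d := by rw [hτ']; field_simp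
          have : RD * ((Y + 1) * τ) ≤ RD * ‖om r0 (n p) p z‖ := by linarith
          exact le_of_mul_le_mul_left this hRD0
        have h3 := norm_sub_le (1:ℂ) (u z)
        have h4 : (1:ℂ) - u z = I * om r0 (n p) p z / τ := by simp only [hu]; ring
        rw [h4, norm_div, norm_mul, Complex.norm_I, one_mul, Complex.norm_real,
          Real.norm_of_nonneg hτ.le, norm_one] at h3
        linarith
      have h5 : -Real.log ε / α ≤ Real.log ‖u z‖ := by
        rw [← Real.log_exp (-Real.log ε / α)]
        exact Real.log_le_log hY0 h1
      rw [div_le_iff₀ hα0] at h5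
      calc Real.exp (-α * Real.log ‖u z‖) ≤ Real.exp (Real.log ε) := by
            rw [Real.exp_le_exp]; linarith
        _ = ε := Real.exp_log hε
  · simp [hu, om]

/-- modulus data for the weight `P` -/
lemma weight {D : Set ℂ} (hDb : Bornology.IsBounded D) {P : ℂ → ℂ} (hP : Differentiable ℂ P)
    (hP0 : ∀ z ∈ frontier D, P z ≠ 0) : ∃ S : ℝ, 1 ≤ S ∧ (∀ p ∈ frontier D, ∀ z ∈ closure D,
      ‖P z / P p‖ ≤ S) ∧ ∀ η > 0, ∃ d > 0, ∀ p ∈ frontier D, ∀ z ∈ closure D, ‖z - p‖ ≤ d →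
        ‖P z / P p - 1‖ ≤ η := by
  have hfc : frontier D ⊆ closure D := frontier_subset_closure
  have hc : IsCompact (closure D) := hDb.isCompact_closure
  have hf : IsCompact (frontier D) := hc.of_isClosed_subset isClosed_frontier hfc
  obtain ⟨S0, hS0⟩ := hc.exists_bound_of_continuousOn hP.continuous.continuousOn
  obtain ⟨m, hm, hmP⟩ : ∃ m > 0, ∀ p ∈ frontier D, m ≤ ‖P p‖ := by
    rcases (frontier D).eq_empty_or_nonempty with h | h
    · exact ⟨1, one_pos, by simp [h]⟩
    · obtain ⟨p, hp, hmin⟩ := hf.exists_isMinOn h hP.continuous.norm.continuousOn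
      exact ⟨‖P p‖, norm_pos_iff.2 (hP0 p hp), fun q hq => hmin hq⟩
  refine ⟨max 1 (|S0| / m), le_max_left _ _, ?_, ?_⟩
  · intro p hp z hz
    refine le_trans ?_ (le_max_right _ _)
    rw [norm_div]
    exact div_le_div₀ (abs_nonneg _) ((hS0 z hz).trans (le_abs_self _)) hm (hmP p hp)
  · intro η hη
    have huc := hc.uniformContinuousOn_of_continuous hP.continuous.continuousOn
    rw [Metric.uniformContinuousOn_iff] at huc
    obtain ⟨d, hd, h⟩ := huc (η * m) (by positivity)
    refine ⟨d / 2, by positivity, fun p hp z hz hzp => ?_⟩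
    have := h z hz p (hfc hp) (by rw [dist_eq_norm]; linarith)
    rw [dist_eq_norm] at this
    have e : P z / P p - 1 = (P z - P p) / P p := by
      have := hP0 p hp
      field_simp
    rw [e, norm_div, div_le_iff₀ (norm_pos_iff.2 (hP0 p hp))]
    nlinarith [hmP p hp]

lemma bump {D : Set ℂ} (hDo : IsOpen D) (hDb : Bornology.IsBounded D) (hSB : SmoothlyBounded D)
    {P : ℂ → ℂ} (hP : Differentiable ℂ P) (hP0 : ∀ z ∈ frontier D, P z ≠ 0)
    {p : ℂ} (hp : p ∈ frontier D) {ε d : ℝ} (hε : 0 < ε) (hε1 : ε ≤ 1) (hd : 0 < d) :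
    ∃ b : ℂ → ℂ, ∃ t > 0, (∀ z ∈ closure D, DifferentiableAt ℂ b z) ∧
      (∀ z ∈ closure D, ‖b z * P z‖ ≤ 2 ∧ (∃ r ∈ Icc (0:ℝ) 1, ‖b z * P z - r‖ ≤ ε) ∧
      (d ≤ ‖z - p‖ → ‖b z * P z‖ ≤ ε) ∧ (‖z - p‖ ≤ t → ‖b z * P z - 1‖ ≤ ε)) := by
  have hfc : frontier D ⊆ closure D := frontier_subset_closure
  obtain ⟨S, hS1, hS, hmod⟩ := weight hDb hP hP0
  obtain ⟨d', hd', hm⟩ := hmod (ε / 2) (by positivity)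
  obtain ⟨b, hb, hb1⟩ := bump0 hDo hDb hSB hp (ε := ε / (2 * S)) (d := min d d')
    (by positivity) (by positivity)
  have hPp := hP0 p hp
  have e : ∀ z, b z / P p * P z = b z * (P z / P p) := fun z => by ring
  have hεS : ε / (2 * S) * S = ε / 2 := by field_simp
  have hεS2 : ε / (2 * S) ≤ ε / 2 := by
    rw [← hεS]; exact le_mul_of_one_le_right (by positivity) hS1
  have hct : ContinuousAt (fun z => b z * (P z / P p)) p :=
    ((hb p (hfc hp)).1.continuousAt).mul (hP.continuous.continuousAt.div_const _)
  obtain ⟨t, ht, hct⟩ := Metric.continuousAt_iff.1 hct ε hε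
  refine ⟨fun z => b z / P p, t / 2, by positivity, fun z hz => (hb z hz).1.div_const _,
    fun z hz => ?_⟩
  obtain ⟨-, h1, h2, h3⟩ := hb z hz
  simp only [e]
  have far : min d d' ≤ ‖z - p‖ → ‖b z * (P z / P p)‖ ≤ ε / 2 := by
    intro h
    rw [norm_mul, ← hεS]
    exact mul_le_mul (h3 h) (hS p hp z hz) (norm_nonneg _) (by positivity)
  refine ⟨?_, ?_, ?_, ?_⟩
  · by_cases h : ‖z - p‖ ≤ d'
    · have h4 := hm p hp z hz h
      have h5 := norm_add_le (P z / P p - 1) 1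
      rw [sub_add_cancel, norm_one] at h5
      rw [norm_mul]
      nlinarith [norm_nonneg (b z), norm_nonneg (P z / P p)]
    · push Not at h
      have := far ((min_le_right _ _).trans h.le)
      linarith
  · by_cases h : ‖z - p‖ ≤ d'
    · refine ⟨‖b z‖, ⟨norm_nonneg _, h1⟩, ?_⟩
      have h4 := hm p hp z hz h
      have : b z * (P z / P p) - (‖b z‖:ℂ) = b z * (P z / P p - 1) + (b z - (‖b z‖ : ℂ)) := by ring
      rw [this]
      refine (norm_add_le _ _).trans ?_
      rw [norm_mul]
      have : ‖b z‖ * ‖P z / P p - 1‖ ≤ 1 * (ε / 2) :=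
        mul_le_mul h1 h4 (norm_nonneg _) zero_le_one
      linarith
    · push Not at h
      refine ⟨0, by simp, ?_⟩
      have := far ((min_le_right _ _).trans h.le)
      simp only [Complex.ofReal_zero, sub_zero]
      linarith
  · intro h
    have := far ((min_le_left _ _).trans h)
    linarith
  · intro h
    have := hct (x := z) (by rw [dist_eq_norm]; linarith)
    rw [dist_eq_norm, hb1, one_mul, div_self hPp] at this
    exact this.le

set_option maxHeartbeats 1000000 in
lemma grid' {D : Set ℂ} (hDo : IsOpen D) (hDb : Bornology.IsBounded D) (hSB : SmoothlyBounded D)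
    {P : ℂ → ℂ} (hP : Differentiable ℂ P) (hP0 : ∀ z ∈ frontier D, P z ≠ 0) :
    ∃ N1 : ℝ, 0 < N1 ∧ ∀ q ∈ frontier D, ∃ β > 0, ∀ d > 0, ∀ ε > 0, ε ≤ 1 → ∃ M : ℕ, 0 < M ∧
      ∃ x : ℕ → ℂ, (∀ i ≤ M, x i ∈ frontier D) ∧ (∀ i ≤ M, ∀ j ≤ M, x i = x j → i = j) ∧
      (∀ i < M, ‖x i - x (i + 1)‖ ≤ d) ∧
      ∀ t > 0, ∃ h : ℕ → ℂ → ℂ, ∃ e1 e2 : ℕ → ℂ,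
        (∀ i < M, (∀ z ∈ closure D, DifferentiableAt ℂ (h i) z) ∧ ‖e1 i‖ = 1 ∧ ‖e2 i‖ = 1 ∧
          (∀ z ∈ closure D, ‖h i z * P z‖ ≤ 2) ∧
          (∀ z ∈ closure D, d ≤ ‖z - x i‖ → ‖h i z * P z‖ ≤ ε / M)) ∧
        (∀ z ∈ closure D, ∑ i ∈ Finset.range M, ‖h i z * P z‖ ≤ N1) ∧
        (∀ z ∈ frontier D, (β ≤ ‖z - q‖ ∧ ∀ i < M, ‖h i z * P z‖ ≤ ε / M) ∨
          ∃ i0 < M, (∀ i < M, i ≠ i0 → ‖h i z * P z‖ ≤ ε / M) ∧ ‖z - x i0‖ ≤ d ∧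
            (2 / 5 ≤ ‖h i0 z * P z‖ ∨
              (‖z - x i0‖ < t ∧ ∃ r ∈ Icc (0:ℝ) 1, ‖h i0 z * P z - e1 i0 * r‖ ≤ ε) ∨
              (‖z - x (i0 + 1)‖ < t ∧ ∃ r ∈ Icc (0:ℝ) 1, ‖h i0 z * P z - e2 i0 * r‖ ≤ ε))) := by
  have hfc : frontier D ⊆ closure D := frontier_subset_closure
  obtain ⟨S, hS1, hS, hmod⟩ := weight hDb hP hP0
  obtain ⟨N1, hN1, hg⟩ := grid hDo hDb hSB
  refine ⟨2 * N1 + 1, by positivity, fun q hq => ?_⟩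
  obtain ⟨β, hβ, hg⟩ := hg q hq
  refine ⟨β, hβ, fun d hd ε hε hε1 => ?_⟩
  obtain ⟨d', hd', hm⟩ := hmod (min (ε / 2) (1 / 5)) (by positivity)
  have hS0 : 0 < S := by linarith
  have hεS : ε / (2 * S) * S = ε / 2 := by field_simp
  have hεS2 : ε / (2 * S) ≤ ε / 2 := by
    rw [← hεS]; exact le_mul_of_one_le_right (by positivity) hS1
  obtain ⟨M, hM, x, hx, hinj, hcon, hg⟩ := hg (min d d') (by positivity) (ε / (2 * S))
    (by positivity) (by linarith)
  have hMp : (0:ℝ) < M := by exact_mod_cast hM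
  refine ⟨M, hM, x, hx, hinj, fun i hi => (hcon i hi).trans (min_le_left _ _), fun t ht => ?_⟩
  obtain ⟨h, e1, e2, H1, H2, H3⟩ := hg t ht
  have e : ∀ i z, h i z / P (x i) * P z = h i z * (P z / P (x i)) := fun i z => by ring
  have small : ∀ i < M, ∀ z ∈ closure D, ‖h i z‖ ≤ ε / (2 * S) / M →
      ‖h i z * (P z / P (x i))‖ ≤ ε / M := by
    intro i hi z hz hh
    rw [norm_mul]
    calc ‖h i z‖ * ‖P z / P (x i)‖ ≤ ε / (2 * S) / M * S :=
          mul_le_mul hh (hS _ (hx i hi.le) z hz) (norm_nonneg _) (by positivity)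
      _ = ε / 2 / M := by rw [← hεS]; ring
      _ ≤ ε / M := by gcongr; linarith
  have near : ∀ i < M, ∀ z ∈ closure D, ‖z - x i‖ ≤ d' → ‖P z / P (x i)‖ ≤ 2 := by
    intro i hi z hz hh
    have h4 := (hm _ (hx i hi.le) z hz hh).trans (min_le_right _ _)
    have h5 := norm_add_le (P z / P (x i) - 1) 1
    rw [sub_add_cancel, norm_one] at h5
    linarith
  have all : ∀ i < M, ∀ z ∈ closure D, ‖h i z * (P z / P (x i))‖ ≤ ‖h i z‖ * 2 ∨
      ‖h i z * (P z / P (x i))‖ ≤ ε / M := by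
    intro i hi z hz
    by_cases hh : ‖z - x i‖ ≤ d'
    · left
      rw [norm_mul]
      exact mul_le_mul_of_nonneg_left (near i hi z hz hh) (norm_nonneg _)
    · right
      push Not at hh
      exact small i hi z hz ((H1 i hi).2.2.2.2 z hz ((min_le_right _ _).trans hh.le))
  have hεM : ε / M ≤ 1 := by
    rw [div_le_one hMp]
    have : (1:ℝ) ≤ M := by exact_mod_cast hM
    linarith
  refine ⟨fun i z => h i z / P (x i), e1, e2, ?_, ?_, ?_⟩
  · intro i hi
    obtain ⟨a1, a2, a3, a4, a5⟩ := H1 i hi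
    refine ⟨fun z hz => (a1 z hz).div_const _, a2, a3, fun z hz => ?_, fun z hz hzd => ?_⟩
    · simp only [e]
      rcases all i hi z hz with h1 | h1
      · have := a4 z hz
        linarith
      · linarith
    · simp only [e]
      exact small i hi z hz (a5 z hz ((min_le_left _ _).trans hzd))
  · intro z hz
    simp only [e]
    calc ∑ i ∈ Finset.range M, ‖h i z * (P z / P (x i))‖
        ≤ ∑ i ∈ Finset.range M, (‖h i z‖ * 2 + ε / M) := by
          apply Finset.sum_le_sum
          intro i hi
          rcases all i (Finset.mem_range.1 hi) z hz with h1 | h1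
          · have : 0 ≤ ε / M := by positivity
            linarith
          · linarith [norm_nonneg (h i z)]
      _ = (∑ i ∈ Finset.range M, ‖h i z‖) * 2 + ε := by
          rw [Finset.sum_add_distrib, Finset.sum_mul]; simp; field_simp
      _ ≤ 2 * N1 + 1 := by linarith [H2 z hz]
  · intro z hzf
    have hz := hfc hzf
    simp only [e]
    rcases H3 z hzf with ⟨h1, h2⟩ | ⟨i0, hi0, h1, h2, h3⟩
    · left
      exact ⟨h1, fun i hi => small i hi z hz (h2 i hi)⟩
    · right
      have hd2 := h2.trans (min_le_right d d')
      have hF := hm _ (hx i0 hi0.le) z hz hd2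
      have hF1 := hF.trans (min_le_left _ _)
      have hF2 := hF.trans (min_le_right _ _)
      have ray : ∀ c : ℂ, ‖h i0 z - c‖ ≤ ε / (2 * S) → ‖h i0 z * (P z / P (x i0)) - c‖ ≤ ε := by
        intro c hc
        have : h i0 z * (P z / P (x i0)) - c = h i0 z * (P z / P (x i0) - 1) + (h i0 z - c) := by ring
        rw [this]
        refine (norm_add_le _ _).trans ?_
        rw [norm_mul]
        have : ‖h i0 z‖ * ‖P z / P (x i0) - 1‖ ≤ 1 * (ε / 2) :=
          mul_le_mul ((H1 i0 hi0).2.2.2.1 z hz) hF1 (norm_nonneg _) zero_le_one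
        linarith
      refine ⟨i0, hi0, fun i hi hne => small i hi z hz (h1 i hi hne), h2.trans (min_le_left _ _), ?_⟩
      rcases h3 with h3 | ⟨h3, r, hr, h4⟩ | ⟨h3, r, hr, h4⟩
      · left
        rw [norm_mul]
        have h5 := norm_sub_norm_le (1:ℂ) (1 - P z / P (x i0))
        rw [sub_sub_cancel, norm_one, norm_sub_rev] at h5
        have : 4 / 5 ≤ ‖P z / P (x i0)‖ := by linarith
        nlinarith
      · right; left
        exact ⟨h3, r, hr, ray _ h4⟩
      · right; right
        exact ⟨h3, r, hr, ray _ h4⟩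


lemma modul {N : ℕ} {X W : Set (Cn N)} {ρ : Cn N → ℝ} (hX : IsOpen X) (hρ : ContinuousOn ρ X)
    (hW : IsCompact W) (hWX : W ⊆ X) {ε : ℝ} (hε : 0 < ε) :
    ∃ η > 0, ∀ x ∈ W, ∀ y, ‖y - x‖ ≤ η → y ∈ X ∧ |ρ y - ρ x| ≤ ε := by
  obtain ⟨r, hr, hrX⟩ := hW.exists_cthickening_subset_open hX hWX
  have hc : IsCompact (cthickening r W) := hW.cthickening
  have huc := hc.uniformContinuousOn_of_continuous (hρ.mono hrX)
  obtain ⟨d, hd, h⟩ := Metric.uniformContinuousOn_iff.1 huc ε hε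
  refine ⟨min r (d / 2), by positivity, fun x hx y hy => ?_⟩
  have hyc : y ∈ cthickening r W := by
    apply mem_cthickening_of_dist_le y x r W hx
    rw [dist_eq_norm]; exact hy.trans (min_le_left _ _)
  refine ⟨hrX hyc, ?_⟩
  have := h y hyc x (self_subset_cthickening W hx) (by
    rw [dist_eq_norm]; have := hy.trans (min_le_right _ _); linarith)
  rw [Real.dist_eq] at this
  exact this.le

lemma unit2 (c1 c2 : ℂ) : ∃ u : ℂ, ‖u‖ = 1 ∧ 0 ≤ (c1 * u).re ∧ 0 ≤ (c2 * u).re := by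
  obtain ⟨w, hw, hw0⟩ : ∃ w : ℂ, ‖w‖ = 1 ∧ (c1 * w).re = 0 := by
    by_cases h : c1 = 0
    · exact ⟨1, by simp, by simp [h]⟩
    · refine ⟨I * (starRingEnd ℂ) c1 / ‖c1‖, ?_, ?_⟩
      · rw [norm_div, norm_mul, Complex.norm_I, RCLike.norm_conj, one_mul, Complex.norm_real, norm_norm,
          div_self (norm_ne_zero_iff.2 h)]
      · rw [mul_div_assoc', Complex.div_ofReal_re]
        simp
        left; ring
  rcases le_total 0 (c2 * w).re with h | h
  · exact ⟨w, hw, hw0.ge, h⟩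
  · refine ⟨-w, by simpa using hw, ?_, ?_⟩
    · rw [mul_neg, Complex.neg_re, hw0]; simp
    · rw [mul_neg, Complex.neg_re]; linarith

lemma pd_lip {N : ℕ} {v w : Cn N} {r : ℝ} {ζ ζ' : ℂ} (hv : ‖v‖ ≤ r) (hw : ‖w‖ ≤ r) (h : ‖ζ‖ ≤ 2)
    (h' : ‖ζ'‖ ≤ 2) : ‖pd v w ζ - pd v w ζ'‖ ≤ 5 * r * ‖ζ - ζ'‖ := by
  have : pd v w ζ - pd v w ζ' = (ζ - ζ') • v + ((ζ - ζ') * (ζ + ζ')) • w := by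
    unfold pd
    have e : (ζ - ζ') * (ζ + ζ') = ζ ^ 2 - ζ' ^ 2 := by ring
    rw [e, sub_smul, sub_smul]; abel
  rw [this]
  refine (norm_add_le _ _).trans ?_
  rw [norm_smul, norm_smul, norm_mul]
  have h1 : ‖ζ + ζ'‖ ≤ 4 := (norm_add_le _ _).trans (by linarith)
  have h2 : ‖ζ - ζ'‖ * ‖v‖ ≤ ‖ζ - ζ'‖ * r := by gcongr
  have h3 : ‖ζ - ζ'‖ * ‖ζ + ζ'‖ * ‖w‖ ≤ ‖ζ - ζ'‖ * 4 * r := by gcongr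
  linarith

lemma pd_zero {N : ℕ} (v w : Cn N) : pd v w 0 = 0 := by simp [pd]

lemma pd_le {N : ℕ} {v w : Cn N} {r : ℝ} {ζ : ℂ} (hv : ‖v‖ ≤ r) (hw : ‖w‖ ≤ r) (h : ‖ζ‖ ≤ 2) :
    ‖pd v w ζ‖ ≤ 5 * r * ‖ζ‖ := by
  have := pd_lip hv hw h (ζ' := 0) (by simp)
  simpa [pd_zero] using this

lemma sum_small {N : ℕ} {S : Finset ℕ} {a : ℕ → Cn N} {b m : ℝ} (hb : 0 ≤ b) (hS : (S.card : ℝ) ≤ m)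
    (h : ∀ i ∈ S, ‖a i‖ ≤ b) : ‖∑ i ∈ S, a i‖ ≤ m * b := by
  refine (norm_sum_le_of_le S h).trans ?_
  rw [Finset.sum_const, nsmul_eq_mul]
  gcongr

lemma unif {N : ℕ} {S : Set ℂ} (hS : IsCompact S) {f : ℂ → Cn N} (hf : ContinuousOn f S) {ε : ℝ}
    (hε : 0 < ε) : ∃ d > 0, ∀ z ∈ S, ∀ z' ∈ S, ‖z - z'‖ ≤ d → ‖f z - f z'‖ ≤ ε := by
  have huc := hS.uniformContinuousOn_of_continuous hf
  obtain ⟨d, hd, h⟩ := Metric.uniformContinuousOn_iff.1 huc ε hε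
  refine ⟨d / 2, by positivity, fun z hz z' hz' hzz => ?_⟩
  have := h z hz z' hz' (by rw [dist_eq_norm]; linarith)
  rw [dist_eq_norm] at this
  exact this.le

lemma dist_compl {D K : Set ℂ} (hD : IsOpen D) (hK : IsCompact K) (hKD : K ⊆ D) :
    ∃ d > 0, ∀ z ∈ K, ∀ p ∈ frontier D, d ≤ ‖z - p‖ := by
  obtain ⟨r, hr, hrX⟩ := hK.exists_cthickening_subset_open hD hKD
  refine ⟨r, hr, fun z hz p hp => ?_⟩
  by_contra hc
  push Not at hc
  have : p ∈ D := hrX (mem_cthickening_of_dist_le p z r K hz (by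
    rw [dist_comm, dist_eq_norm]; exact hc.le))
  exact (hD.frontier_eq ▸ hp).2 this


lemma fin_min {ι : Type*} (S : Finset ι) (g : ι → ℝ) (h : ∀ i ∈ S, 0 < g i) :
    ∃ m > 0, ∀ i ∈ S, m ≤ g i := by
  classical
  induction S using Finset.induction_on with
  | empty => exact ⟨1, one_pos, by simp⟩
  | insert a s ha ih =>
    obtain ⟨m, hm, hm2⟩ := ih (fun i hi => h i (Finset.mem_insert_of_mem hi))
    refine ⟨min m (g a), lt_min hm (h a (Finset.mem_insert_self _ _)), fun i hi => ?_⟩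
    rcases Finset.mem_insert.1 hi with rfl | hi
    · exact min_le_right _ _
    · exact (min_le_left _ _).trans (hm2 i hi)

lemma sep {M : ℕ} {x : ℕ → ℂ} (h : ∀ i ≤ M, ∀ j ≤ M, x i = x j → i = j) :
    ∃ m > 0, ∀ i ≤ M, ∀ j ≤ M, i ≠ j → m ≤ ‖x i - x j‖ := by
  classical
  obtain ⟨m, hm, hm2⟩ := fin_min ((Finset.range (M + 1) ×ˢ Finset.range (M + 1)).filter
    (fun p => p.1 ≠ p.2)) (fun p => ‖x p.1 - x p.2‖) (by
      intro p hp
      simp only [Finset.mem_filter, Finset.mem_product, Finset.mem_range] at hp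
      rw [norm_pos_iff, sub_ne_zero]
      exact fun e => hp.2 (h p.1 (by omega) p.2 (by omega) e))
  refine ⟨m, hm, fun i hi j hj hij => hm2 (i, j) ?_⟩
  simp only [Finset.mem_filter, Finset.mem_product, Finset.mem_range]
  exact ⟨⟨by omega, by omega⟩, hij⟩

lemma pd_cont {N : ℕ} {α : Type*} [TopologicalSpace α] (v w : Cn N) {φ : α → ℂ} {S : Set α}
    (h : ContinuousOn φ S) : ContinuousOn (fun x => pd v w (φ x)) S := by
  unfold pd
  exact (h.smul continuousOn_const).add ((h.pow 2).smul continuousOn_const)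

lemma pd_fac {N : ℕ} (v w : Cn N) (e b P : ℂ) :
    pd v w (e * (b * P)) = P • ((e * b) • v + ((e * b) ^ 2 * P) • w) := by
  unfold pd
  rw [smul_add, smul_smul, smul_smul]
  congr 2 <;> ring

/-- Bookkeeping package for a lift over one boundary box. -/
def BoxLift {N : ℕ} (X : Set (Cn N)) (ρ : Cn N → ℝ) (D : Set ℂ) (P : ℂ → ℂ) (f : ℂ → Cn N)
    (K : Set ℂ) (ε : ℝ) (H : ℝ × ℂ → Cn N) : Prop :=
  ContinuousOn H (Icc (0:ℝ) 1 ×ˢ closure D) ∧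
  (∀ s ∈ Icc (0:ℝ) 1, ∀ z ∈ closure D, H (s, z) ∈ X) ∧
  (∀ z, H (0, z) = f z) ∧
  (∀ s ∈ Icc (0:ℝ) 1, ∀ z ∈ K, ‖H (s, z) - f z‖ ≤ ε) ∧
  (∃ G : ℂ → Cn N, DifferentiableOn ℂ G D ∧ ∀ z ∈ D, H (1, z) = f z + P z • G z) ∧
  (∀ z ∈ closure D, ρ (f z) - 1 ≤ ρ (H (1, z))) ∧
  (∀ z ∈ frontier D, ρ (f z) - ε ≤ ρ (H (1, z)))

set_option maxHeartbeats 4000000 in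
lemma boxlift {N : ℕ} {X : Set (Cn N)} (hX : IsOpen X) {ρ : Cn N → ℝ}
    (hρ : ContDiffOn ℝ (⊤ : ℕ∞) ρ X) (hexh : ∀ c : ℝ, IsCompact {x ∈ X | ρ x ≤ c})
    {c : ℝ} (hLevi : ∀ x ∈ X, c < ρ x → TwoPosEigen ρ x)
    {D : Set ℂ} (hDo : IsOpen D) (hDb : Bornology.IsBounded D) (hSB : SmoothlyBounded D)
    {P : ℂ → ℂ} (hP : Differentiable ℂ P) (hP0 : ∀ z ∈ frontier D, P z ≠ 0)
    {c' C : ℝ} (hcc : c < c') :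
    ∃ δ > 0, ∀ q ∈ frontier D, ∃ β > 0, ∀ f : ℂ → Cn N, ContinuousOn f (closure D) →
      (∀ z ∈ closure D, f z ∈ X) → (∀ z ∈ frontier D, c' ≤ ρ (f z)) →
      ∀ K ⊆ D, IsCompact K → ∀ ε > 0, ∃ H, BoxLift X ρ D P f K ε H ∧
        (∀ z ∈ frontier D, ‖z - q‖ < β → min (ρ (f z) + δ) C ≤ ρ (H (1, z))) := by
  have hfc : frontier D ⊆ closure D := frontier_subset_closure
  have hcD : IsCompact (closure D) := hDb.isCompact_closure
  obtain ⟨N1, hN1, hgrid⟩ := grid' hDo hDb hSB hP hP0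
  set L1 : Set (Cn N) := {x ∈ X | c' ≤ ρ x ∧ ρ x ≤ C + 1} with hL1
  have hρc : ContinuousOn ρ X := hρ.continuousOn
  have hL1c : IsCompact L1 := by
    have h1 := hexh (C + 1)
    have h2 : IsClosed ({x ∈ X | ρ x ≤ C + 1} ∩ ρ ⁻¹' (Ici c')) :=
      (hρc.mono (fun x hx => hx.1)).preimage_isClosed_of_isClosed h1.isClosed isClosed_Ici
    refine h1.of_isClosed_subset ?_ (fun x hx => ⟨hx.1, hx.2.2⟩)
    convert h2 using 1
    ext x
    simp only [hL1, mem_setOf_eq, mem_inter_iff, mem_preimage, mem_Ici]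
    tauto
  have hL1X : L1 ⊆ X := fun x hx => hx.1
  have hL1L : ∀ x ∈ L1, TwoPosEigen ρ x := fun x hx => hLevi x hx.1 (lt_of_lt_of_le hcc hx.2.1)
  obtain ⟨r2', hr2', hmodL⟩ := modul hX hρc hL1c hL1X (ε := 1 / 4) (by norm_num)
  obtain ⟨rX, hrX, hrXX⟩ := hL1c.exists_cthickening_subset_open hX hL1X
  set r2 := min r2' rX with hr2
  have hr20 : 0 < r2 := by positivity
  set rb := r2 / (100 * (N1 + 1)) with hrb
  have hrb0 : 0 < rb := by positivity
  have hrbN : 5 * rb * N1 ≤ r2 / 20 := by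
    have : rb * (N1 + 1) = r2 / 100 := by rw [hrb]; field_simp
    nlinarith
  have hrb1 : 5 * rb ≤ r2 / 20 := by
    have : rb * (N1 + 1) = r2 / 100 := by rw [hrb]; field_simp
    nlinarith
  obtain ⟨σB, hσB, rB, hrB, discB⟩ := disc_unif hX hρ hL1c hL1X hL1L hrb0
  set ra := min (rB / 100) (r2 / 100) with hra
  have hra0 : 0 < ra := by positivity
  have hraB : ra ≤ rB / 100 := min_le_left _ _
  have hra2 : ra ≤ r2 / 100 := min_le_right _ _
  obtain ⟨σA, hσA, rA, hrA, discA⟩ := disc_unif hX hρ hL1c hL1X hL1L hra0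
  set δ := min σA σB / 2 with hδ
  have hδ0 : 0 < δ := by positivity
  have hδA : 2 * δ ≤ σA := by have := min_le_left σA σB; rw [hδ]; linarith
  have hδB : 2 * δ ≤ σB := by have := min_le_right σA σB; rw [hδ]; linarith
  refine ⟨δ, hδ0, fun q hq => ?_⟩
  obtain ⟨β, hβ, hgrid⟩ := hgrid q hq
  refine ⟨β, hβ, fun f hf hfX hfb K hKD hK ε hε => ?_⟩
  -- constants depending on f
  set W : Set (Cn N) := cthickening r2 L1 ∪ f '' closure D with hW
  have hWc : IsCompact W := hL1c.cthickening.union (hcD.image_of_continuousOn hf)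
  have hWX : W ⊆ X := by
    rintro y (hy | ⟨z, hz, rfl⟩)
    · exact hrXX (cthickening_mono (min_le_right _ _) _ hy)
    · exact hfX z hz
  have hfW : ∀ z ∈ closure D, f z ∈ W := fun z hz => Or.inr ⟨z, hz, rfl⟩
  have hLW : ∀ x ∈ L1, ∀ y, ‖y - x‖ ≤ r2 → y ∈ W ∧ y ∈ X ∧ |ρ y - ρ x| ≤ 1 / 4 := by
    intro x hx y hy
    have hyW : y ∈ W := Or.inl (mem_cthickening_of_dist_le y x r2 L1 hx (by rw [dist_eq_norm]; exact hy))
    exact ⟨hyW, hWX hyW, (hmodL x hx y (hy.trans (min_le_left _ _))).2⟩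
  set ε' := min (ε / 4) (min (1 / 8) (δ / 4)) with hε'
  have hε'0 : 0 < ε' := by positivity
  have hε'1 : ε' ≤ ε / 4 := min_le_left _ _
  have hε'2 : ε' ≤ 1 / 8 := (min_le_right _ _).trans (min_le_left _ _)
  have hε'3 : ε' ≤ δ / 4 := (min_le_right _ _).trans (min_le_right _ _)
  obtain ⟨η', hη', hmodW'⟩ := modul hX hρc hWc hWX hε'0
  set η := min η' ε with hη
  have hη0 : 0 < η := by positivity
  have hηε : η ≤ ε := min_le_right _ _
  have hmodW : ∀ x ∈ W, ∀ y, ‖y - x‖ ≤ η → y ∈ X ∧ |ρ y - ρ x| ≤ ε' := fun x hx y hy =>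
    hmodW' x hx y (hy.trans (min_le_left _ _))
  clear hmodW'
  obtain ⟨η0, hη0', hmod4⟩ := modul hX hρc hWc hWX (ε := 1 / 4) (by norm_num)
  obtain ⟨d0, hd0, hfd0⟩ := unif hcD hf (ε := min (min (rB / 4) (r2 / 4)) η0) (by positivity)
  obtain ⟨tf, htf, hftf⟩ := unif hcD hf (ε := η / 8) (by positivity)
  obtain ⟨dK, hdK, hdK2⟩ := dist_compl hDo hK hKD
  set d := min d0 dK with hd
  have hdp : 0 < d := by positivity
  have hfd : ∀ z ∈ closure D, ∀ z' ∈ closure D, ‖z - z'‖ ≤ d →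
      ‖f z - f z'‖ ≤ rB / 4 ∧ ‖f z - f z'‖ ≤ r2 / 4 ∧ |ρ (f z) - ρ (f z')| ≤ 1 / 4 := by
    intro z hz z' hz' h
    have := hfd0 z hz z' hz' (h.trans (min_le_left _ _))
    refine ⟨this.trans ((min_le_left _ _).trans (min_le_left _ _)),
      this.trans ((min_le_left _ _).trans (min_le_right _ _)), ?_⟩
    exact (hmod4 (f z') (hfW z' hz') (f z) (this.trans (min_le_right _ _))).2
  clear hfd0 hmod4
  set ε1 := min 1 (η / (40 * rb)) with hε1
  have hε10 : 0 < ε1 := by positivity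
  have hε11 : 5 * rb * ε1 ≤ η / 8 := by
    have : ε1 ≤ η / (40 * rb) := min_le_right _ _
    rw [le_div_iff₀ (by positivity)] at this
    linarith
  obtain ⟨M, hM, x, hx, hinj, hcon, hgrid⟩ := hgrid d hdp ε1 hε10 (min_le_left _ _)
  have hMp : (0:ℝ) < M := by exact_mod_cast hM
  have hxc : ∀ T ≤ M, x T ∈ closure D := fun T hT => hfc (hx T hT)
  obtain ⟨msep, hmsep, hsep⟩ := sep hinj
  set dA := min d (min tf (msep / 2)) with hdA
  have hdA0 : 0 < dA := by positivity
  have hdAd : dA ≤ d := min_le_left _ _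
  have hdAt : dA ≤ tf := (min_le_right _ _).trans (min_le_left _ _)
  have hdAs : dA ≤ msep / 2 := (min_le_right _ _).trans (min_le_right _ _)
  set εA := min (1 / ((M:ℝ) + 1)) (η / (40 * ra * ((M:ℝ) + 1))) with hεA
  have hεA0 : 0 < εA := by positivity
  have hεA1 : ((M:ℝ) + 1) * εA ≤ 1 := by
    have : εA ≤ 1 / ((M:ℝ) + 1) := min_le_left _ _
    rw [le_div_iff₀ (by positivity)] at this
    linarith
  have hεA1' : εA ≤ 1 := by nlinarith
  have hεA2 : ((M:ℝ) + 1) * (5 * ra * εA) ≤ η / 8 := by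
    have : εA ≤ η / (40 * ra * ((M:ℝ) + 1)) := min_le_right _ _
    rw [le_div_iff₀ (by positivity)] at this
    linarith
  have hεA3 : 5 * ra * εA ≤ η / 8 := by
    have : 0 ≤ M * (5 * ra * εA) := by positivity
    linarith
  have hbump : ∀ T : ℕ, ∃ b : ℂ → ℂ, ∃ t : ℝ, 0 < t ∧ (T ≤ M → _) := fun T => by
    by_cases hT : T ≤ M
    · obtain ⟨b, t, ht, h⟩ := bump hDo hDb hSB hP hP0 (hx T hT) hεA0 hεA1' hdA0
      exact ⟨b, t, ht, fun _ => h⟩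
    · exact ⟨0, 1, one_pos, fun h => absurd h hT⟩
  choose b tb htb hb using hbump
  obtain ⟨tm, htm, htm2⟩ := fin_min (Finset.range (M + 1)) tb (fun i _ => htb i)
  set t := min tm dA with ht
  have ht0 : 0 < t := by positivity
  obtain ⟨h, e1, e2, hh1, hh2, hh3⟩ := hgrid t ht0
  -- A discs
  have hA : ∀ T : ℕ, ∃ v w : Cn N, ∃ e : ℂ, T ≤ M → ‖v‖ ≤ ra ∧ ‖w‖ ≤ ra ∧ ‖e‖ = 1 ∧
      (ρ (f (x T)) ≤ C + 1 → ρ (f (x T)) + σA ≤ ρ (f (x T) + pd v w e)) ∧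
      (∀ r ∈ Icc (0:ℝ) 1, ρ (f (x T)) ≤ ρ (f (x T) + pd v w (e * r))) ∧
      (C + 1 < ρ (f (x T)) → v = 0 ∧ w = 0) := by
    intro T
    by_cases hT : T ≤ M
    swap
    · exact ⟨0, 0, 0, fun h => absurd h hT⟩
    by_cases hact : ρ (f (x T)) ≤ C + 1
    · obtain ⟨v, w, hv, hw, H⟩ := discA (f (x T)) ⟨hfX _ (hxc T hT), hfb _ (hx T hT), hact⟩
      obtain ⟨-, H2, cc, H3⟩ := H (f (x T)) (mem_ball_self hrA)
      obtain ⟨u, hu, hu1, -⟩ := unit2 cc cc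
      refine ⟨v, w, u, fun _ => ⟨hv, hw, hu, fun _ => H2 u (by rw [hu]; norm_num) (by rw [hu]; norm_num),
        fun r hr => ?_, fun h => absurd hact (not_le.2 h)⟩⟩
      have := H3 (u * r) (by
        rw [norm_mul, hu, Complex.norm_real, Real.norm_of_nonneg hr.1]; linarith [hr.2]) (by
        rw [← mul_assoc, Complex.re_mul_ofReal]; exact mul_nonneg hu1 hr.1)
      have h0 : 0 ≤ σA * ‖u * (r:ℂ)‖ ^ 2 := by positivity
      linarith
    · exact ⟨0, 0, 1, fun _ => ⟨by simp [hra0.le], by simp [hra0.le], by simp, fun h => absurd h hact,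
        fun r hr => by simp [pd], fun _ => ⟨rfl, rfl⟩⟩⟩
  choose vA wA eA hA using hA
  set x' : ℕ → Cn N := fun T => f (x T) + pd (vA T) (wA T) (eA T) with hx'
  have hpA1 : ∀ T ≤ M, ∀ ζ : ℂ, ‖ζ‖ ≤ 2 → ‖pd (vA T) (wA T) ζ‖ ≤ 5 * ra * ‖ζ‖ := fun T hT ζ hζ =>
    pd_le (hA T hT).1 (hA T hT).2.1 hζ
  have hx'n : ∀ T ≤ M, ‖x' T - f (x T)‖ ≤ 5 * ra := by
    intro T hT
    have := hpA1 T hT (eA T) (by rw [(hA T hT).2.2.1]; norm_num)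
    rw [(hA T hT).2.2.1] at this
    simpa [hx'] using this
  have hxx : ∀ i < M, ‖f (x (i + 1)) - f (x i)‖ ≤ rB / 4 ∧ ‖f (x (i + 1)) - f (x i)‖ ≤ r2 / 4 := by
    intro i hi
    have := hfd (x (i + 1)) (hxc _ hi) (x i) (hxc _ hi.le) (by rw [norm_sub_rev]; exact hcon i hi)
    exact ⟨this.1, this.2.1⟩
  -- B discs
  have hB : ∀ i : ℕ, ∃ v w : Cn N, ∃ u : ℂ, i < M → ‖v‖ ≤ rb ∧ ‖w‖ ≤ rb ∧ ‖u‖ = 1 ∧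
      (C + 1 < ρ (f (x i)) → v = 0 ∧ w = 0) ∧
      (ρ (f (x i)) ≤ C + 1 → (∀ y, ‖y - f (x i)‖ < rB → ∀ ζ : ℂ, 2 / 5 ≤ ‖ζ‖ → ‖ζ‖ ≤ 2 →
          ρ y + σB ≤ ρ (y + pd v w ζ)) ∧
        (∀ r ∈ Icc (0:ℝ) 1, ρ (x' i) ≤ ρ (x' i + pd v w (u * (e1 i * r)))) ∧
        (∀ r ∈ Icc (0:ℝ) 1, ρ (x' (i + 1)) ≤ ρ (x' (i + 1) + pd v w (u * (e2 i * r))))) := by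
    intro i
    by_cases hi : i < M
    swap
    · exact ⟨0, 0, 0, fun h => absurd h hi⟩
    by_cases hact : ρ (f (x i)) ≤ C + 1
    · obtain ⟨v, w, hv, hw, H⟩ := discB (f (x i)) ⟨hfX _ (hxc i hi.le), hfb _ (hx i hi.le), hact⟩
      have m1 : x' i ∈ ball (f (x i)) rB := by
        rw [mem_ball, dist_eq_norm]
        have := hx'n i hi.le
        linarith
      have m2 : x' (i + 1) ∈ ball (f (x i)) rB := by
        rw [mem_ball, dist_eq_norm]
        have h1 := hx'n (i + 1) hi
        have h2 := (hxx i hi).1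
        have := norm_add_le (x' (i + 1) - f (x (i + 1))) (f (x (i + 1)) - f (x i))
        rw [sub_add_sub_cancel] at this
        linarith
      obtain ⟨-, -, c1, H1⟩ := H _ m1
      obtain ⟨-, -, c2, H2⟩ := H _ m2
      obtain ⟨u, hu, hu1, hu2⟩ := unit2 (c1 * e1 i) (c2 * e2 i)
      refine ⟨v, w, u, fun _ => ⟨hv, hw, hu, fun h => absurd hact (not_le.2 h), fun _ => ⟨?_, ?_, ?_⟩⟩⟩
      · intro y hy
        exact (H y (by rw [mem_ball, dist_eq_norm]; exact hy)).2.1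
      · intro r hr
        have := H1 (u * (e1 i * r)) (by
          rw [norm_mul, norm_mul, hu, (hh1 i hi).2.1, Complex.norm_real, Real.norm_of_nonneg hr.1]
          linarith [hr.2]) (by
          have e : c1 * (u * (e1 i * r)) = (c1 * e1 i * u) * r := by ring
          rw [e, Complex.re_mul_ofReal]; exact mul_nonneg hu1 hr.1)
        have h0 : 0 ≤ σB * ‖u * (e1 i * (r:ℂ))‖ ^ 2 := by positivity
        linarith
      · intro r hr
        have := H2 (u * (e2 i * r)) (by
          rw [norm_mul, norm_mul, hu, (hh1 i hi).2.2.1, Complex.norm_real, Real.norm_of_nonneg hr.1]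
          linarith [hr.2]) (by
          have e : c2 * (u * (e2 i * r)) = (c2 * e2 i * u) * r := by ring
          rw [e, Complex.re_mul_ofReal]; exact mul_nonneg hu2 hr.1)
        have h0 : 0 ≤ σB * ‖u * (e2 i * (r:ℂ))‖ ^ 2 := by positivity
        linarith
    · exact ⟨0, 0, 1, fun _ => ⟨by simp [hrb0.le], by simp [hrb0.le], by simp, fun _ => ⟨rfl, rfl⟩,
        fun h => absurd h hact⟩⟩
  choose vB wB uB hB using hB
  clear discA discB
  have pd00 : ∀ ζ : ℂ, pd (0 : Cn N) 0 ζ = 0 := fun ζ => by simp [pd]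
  set pA : ℕ → ℝ → ℂ → Cn N := fun T s z => pd (vA T) (wA T) ((s:ℂ) * (eA T * (b T z * P z))) with hpA
  set pB : ℕ → ℝ → ℂ → Cn N := fun i s z => pd (vB i) (wB i) ((s:ℂ) * (uB i * (h i z * P z))) with hpB
  have pAle : ∀ T ≤ M, ∀ s ∈ Icc (0:ℝ) 1, ∀ z ∈ closure D, ‖pA T s z‖ ≤ 5 * ra * ‖b T z * P z‖ := by
    intro T hT s hs z hz
    have h1 : ‖(s:ℂ) * (eA T * (b T z * P z))‖ ≤ ‖b T z * P z‖ := by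
      rw [norm_mul, norm_mul (eA T), (hA T hT).2.2.1, one_mul, Complex.norm_real, Real.norm_of_nonneg hs.1]
      exact mul_le_of_le_one_left (norm_nonneg _) hs.2
    refine (hpA1 T hT _ (h1.trans ((hb T hT).2 z hz).1)).trans ?_
    gcongr
  have pBle : ∀ i < M, ∀ s ∈ Icc (0:ℝ) 1, ∀ z ∈ closure D, ‖pB i s z‖ ≤ 5 * rb * ‖h i z * P z‖ := by
    intro i hi s hs z hz
    have h1 : ‖(s:ℂ) * (uB i * (h i z * P z))‖ ≤ ‖h i z * P z‖ := by
      rw [norm_mul, norm_mul (uB i), (hB i hi).2.2.1, one_mul, Complex.norm_real, Real.norm_of_nonneg hs.1]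
      exact mul_le_of_le_one_left (norm_nonneg _) hs.2
    refine (pd_le (hB i hi).1 (hB i hi).2.1 (h1.trans ((hh1 i hi).2.2.2.1 z hz))).trans ?_
    gcongr
  have pA0 : ∀ T ≤ M, ∀ s z, C + 1 < ρ (f (x T)) → pA T s z = 0 := by
    intro T hT s z hin
    obtain ⟨h1, h2⟩ := (hA T hT).2.2.2.2.2 hin
    simp only [hpA, h1, h2, pd00]
  have pB0 : ∀ i < M, ∀ s z, C + 1 < ρ (f (x i)) → pB i s z = 0 := by
    intro i hi s z hin
    obtain ⟨h1, h2⟩ := (hB i hi).2.2.2.1 hin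
    simp only [hpB, h1, h2, pd00]
  have Z1 : ∀ z : ℂ, ∃ T0 ≤ M, ∀ T ≤ M, T ≠ T0 → dA ≤ ‖z - x T‖ := by
    intro z
    by_cases hex : ∃ T0 ≤ M, ‖z - x T0‖ < dA
    · obtain ⟨T0, hT0, hlt⟩ := hex
      refine ⟨T0, hT0, fun T hT hne => ?_⟩
      have h1 := hsep T hT T0 hT0 hne
      have h2 := norm_sub_le (z - x T0) (z - x T)
      rw [show z - x T0 - (z - x T) = x T - x T0 by ring] at h2
      linarith
    · push Not at hex
      exact ⟨0, by omega, fun T hT _ => hex T hT⟩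
  have restA : ∀ s ∈ Icc (0:ℝ) 1, ∀ z ∈ closure D, ∀ T0 ≤ M, (∀ T ≤ M, T ≠ T0 → dA ≤ ‖z - x T‖) →
      ‖∑ T ∈ Finset.range (M + 1), pA T s z - pA T0 s z‖ ≤ ((M:ℝ) + 1) * (5 * ra * εA) := by
    intro s hs z hz T0 hT0 hfar
    rw [← Finset.add_sum_erase _ _ (Finset.mem_range.2 (Nat.lt_succ_of_le hT0)), add_sub_cancel_left]
    apply sum_small (by positivity)
    · have := Finset.card_le_card (Finset.erase_subset T0 (Finset.range (M + 1)))
      rw [Finset.card_range] at this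
      exact_mod_cast this
    · intro T hT
      have hT' : T ≤ M := by have := Finset.mem_range.1 (Finset.mem_of_mem_erase hT); omega
      refine (pAle T hT' s hs z hz).trans ?_
      have := ((hb T hT').2 z hz).2.2.1 (hfar T hT' (Finset.ne_of_mem_erase hT))
      gcongr
  have hMe : (M:ℝ) * (5 * rb * (ε1 / M)) = 5 * rb * ε1 := by field_simp
  have restB : ∀ s ∈ Icc (0:ℝ) 1, ∀ z ∈ closure D, ∀ i0 < M, (∀ i < M, i ≠ i0 → ‖h i z * P z‖ ≤ ε1 / M) →
      ‖∑ i ∈ Finset.range M, pB i s z - pB i0 s z‖ ≤ η / 8 := by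
    intro s hs z hz i0 hi0 hfar
    rw [← Finset.add_sum_erase _ _ (Finset.mem_range.2 hi0), add_sub_cancel_left]
    refine le_trans ?_ (hMe.le.trans hε11)
    apply sum_small (by positivity)
    · have := Finset.card_le_card (Finset.erase_subset i0 (Finset.range M))
      rw [Finset.card_range] at this
      exact_mod_cast this
    · intro i hi
      have hi' : i < M := Finset.mem_range.1 (Finset.mem_of_mem_erase hi)
      refine (pBle i hi' s hs z hz).trans ?_
      have := hfar i hi' (Finset.ne_of_mem_erase hi)
      gcongr
  have allB : ∀ s ∈ Icc (0:ℝ) 1, ∀ z ∈ closure D, (∀ i < M, ρ (f (x i)) ≤ C + 1 → ‖h i z * P z‖ ≤ ε1 / M) →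
      ‖∑ i ∈ Finset.range M, pB i s z‖ ≤ η / 8 := by
    intro s hs z hz hfar
    refine le_trans ?_ (hMe.le.trans hε11)
    apply sum_small (by positivity)
    · rw [Finset.card_range]
    · intro i hi
      have hi' : i < M := Finset.mem_range.1 hi
      by_cases hact : ρ (f (x i)) ≤ C + 1
      · refine (pBle i hi' s hs z hz).trans ?_
        have := hfar i hi' hact
        gcongr
      · rw [pB0 i hi' s z (not_le.1 hact), norm_zero]; positivity
  have Z2 : ∀ s ∈ Icc (0:ℝ) 1, ∀ z ∈ closure D,
      ‖∑ T ∈ Finset.range (M + 1), pA T s z + ∑ i ∈ Finset.range M, pB i s z‖ ≤ r2 / 2 := by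
    intro s hs z hz
    obtain ⟨T0, hT0, hfar⟩ := Z1 z
    have h1 := restA s hs z hz T0 hT0 hfar
    have h2 := pAle T0 hT0 s hs z hz
    have h3 := ((hb T0 hT0).2 z hz).1
    have h4 : ‖∑ i ∈ Finset.range M, pB i s z‖ ≤ 5 * rb * N1 := by
      refine (norm_sum_le_of_le _ (fun i hi => pBle i (Finset.mem_range.1 hi) s hs z hz)).trans ?_
      rw [← Finset.mul_sum]
      have := hh2 z hz
      gcongr
    have h5 : 5 * ra * ‖b T0 z * P z‖ ≤ 5 * ra * 2 := by gcongr
    have h6 : ((M:ℝ) + 1) * (5 * ra * εA) ≤ 5 * ra := by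
      have : 5 * ra * (((M:ℝ) + 1) * εA) ≤ 5 * ra * 1 := by gcongr
      linarith
    have h7 := norm_add_le (∑ T ∈ Finset.range (M + 1), pA T s z - pA T0 s z) (pA T0 s z)
    rw [sub_add_cancel] at h7
    have h8 := norm_add_le (∑ T ∈ Finset.range (M + 1), pA T s z) (∑ i ∈ Finset.range M, pB i s z)
    linarith
  have Z3 : ∀ s ∈ Icc (0:ℝ) 1, ∀ z ∈ closure D, (∀ T ≤ M, ρ (f (x T)) ≤ C + 1 → d ≤ ‖z - x T‖) →
      ‖∑ T ∈ Finset.range (M + 1), pA T s z + ∑ i ∈ Finset.range M, pB i s z‖ ≤ η / 4 := by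
    intro s hs z hz hfar
    have h1 := allB s hs z hz (fun i hi hact => (hh1 i hi).2.2.2.2 z hz (hfar i hi.le hact))
    have h2 : ‖∑ T ∈ Finset.range (M + 1), pA T s z‖ ≤ ((M:ℝ) + 1) * (5 * ra * εA) := by
      apply sum_small (by positivity)
      · rw [Finset.card_range]; push_cast; exact le_rfl
      · intro T hT
        have hT' : T ≤ M := by have := Finset.mem_range.1 hT; omega
        by_cases hact : ρ (f (x T)) ≤ C + 1
        · refine (pAle T hT' s hs z hz).trans ?_
          have := ((hb T hT').2 z hz).2.2.1 (hdAd.trans (hfar T hT' hact))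
          gcongr
        · rw [pA0 T hT' s z (not_le.1 hact), norm_zero]; positivity
    have h8 := norm_add_le (∑ T ∈ Finset.range (M + 1), pA T s z) (∑ i ∈ Finset.range M, pB i s z)
    linarith
  set H : ℝ × ℂ → Cn N := fun p => f p.2 + (∑ T ∈ Finset.range (M + 1), pA T p.1 p.2 +
    ∑ i ∈ Finset.range M, pB i p.1 p.2) with hH
  have Hint : ∀ s ∈ Icc (0:ℝ) 1, ∀ z ∈ closure D, H (s, z) ∈ X ∧ ρ (f z) - 1 ≤ ρ (H (s, z)) := by
    intro s hs z hz
    by_cases hex : ∃ T ≤ M, ρ (f (x T)) ≤ C + 1 ∧ ‖z - x T‖ < d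
    · obtain ⟨T, hT, hact, hlt⟩ := hex
      have h1 := hfd z hz (x T) (hxc T hT) hlt.le
      have h2 := Z2 s hs z hz
      have h3 : ‖H (s, z) - f (x T)‖ ≤ r2 := by
        have : H (s, z) - f (x T) = (f z - f (x T)) + (∑ T ∈ Finset.range (M + 1), pA T s z +
            ∑ i ∈ Finset.range M, pB i s z) := by simp only [hH]; abel
        rw [this]
        refine (norm_add_le _ _).trans ?_
        linarith [h1.2.1]
      have h4 := hLW (f (x T)) ⟨hfX _ (hxc T hT), hfb _ (hx T hT), hact⟩ _ h3
      refine ⟨h4.2.1, ?_⟩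
      have h5 := abs_le.1 h4.2.2
      have h6 := abs_le.1 h1.2.2
      linarith [h5.1, h6.2]
    · push Not at hex
      have h3 := Z3 s hs z hz hex
      have h4 := hmodW (f z) (hfW z hz) (H (s, z)) (by
        simp only [hH, add_sub_cancel_left]; linarith)
      refine ⟨h4.1, ?_⟩
      have h5 := abs_le.1 h4.2
      linarith [h5.1]
  have one1 : (1:ℝ) ∈ Icc (0:ℝ) 1 := ⟨zero_le_one, le_rfl⟩
  -- boundary estimates
  have Hbd : ∀ z ∈ frontier D, ρ (f z) - ε ≤ ρ (H (1, z)) ∧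
      (‖z - q‖ < β → min (ρ (f z) + δ) C ≤ ρ (H (1, z))) := by
    intro z hzf
    have hz := hfc hzf
    obtain ⟨T0, hT0, hfar⟩ := Z1 z
    have hrA8 := (restA 1 one1 z hz T0 hT0 hfar).trans hεA2
    have hpb := pAle T0 hT0 1 one1 z hz
    have hb2 := (hb T0 hT0).2 z hz
    have hpb10 : ‖pA T0 1 z‖ ≤ 10 * ra := by
      have : 5 * ra * ‖b T0 z * P z‖ ≤ 5 * ra * 2 := by gcongr; exact hb2.1
      linarith
    have fin : ∀ w ∈ W, ‖H (1, z) - w‖ ≤ η → ρ w - ε' ≤ ρ (H (1, z)) := by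
      intro w hw hle
      have := abs_le.1 (hmodW w hw _ hle).2
      linarith [this.1]
    obtain ⟨w0, hw0, hyw, hρw⟩ : ∃ w0 ∈ W, ‖f z + pA T0 1 z - w0‖ ≤ η / 4 ∧ ρ (f z) - ε' ≤ ρ w0 := by
      by_cases hnear : ‖z - x T0‖ < dA
      · obtain ⟨r, hr, hbr⟩ := hb2.2.1
        have hf8 := hftf z hz (x T0) (hxc T0 hT0) (hnear.le.trans hdAt)
        have hA0 := hA T0 hT0
        have hre : ‖eA T0 * (r:ℂ)‖ ≤ 1 := by
          rw [norm_mul, hA0.2.2.1, Complex.norm_real, Real.norm_of_nonneg hr.1]; linarith [hr.2]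
        have hn : ‖((1:ℝ):ℂ) * (eA T0 * (b T0 z * P z))‖ ≤ 2 := by
          rw [norm_mul, norm_mul (eA T0), hA0.2.2.1]; simpa using hb2.1
        refine ⟨f (x T0) + pd (vA T0) (wA T0) (eA T0 * r), ?_, ?_, ?_⟩
        · by_cases hact : ρ (f (x T0)) ≤ C + 1
          · refine (hLW (f (x T0)) ⟨hfX _ (hxc T0 hT0), hfb _ (hx T0 hT0), hact⟩ _ ?_).1
            rw [add_sub_cancel_left]
            refine (hpA1 T0 hT0 _ (by linarith)).trans ?_
            have : 5 * ra * ‖eA T0 * (r:ℂ)‖ ≤ 5 * ra * 1 := by gcongr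
            linarith
          · obtain ⟨h1, h2⟩ := hA0.2.2.2.2.2 (not_le.1 hact)
            rw [h1, h2, pd00, add_zero]
            exact hfW _ (hxc T0 hT0)
        · have h1 : ‖pA T0 1 z - pd (vA T0) (wA T0) (eA T0 * r)‖ ≤ 5 * ra * εA := by
            refine (pd_lip hA0.1 hA0.2.1 hn (by linarith)).trans ?_
            have : ((1:ℝ):ℂ) * (eA T0 * (b T0 z * P z)) - eA T0 * r = eA T0 * (b T0 z * P z - r) := by
              push_cast; ring
            rw [this, norm_mul, hA0.2.2.1, one_mul]
            gcongr
          have h2 := norm_add_le (f z - f (x T0)) (pA T0 1 z - pd (vA T0) (wA T0) (eA T0 * r))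
          rw [show f z - f (x T0) + (pA T0 1 z - pd (vA T0) (wA T0) (eA T0 * r)) =
            f z + pA T0 1 z - (f (x T0) + pd (vA T0) (wA T0) (eA T0 * r)) by abel] at h2
          linarith
        · have h1 := hA0.2.2.2.2.1 r hr
          have h2 := abs_le.1 (hmodW (f z) (hfW z hz) (f (x T0)) (by rw [norm_sub_rev]; linarith)).2
          linarith [h2.1]
      · refine ⟨f z, hfW z hz, ?_, by linarith⟩
        rw [add_sub_cancel_left]
        have := hb2.2.2.1 (not_lt.1 hnear)
        have : 5 * ra * ‖b T0 z * P z‖ ≤ 5 * ra * εA := by gcongr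
        linarith
    -- when the B-part is small
    have smallB : ‖∑ i ∈ Finset.range M, pB i 1 z‖ ≤ η / 8 → ρ (f z) - 2 * ε' ≤ ρ (H (1, z)) := by
      intro hsb
      have h1 := fin w0 hw0 (by
        have e : H (1, z) - w0 = (f z + pA T0 1 z - w0) + (∑ T ∈ Finset.range (M + 1), pA T 1 z - pA T0 1 z)
          + ∑ i ∈ Finset.range M, pB i 1 z := by simp only [hH]; abel
        rw [e]
        refine (norm_add_le _ _).trans ?_
        have := norm_add_le (f z + pA T0 1 z - w0) (∑ T ∈ Finset.range (M + 1), pA T 1 z - pA T0 1 z)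
        linarith)
      linarith
    rcases hh3 z hzf with ⟨hβz, hsm⟩ | ⟨i0, hi0, hsm, hzi, hcase⟩
    · have := smallB (allB 1 one1 z hz (fun i hi _ => hsm i hi))
      exact ⟨by linarith, fun hlt => absurd hlt (not_lt.2 hβz)⟩
    have hrB8 := restB 1 one1 z hz i0 hi0 hsm
    by_cases hact : ρ (f (x i0)) ≤ C + 1
    swap
    · have h0 := pB0 i0 hi0 1 z (not_le.1 hact)
      rw [h0, sub_zero] at hrB8
      have h1 := smallB hrB8
      have h2 := abs_le.1 (hfd z hz (x i0) (hxc i0 hi0.le) hzi).2.2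
      refine ⟨by linarith, fun _ => (min_le_right _ _).trans ?_⟩
      push Not at hact
      linarith [h2.1]
    have hiL : f (x i0) ∈ L1 := ⟨hfX _ (hxc i0 hi0.le), hfb _ (hx i0 hi0.le), hact⟩
    have hB0 := hB i0 hi0
    have hBa := hB0.2.2.2.2 hact
    have hn : ‖((1:ℝ):ℂ) * (uB i0 * (h i0 z * P z))‖ = ‖h i0 z * P z‖ := by
      rw [norm_mul, norm_mul (uB i0), hB0.2.2.1]; simp
    have hn2 := (hh1 i0 hi0).2.2.2.1 z hz
    have hfi := hfd z hz (x i0) (hxc i0 hi0.le) hzi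
    have ray : ∀ T ≤ M, ‖f (x T) - f (x i0)‖ ≤ r2 / 4 → ∀ e' : ℂ, ‖e'‖ = 1 → ‖z - x T‖ < t →
        (∀ r ∈ Icc (0:ℝ) 1, ρ (x' T) ≤ ρ (x' T + pd (vB i0) (wB i0) (uB i0 * (e' * r)))) →
        (∃ r ∈ Icc (0:ℝ) 1, ‖h i0 z * P z - e' * r‖ ≤ ε1) →
        ρ (f z) - ε ≤ ρ (H (1, z)) ∧ (min (ρ (f z) + δ) C ≤ ρ (H (1, z))) := by
      rintro T hT hTi e' he' hzT hray ⟨r, hr, hhr⟩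
      have hTT : T = T0 := by
        by_contra hne
        exact absurd ((hzT.trans_le (min_le_right _ _)).trans_le (hfar T hT hne)) (lt_irrefl _)
      subst hTT
      have hA0 := hA T hT
      have hre : ‖uB i0 * (e' * (r:ℂ))‖ ≤ 1 := by
        rw [norm_mul, norm_mul, hB0.2.2.1, he', Complex.norm_real, Real.norm_of_nonneg hr.1]
        linarith [hr.2]
      have hnA : ‖((1:ℝ):ℂ) * (eA T * (b T z * P z))‖ ≤ 2 := by
        rw [norm_mul, norm_mul (eA T), hA0.2.2.1]; simpa using hb2.1
      have hf8 := hftf z hz (x T) (hxc T hT) ((hzT.le.trans (min_le_right _ _)).trans hdAt)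
      have hb1 := hb2.2.2.2 ((hzT.le.trans (min_le_left _ _)).trans
        (htm2 T (Finset.mem_range.2 (Nat.lt_succ_of_le hT))))
      have h1 : ‖pA T 1 z - pd (vA T) (wA T) (eA T)‖ ≤ 5 * ra * εA := by
        refine (pd_lip hA0.1 hA0.2.1 hnA (by rw [hA0.2.2.1]; norm_num)).trans ?_
        have : ((1:ℝ):ℂ) * (eA T * (b T z * P z)) - eA T = eA T * (b T z * P z - 1) := by
          push_cast; ring
        rw [this, norm_mul, hA0.2.2.1, one_mul]
        gcongr
      have h2 : ‖pB i0 1 z - pd (vB i0) (wB i0) (uB i0 * (e' * r))‖ ≤ 5 * rb * ε1 := by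
        refine (pd_lip hB0.1 hB0.2.1 (hn.le.trans hn2) (by linarith)).trans ?_
        have : ((1:ℝ):ℂ) * (uB i0 * (h i0 z * P z)) - uB i0 * (e' * r) = uB i0 * (h i0 z * P z - e' * r) := by
          push_cast; ring
        rw [this, norm_mul, hB0.2.2.1, one_mul]
        gcongr
      have h3 : x' T + pd (vB i0) (wB i0) (uB i0 * (e' * r)) ∈ W := by
        refine (hLW (f (x i0)) hiL _ ?_).1
        have e : x' T + pd (vB i0) (wB i0) (uB i0 * (e' * r)) - f (x i0) = (x' T - f (x T)) +
          (f (x T) - f (x i0)) + pd (vB i0) (wB i0) (uB i0 * (e' * r)) := by abel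
        rw [e]
        refine (norm_add_le _ _).trans ?_
        have i1 := norm_add_le (x' T - f (x T)) (f (x T) - f (x i0))
        have i2 := hx'n T hT
        have i3 := pd_le (ζ := uB i0 * (e' * (r:ℂ))) hB0.1 hB0.2.1 (by linarith)
        have i4 : 5 * rb * ‖uB i0 * (e' * (r:ℂ))‖ ≤ 5 * rb * 1 := by gcongr
        linarith
      have h4 := fin _ h3 (by
        have e : H (1, z) - (x' T + pd (vB i0) (wB i0) (uB i0 * (e' * r))) =
          (f z - f (x T)) + (pA T 1 z - pd (vA T) (wA T) (eA T)) +
          (∑ T ∈ Finset.range (M + 1), pA T 1 z - pA T 1 z) +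
          (pB i0 1 z - pd (vB i0) (wB i0) (uB i0 * (e' * r))) +
          (∑ i ∈ Finset.range M, pB i 1 z - pB i0 1 z) := by simp only [hH, hx']; abel
        rw [e]
        refine (norm_add_le _ _).trans ?_
        refine (add_le_add_left (norm_add_le _ _) _).trans ?_
        refine (add_le_add_left (add_le_add_left (norm_add_le _ _) _) _).trans ?_
        refine (add_le_add_left (add_le_add_left (add_le_add_left (norm_add_le _ _) _) _) _).trans ?_
        linarith)
      have h5 := hray r hr
      have h6 := abs_le.1 (hmodW (f z) (hfW z hz) (f (x T)) (by rw [norm_sub_rev]; linarith)).2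
      by_cases hTa : ρ (f (x T)) ≤ C + 1
      · have h7 : ρ (f (x T)) + σA ≤ ρ (x' T) := hA0.2.2.2.1 hTa
        refine ⟨by linarith [h6.1], (min_le_left _ _).trans (by linarith [h6.1])⟩
      · obtain ⟨j1, j2⟩ := hA0.2.2.2.2.2 (not_le.1 hTa)
        have h7 : x' T = f (x T) := by simp only [hx', j1, j2, pd00, add_zero]
        rw [h7] at h5
        push Not at hTa
        rw [h7] at h4
        refine ⟨by linarith [h6.1], (min_le_right _ _).trans (by linarith)⟩
    rcases hcase with hF | ⟨hzt, hr⟩ | ⟨hzt, hr⟩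
    · have i1 := norm_add_le (f z - f (x i0)) (pA T0 1 z)
      have e1 : f z - f (x i0) + pA T0 1 z = f z + pA T0 1 z - f (x i0) := by abel
      rw [e1] at i1
      have h1 := hBa.1 (f z + pA T0 1 z) (by linarith [hfi.1]) _ (by rw [hn]; exact hF) (hn.le.trans hn2)
      have h2 : f z + pA T0 1 z + pB i0 1 z ∈ W := by
        refine (hLW (f (x i0)) hiL _ ?_).1
        have i2 := norm_add_le (f z + pA T0 1 z - f (x i0)) (pB i0 1 z)
        rw [show f z + pA T0 1 z - f (x i0) + pB i0 1 z = f z + pA T0 1 z + pB i0 1 z - f (x i0) by abel] at i2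
        have i3 := pBle i0 hi0 1 one1 z hz
        have i4 : 5 * rb * ‖h i0 z * P z‖ ≤ 5 * rb * 2 := by gcongr
        linarith [hfi.2.1]
      have h3 := fin _ h2 (by
        have e : H (1, z) - (f z + pA T0 1 z + pB i0 1 z) =
          (∑ T ∈ Finset.range (M + 1), pA T 1 z - pA T0 1 z) +
          (∑ i ∈ Finset.range M, pB i 1 z - pB i0 1 z) := by simp only [hH]; abel
        rw [e]
        refine (norm_add_le _ _).trans ?_
        linarith)
      have h4 := abs_le.1 (hmodW w0 hw0 (f z + pA T0 1 z) (by linarith)).2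
      have h1' : ρ (f z + pA T0 1 z) + σB ≤ ρ (f z + pA T0 1 z + pB i0 1 z) := h1
      refine ⟨by linarith [h4.1], fun _ => (min_le_left _ _).trans (by linarith [h4.1])⟩
    · have := ray i0 hi0.le (by simp; positivity) (e1 i0) (hh1 i0 hi0).2.1 hzt hBa.2.1 hr
      exact ⟨this.1, fun _ => this.2⟩
    · have := ray (i0 + 1) hi0 (hxx i0 hi0).2 (e2 i0) (hh1 i0 hi0).2.2.1 hzt hBa.2.2 hr
      exact ⟨this.1, fun _ => this.2⟩
  have hsnd : ∀ φ : ℂ → ℂ, ContinuousOn φ (closure D) →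
      ContinuousOn (fun p : ℝ × ℂ => φ p.2) (Icc (0:ℝ) 1 ×ˢ closure D) := fun φ hφ =>
    hφ.comp continuousOn_snd (fun p hp => hp.2)
  have hbc : ∀ T ≤ M, ContinuousOn (b T) (closure D) := fun T hT z hz =>
    ((hb T hT).1 z hz).continuousAt.continuousWithinAt
  have hhc : ∀ i < M, ContinuousOn (h i) (closure D) := fun i hi z hz =>
    ((hh1 i hi).1 z hz).continuousAt.continuousWithinAt
  have hPc : ContinuousOn P (closure D) := hP.continuous.continuousOn
  have hfst : ContinuousOn (fun p : ℝ × ℂ => ((p.1 : ℝ) : ℂ)) (Icc (0:ℝ) 1 ×ˢ closure D) :=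
    (Complex.continuous_ofReal.comp continuous_fst).continuousOn
  refine ⟨H, ⟨?_, fun s hs z hz => (Hint s hs z hz).1, ?_, ?_, ?_, fun z hz => (Hint 1 one1 z hz).2,
    fun z hz => (Hbd z hz).1⟩, fun z hz => (Hbd z hz).2⟩
  · refine ContinuousOn.add (hf.comp continuousOn_snd (fun p hp => hp.2)) (ContinuousOn.add ?_ ?_)
    · refine continuousOn_finset_sum _ (fun T hT => ?_)
      have hT' : T ≤ M := by have := Finset.mem_range.1 hT; omega
      exact pd_cont _ _ (hfst.mul (continuousOn_const.mul
        ((hsnd _ (hbc T hT')).mul (hsnd _ hPc))))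
    · refine continuousOn_finset_sum _ (fun i hi => ?_)
      exact pd_cont _ _ (hfst.mul (continuousOn_const.mul
        ((hsnd _ (hhc i (Finset.mem_range.1 hi))).mul (hsnd _ hPc))))
  · intro z
    simp [hH, hpA, hpB, pd_zero]
  · intro s hs z hz
    have := Z3 s hs z (subset_closure (hKD hz)) (fun T hT _ =>
      (min_le_right _ _).trans (hdK2 z hz (x T) (hx T hT)))
    simp only [hH, add_sub_cancel_left]
    linarith
  · refine ⟨fun z => (∑ T ∈ Finset.range (M + 1), ((eA T * b T z) • vA T + ((eA T * b T z) ^ 2 * P z) • wA T)) +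
      ∑ i ∈ Finset.range M, ((uB i * h i z) • vB i + ((uB i * h i z) ^ 2 * P z) • wB i), ?_, ?_⟩
    · refine DifferentiableOn.add ?_ ?_
      · refine DifferentiableOn.fun_sum (fun T hT => ?_)
        have hT' : T ≤ M := by have := Finset.mem_range.1 hT; omega
        have hd1 : DifferentiableOn ℂ (b T) D := fun z hz =>
          ((hb T hT').1 z (subset_closure hz)).differentiableWithinAt
        have hd2 := hd1.const_mul (eA T)
        exact (hd2.smul_const _).add (((hd2.pow 2).mul hP.differentiableOn).smul_const _)
      · refine DifferentiableOn.fun_sum (fun i hi => ?_)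
        have hd1 : DifferentiableOn ℂ (h i) D := fun z hz =>
          ((hh1 i (Finset.mem_range.1 hi)).1 z (subset_closure hz)).differentiableWithinAt
        have hd2 := hd1.const_mul (uB i)
        exact (hd2.smul_const _).add (((hd2.pow 2).mul hP.differentiableOn).smul_const _)
    · intro z hz
      simp only [hH, hpA, hpB]
      rw [smul_add, Finset.smul_sum, Finset.smul_sum]
      congr 1
      congr 1
      · refine Finset.sum_congr rfl (fun T _ => ?_)
        rw [Complex.ofReal_one, one_mul, pd_fac]
      · refine Finset.sum_congr rfl (fun i _ => ?_)
        rw [Complex.ofReal_one, one_mul, pd_fac]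


/-- Maps continuous on the closure, holomorphic inside, with values in `X`. -/
def Adm {N : ℕ} (X : Set (Cn N)) (D : Set ℂ) (f : ℂ → Cn N) : Prop :=
  ContinuousOn f (closure D) ∧ DifferentiableOn ℂ f D ∧ ∀ z ∈ closure D, f z ∈ X

/-- `f'` is obtained from `f` by a homotopy, `ε`-small over `K`, with `f' - f` divisible by `P`. -/
def Lk {N : ℕ} (X : Set (Cn N)) (D : Set ℂ) (P : ℂ → ℂ) (f f' : ℂ → Cn N) (K : Set ℂ) (ε : ℝ) : Prop :=
  (∃ H : ℝ × ℂ → Cn N, ContinuousOn H (Icc (0:ℝ) 1 ×ˢ closure D) ∧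
    (∀ s ∈ Icc (0:ℝ) 1, ∀ z ∈ closure D, H (s, z) ∈ X) ∧
    (∀ z ∈ closure D, H (0, z) = f z) ∧ (∀ z ∈ closure D, H (1, z) = f' z) ∧
    (∀ s ∈ Icc (0:ℝ) 1, ∀ z ∈ K, ‖H (s, z) - f z‖ ≤ ε)) ∧
  ∃ G : ℂ → Cn N, DifferentiableOn ℂ G D ∧ ∀ z ∈ D, f' z = f z + P z • G z

section
variable {N : ℕ} {X : Set (Cn N)} {D : Set ℂ} {P : ℂ → ℂ} {f f' f'' : ℂ → Cn N} {K : Set ℂ} {ε ε2 : ℝ}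

lemma Lk.refl (hf : Adm X D f) (hε : 0 ≤ ε) : Lk X D P f f K ε := by
  refine ⟨⟨fun p => f p.2, hf.1.comp continuousOn_snd (fun p hp => hp.2), fun s _ z hz => hf.2.2 z hz,
    fun _ _ => rfl, fun _ _ => rfl, fun s _ z _ => by simpa using hε⟩, fun _ => 0, differentiableOn_const _, ?_⟩
  intro z _; simp

lemma Lk.mono {K' : Set ℂ} {ε' : ℝ} (h : Lk X D P f f' K ε) (hK : K' ⊆ K) (hε : ε ≤ ε') :
    Lk X D P f f' K' ε' := by
  obtain ⟨⟨H, h1, h2, h3, h4, h5⟩, h6⟩ := h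
  exact ⟨⟨H, h1, h2, h3, h4, fun s hs z hz => (h5 s hs z (hK hz)).trans hε⟩, h6⟩

lemma Lk.cont (h : Lk X D P f f' K ε) : ContinuousOn f' (closure D) := by
  obtain ⟨⟨H, h1, h2, h3, h4, h5⟩, h6⟩ := h
  have : ContinuousOn (fun z => H (1, z)) (closure D) :=
    h1.comp (by fun_prop) (fun z hz => ⟨⟨zero_le_one, le_rfl⟩, hz⟩)
  exact this.congr (fun z hz => (h4 z hz).symm)

lemma Lk.adm (h : Lk X D P f f' K ε) (hf : Adm X D f) (hP : Differentiable ℂ P) : Adm X D f' := by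
  refine ⟨h.cont, ?_, ?_⟩
  · obtain ⟨-, G, hG, h6⟩ := h
    exact (hf.2.1.add (hP.differentiableOn.smul hG)).congr h6
  · obtain ⟨⟨H, h1, h2, h3, h4, h5⟩, h6⟩ := h
    intro z hz
    rw [← h4 z hz]; exact h2 1 ⟨zero_le_one, le_rfl⟩ z hz

lemma Lk.close (h : Lk X D P f f' K ε) (hK : K ⊆ closure D) : ∀ z ∈ K, ‖f' z - f z‖ ≤ ε := by
  obtain ⟨⟨H, h1, h2, h3, h4, h5⟩, h6⟩ := h
  intro z hz
  rw [← h4 z (hK hz)]; exact h5 1 ⟨zero_le_one, le_rfl⟩ z hz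

lemma Lk.trans (h : Lk X D P f f' K ε) (h' : Lk X D P f' f'' K ε2) (hKD : K ⊆ closure D) :
    Lk X D P f f'' K (ε + ε2) := by
  have hc := h.cont
  have hcl := h.close hKD
  have h0 : 0 ≤ ε2 ∨ K = ∅ := by
    rcases K.eq_empty_or_nonempty with e | ⟨z, hz⟩
    · exact Or.inr e
    · obtain ⟨⟨H', g1, g2, g3, g4, g5⟩, G', hG', hGe'⟩ := h'
      exact Or.inl ((norm_nonneg _).trans (g5 0 ⟨le_rfl, zero_le_one⟩ z hz))
  obtain ⟨⟨H, h1, h2, h3, h4, h5⟩, G, hG, hGe⟩ := h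
  obtain ⟨⟨H', g1, g2, g3, g4, g5⟩, G', hG', hGe'⟩ := h'
  have m1 : ∀ s ∈ Icc (0:ℝ) 1, min (2 * s) 1 ∈ Icc (0:ℝ) 1 := fun s hs =>
    ⟨le_min (by linarith [hs.1]) zero_le_one, min_le_right _ _⟩
  have m2 : ∀ s ∈ Icc (0:ℝ) 1, max (2 * s - 1) 0 ∈ Icc (0:ℝ) 1 := fun s hs =>
    ⟨le_max_right _ _, max_le (by linarith [hs.2]) zero_le_one⟩
  have key : ∀ s ∈ Icc (0:ℝ) 1, ∀ z ∈ closure D,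
      (H (min (2 * s) 1, z) + H' (max (2 * s - 1) 0, z) - f' z = H (min (2 * s) 1, z)) ∨
      (H (min (2 * s) 1, z) + H' (max (2 * s - 1) 0, z) - f' z = H' (max (2 * s - 1) 0, z)) := by
    intro s hs z hz
    rcases le_total (2 * s) 1 with h | h
    · left
      rw [max_eq_right (by linarith), g3 z hz]; abel
    · right
      rw [min_eq_right h, h4 z hz]; abel
  refine ⟨⟨fun p => H (min (2 * p.1) 1, p.2) + H' (max (2 * p.1 - 1) 0, p.2) - f' p.2, ?_, ?_, ?_, ?_, ?_⟩,
    fun z => G z + G' z, hG.add hG', ?_⟩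
  · refine ContinuousOn.sub (ContinuousOn.add ?_ ?_) (hc.comp continuousOn_snd (fun p hp => hp.2))
    · exact h1.comp (by fun_prop) (fun p hp => ⟨m1 _ hp.1, hp.2⟩)
    · exact g1.comp (by fun_prop) (fun p hp => ⟨m2 _ hp.1, hp.2⟩)
  · intro s hs z hz
    rcases key s hs z hz with e | e
    · beta_reduce; dsimp only; rw [e]; exact h2 _ (m1 s hs) z hz
    · beta_reduce; dsimp only; rw [e]; exact g2 _ (m2 s hs) z hz
  · intro z hz
    have := g3 z hz
    have := h3 z hz
    norm_num [*]
  · intro z hz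
    have := g4 z hz
    have := h4 z hz
    norm_num [*]
  · intro s hs z hz
    have h0 : 0 ≤ ε2 := h0.resolve_right (by rintro rfl; exact hz)
    rcases key s hs z (hKD hz) with e | e
    · dsimp only; rw [e]; linarith [h5 _ (m1 s hs) z hz]
    · dsimp only; rw [e]
      have := norm_add_le (H' (max (2 * s - 1) 0, z) - f' z) (f' z - f z)
      rw [sub_add_sub_cancel] at this
      linarith [g5 _ (m2 s hs) z hz, hcl z hz]
  · intro z hz
    rw [hGe' z hz, hGe z hz, smul_add]; abel

/-- Control of the exhaustion function away from `K` and on the boundary. -/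
def InvR {N : ℕ} (ρ : Cn N → ℝ) (D K : Set ℂ) (m a : ℝ) (f : ℂ → Cn N) : Prop :=
  (∀ z ∈ closure D \ K, m - 1 - a ≤ ρ (f z)) ∧ ∀ z ∈ frontier D, m - a ≤ ρ (f z)

lemma step1 {ρ : Cn N → ℝ} (hX : IsOpen X) (hρc : ContinuousOn ρ X) (hDo : IsOpen D)
    (hDb : Bornology.IsBounded D) (hf : Adm X D f)
    {q : ℂ} {β δ C : ℝ}
    (hbox : ∀ K ⊆ D, IsCompact K → ∀ ε > 0, ∃ H, BoxLift X ρ D P f K ε H ∧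
        (∀ z ∈ frontier D, ‖z - q‖ < β → min (ρ (f z) + δ) C ≤ ρ (H (1, z))))
    (hKD : K ⊆ D) (hK : IsCompact K) {m a τ : ℝ} (hτ : 0 < τ) (hinv : InvR ρ D K m a f) :
    ∃ f', Lk X D P f f' K τ ∧ InvR ρ D K m (a + 2 * τ) f' ∧ (∀ z ∈ frontier D, ρ (f z) - τ ≤ ρ (f' z)) ∧
      ∀ z ∈ frontier D, ‖z - q‖ < β → min (ρ (f z) + δ) C ≤ ρ (f' z) := by
  have hcD : IsCompact (closure D) := hDb.isCompact_closure
  have hρf : ContinuousOn (fun z => ρ (f z)) (closure D) := hρc.comp hf.1 hf.2.2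
  set S : Set ℂ := closure D ∩ (fun z => ρ (f z)) ⁻¹' (Iic (m - a - τ)) with hS
  have hSc : IsCompact S := by
    refine hcD.of_isClosed_subset ?_ inter_subset_left
    exact hρf.preimage_isClosed_of_isClosed isClosed_closure isClosed_Iic
  have hSD : S ⊆ D := by
    intro z hz
    by_contra hc
    have : z ∈ frontier D := by rw [hDo.frontier_eq]; exact ⟨hz.1, hc⟩
    have h1 := hinv.2 z this
    have h2 : ρ (f z) ≤ m - a - τ := hz.2
    linarith
  have hK1 : IsCompact (K ∪ S) := hK.union hSc
  have hK1D : K ∪ S ⊆ D := union_subset hKD hSD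
  have hK1c : K ∪ S ⊆ closure D := hK1D.trans subset_closure
  obtain ⟨η, hη, hmod⟩ := modul hX hρc (hK1.image_of_continuousOn (hf.1.mono hK1c)) (by
    rintro _ ⟨z, hz, rfl⟩; exact hf.2.2 z (hK1c hz)) hτ
  obtain ⟨H, ⟨h1, h2, h3, h4, h5, h6, h7⟩, h8⟩ := hbox (K ∪ S) hK1D hK1 (min η τ) (by positivity)
  refine ⟨fun z => H (1, z), ⟨⟨H, h1, h2, fun z _ => h3 z, fun _ _ => rfl, ?_⟩, h5⟩, ⟨?_, ?_⟩, ?_, h8⟩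
  · intro s hs z hz
    exact (h4 s hs z (Or.inl hz)).trans (min_le_right _ _)
  · rintro z ⟨hz, hzK⟩
    by_cases hzS : z ∈ S
    · have := abs_le.1 (hmod (f z) ⟨z, Or.inr hzS, rfl⟩ (H (1, z))
        ((h4 1 ⟨zero_le_one, le_rfl⟩ z (Or.inr hzS)).trans (min_le_left _ _))).2
      have h := hinv.1 z ⟨hz, hzK⟩
      dsimp only
      linarith [this.1]
    · have h : m - a - τ < ρ (f z) := by
        by_contra hc
        exact hzS ⟨hz, not_lt.1 hc⟩
      have := h6 z hz
      dsimp only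
      linarith
  · intro z hz
    have := h7 z hz
    have := hinv.2 z hz
    have := min_le_right η τ
    dsimp only
    linarith
  · intro z hz
    have := h7 z hz
    have := min_le_right η τ
    dsimp only
    linarith

end

section
variable {N : ℕ} {X : Set (Cn N)} {D : Set ℂ} {P : ℂ → ℂ} {K : Set ℂ}

lemma round1 {ρ : Cn N → ℝ} (hX : IsOpen X) (hρc : ContinuousOn ρ X) (hDo : IsOpen D)
    (hDb : Bornology.IsBounded D) (hP : Differentiable ℂ P) {β : ℂ → ℝ} {δ C c' : ℝ}
    (hKD : K ⊆ D) (hK : IsCompact K) {m τ : ℝ} (hτ : 0 < τ)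
    (L : List ℂ)
    (hbox : ∀ q ∈ L, ∀ f : ℂ → Cn N, Adm X D f → (∀ z ∈ frontier D, c' ≤ ρ (f z)) →
      ∀ K ⊆ D, IsCompact K → ∀ ε > 0, ∃ H, BoxLift X ρ D P f K ε H ∧
        (∀ z ∈ frontier D, ‖z - q‖ < β q → min (ρ (f z) + δ) C ≤ ρ (H (1, z)))) :
    ∀ (f : ℂ → Cn N) (a : ℝ), Adm X D f → InvR ρ D K m a f →
      (∀ z ∈ frontier D, c' + L.length * τ ≤ ρ (f z)) →
      ∃ f', Lk X D P f f' K (L.length * τ) ∧ InvR ρ D K m (a + L.length * (2 * τ)) f' ∧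
        (∀ z ∈ frontier D, ρ (f z) - L.length * τ ≤ ρ (f' z)) ∧
        ∀ z ∈ frontier D, (∃ q ∈ L, ‖z - q‖ < β q) → min (ρ (f z) + δ) C - L.length * τ ≤ ρ (f' z) := by
  induction L with
  | nil =>
    intro f a hf hinv hb
    exact ⟨f, Lk.refl hf (by simp), by simpa using hinv, by simp, by simp⟩
  | cons q L ih =>
    intro f a hf hinv hb
    have hl : ((q :: L).length : ℝ) = L.length + 1 := by simp
    rw [hl] at hb ⊢
    have hL0 : (0:ℝ) ≤ L.length * τ := by positivity
    obtain ⟨f1, k1, k2, k3, k4⟩ := step1 hX hρc hDo hDb hf (hbox q (by simp) f hf (fun z hz => by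
      have := hb z hz; linarith)) hKD hK hτ hinv
    obtain ⟨f2, j1, j2, j3, j4⟩ := ih (fun q' hq' => hbox q' (by simp [hq'])) f1 (a + 2 * τ) (k1.adm hf hP) k2
      (fun z hz => by have := hb z hz; have := k3 z hz; linarith)
    refine ⟨f2, (k1.trans j1 (hKD.trans subset_closure)).mono Subset.rfl (by linarith), ?_, ?_, ?_⟩
    · convert j2 using 1; ring
    · intro z hz
      have := k3 z hz
      have := j3 z hz
      linarith
    · rintro z hz ⟨q', hq', hlt⟩
      rcases List.mem_cons.1 hq' with rfl | hq'
      · have := k4 z hz hlt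
        have := j3 z hz
        linarith
      · have h1 := j4 z hz ⟨q', hq', hlt⟩
        have h2 := k3 z hz
        have h3 : min (ρ (f z) + δ) C - τ ≤ min (ρ (f1 z) + δ) C := by
          apply le_min
          · linarith [min_le_left (ρ (f z) + δ) C]
          · linarith [min_le_right (ρ (f z) + δ) C]
        linarith

lemma lift {ρ : Cn N → ℝ} (hX : IsOpen X)
    (hρ : ContDiffOn ℝ (⊤ : ℕ∞) ρ X) (hexh : ∀ c : ℝ, IsCompact {x ∈ X | ρ x ≤ c})
    {c : ℝ} (hLevi : ∀ x ∈ X, c < ρ x → TwoPosEigen ρ x)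
    (hDo : IsOpen D) (hDb : Bornology.IsBounded D) (hSB : SmoothlyBounded D)
    (hP : Differentiable ℂ P) (hP0 : ∀ z ∈ frontier D, P z ≠ 0)
    {f : ℂ → Cn N} (hf : Adm X D f) (hfb : ∀ z ∈ frontier D, c < ρ (f z))
    (hKD : K ⊆ D) (hK : IsCompact K) {m : ℝ} (hm : ∀ z ∈ closure D \ K, m ≤ ρ (f z))
    {ε : ℝ} (hε : 0 < ε) (B : ℝ) :
    ∃ f', Lk X D P f f' K ε ∧ (∀ z ∈ frontier D, B ≤ ρ (f' z)) ∧
      ∀ z ∈ closure D \ K, m - 2 ≤ ρ (f' z) := by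
  have hρc : ContinuousOn ρ X := hρ.continuousOn
  have hfc : frontier D ⊆ closure D := frontier_subset_closure
  have hcD : IsCompact (closure D) := hDb.isCompact_closure
  have hFc : IsCompact (frontier D) := hcD.of_isClosed_subset isClosed_frontier hfc
  obtain ⟨c0, hc0, hfc0⟩ : ∃ c0 > c, ∀ z ∈ frontier D, c0 ≤ ρ (f z) := by
    rcases (frontier D).eq_empty_or_nonempty with he | hne
    · exact ⟨c + 1, by linarith, by simp [he]⟩
    · obtain ⟨z0, hz0, hmin⟩ := hFc.exists_isMinOn hne (hρc.comp (hf.1.mono hfc) (fun z hz => hf.2.2 z (hfc hz)))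
      exact ⟨ρ (f z0), hfb z0 hz0, fun z hz => hmin hz⟩
  set c' := (c + c0) / 2 with hc'
  set C := max B c0 + 1 with hC
  obtain ⟨δ, hδ, hbox⟩ := boxlift hX hρ hexh hLevi hDo hDb hSB hP hP0 (c' := c') (C := C) (by linarith)
  have hbox' : ∀ q : ℂ, ∃ β > 0, q ∈ frontier D → ∀ f : ℂ → Cn N, ContinuousOn f (closure D) →
      (∀ z ∈ closure D, f z ∈ X) → (∀ z ∈ frontier D, c' ≤ ρ (f z)) →
      ∀ K ⊆ D, IsCompact K → ∀ ε > 0, ∃ H, BoxLift X ρ D P f K ε H ∧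
        (∀ z ∈ frontier D, ‖z - q‖ < β → min (ρ (f z) + δ) C ≤ ρ (H (1, z))) := fun q => by
    by_cases hq : q ∈ frontier D
    · obtain ⟨β, hβ, h⟩ := hbox q hq
      exact ⟨β, hβ, fun _ => h⟩
    · exact ⟨1, one_pos, fun h => absurd h hq⟩
  choose β hβ hbox' using hbox'
  obtain ⟨Q, hQ, hcov⟩ := hFc.elim_nhds_subcover (fun q => ball q (β q)) (fun q _ => ball_mem_nhds q (hβ q))
  set L := Q.toList with hL
  obtain ⟨n, hn⟩ := exists_nat_gt ((C - c0) / (δ / 2))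
  have hn' : C - c0 ≤ n * (δ / 2) := ((div_lt_iff₀ (by positivity)).1 hn).le
  -- choose the loss
  set e0 := min (min (δ / 2) ((c0 - c) / 2)) (min 1 ε) / (2 * (n + 1)) with he0
  have hcc : 0 < (c0 - c) / 2 := by linarith
  have he00 : 0 < e0 := by positivity
  set τ := e0 / (L.length + 1) with hτ
  have hτ0 : 0 < τ := by positivity
  have hLt0 : 0 ≤ L.length * τ := by positivity
  have hLτ : L.length * τ ≤ e0 := by
    have : (L.length + 1) * τ = e0 := by rw [hτ]; field_simp
    linarith
  have hne : (n + 1) * (2 * e0) = min (min (δ / 2) ((c0 - c) / 2)) (min 1 ε) := by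
    rw [he0]; field_simp
  have hnn : (0:ℝ) ≤ n * e0 := by positivity
  have q1 : e0 ≤ δ / 2 := by
    have := (min_le_left _ _ : min (min (δ / 2) ((c0 - c) / 2)) (min 1 ε) ≤ _).trans (min_le_left _ _)
    linarith
  have q2 : e0 ≤ (c0 - c) / 2 := by
    have := (min_le_left _ _ : min (min (δ / 2) ((c0 - c) / 2)) (min 1 ε) ≤ _).trans (min_le_right _ _)
    linarith
  have q3 : n * (2 * e0) ≤ 1 := by
    have := (min_le_right _ _ : min (min (δ / 2) ((c0 - c) / 2)) (min 1 ε) ≤ _).trans (min_le_left _ _)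
    linarith
  have q3' : e0 ≤ 1 := by
    have := (min_le_right _ _ : min (min (δ / 2) ((c0 - c) / 2)) (min 1 ε) ≤ _).trans (min_le_left _ _)
    linarith
  have q4 : n * e0 ≤ ε := by
    have := (min_le_right _ _ : min (min (δ / 2) ((c0 - c) / 2)) (min 1 ε) ≤ _).trans (min_le_right _ _)
    linarith
  have rounds : ∀ j : ℕ, ∃ f', Lk X D P f f' K (j * e0) ∧ InvR ρ D K m (j * (2 * e0)) f' ∧
      ∀ z ∈ frontier D, min (c0 + j * (δ / 2)) (C - 1) ≤ ρ (f' z) := by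
    intro j
    induction j with
    | zero =>
      refine ⟨f, Lk.refl hf (by simp), ⟨fun z hz => ?_, fun z hz => ?_⟩, fun z hz => ?_⟩
      · have := hm z hz
        simp; linarith
      · have hzK : z ∉ K := fun h => (hDo.frontier_eq ▸ hz).2 (hKD h)
        have := hm z ⟨hfc hz, hzK⟩
        simpa using this
      · refine (min_le_left _ _).trans ?_
        simpa using hfc0 z hz
    | succ j ih =>
      obtain ⟨f1, k1, k2, k3⟩ := ih
      have hf1 := k1.adm hf hP
      have hC1 : c0 ≤ C - 1 := by rw [hC]; simp
      have hc1 : ∀ z ∈ frontier D, c0 ≤ ρ (f1 z) := fun z hz =>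
        (le_min (by have : 0 ≤ j * (δ / 2) := by positivity
                    linarith) hC1).trans (k3 z hz)
      obtain ⟨f2, i1, i2, i3, i4⟩ := round1 (β := β) (δ := δ) (C := C) (c' := c') hX hρc hDo hDb hP hKD hK hτ0 L
        (fun q hq g hg hgb => hbox' q (hQ q (by simpa [hL] using hq)) g hg.1 hg.2.2 hgb) f1 (j * (2 * e0)) hf1 k2
        (fun z hz => by have := hc1 z hz; linarith)
      refine ⟨f2, (k1.trans i1 (hKD.trans subset_closure)).mono Subset.rfl (by push_cast; linarith), ?_, ?_⟩
      · refine ⟨fun z hz => ?_, fun z hz => ?_⟩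
        · have := i2.1 z hz
          push_cast; linarith
        · have := i2.2 z hz
          push_cast; linarith
      · intro z hz
        obtain ⟨q, hq, hzq⟩ := mem_iUnion₂.1 (hcov hz)
        rw [mem_ball, dist_eq_norm] at hzq
        have h1 := i4 z hz ⟨q, by simpa [hL] using hq, hzq⟩
        have h2 := k3 z hz
        refine le_trans ?_ h1
        rw [le_sub_iff_add_le]
        apply le_min
        · have h3 : min (c0 + ((j + 1 : ℕ) : ℝ) * (δ / 2)) (C - 1) ≤ min (c0 + j * (δ / 2)) (C - 1) + δ / 2 := by
            rw [← min_add_add_right]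
            apply min_le_min
            · push_cast; linarith
            · linarith
          linarith
        · have := min_le_right (c0 + ((j + 1 : ℕ) : ℝ) * (δ / 2)) (C - 1)
          linarith
  obtain ⟨f', k1, k2, k3⟩ := rounds n
  refine ⟨f', k1.mono Subset.rfl q4, fun z hz => ?_, fun z hz => ?_⟩
  · refine le_trans ?_ (k3 z hz)
    have : B ≤ C - 1 := by rw [hC]; simp
    exact le_min (by linarith) this
  · have := k2.1 z hz
    linarith
end


lemma exhaust {D : Set ℂ} (hDo : IsOpen D) (hDb : Bornology.IsBounded D) :
    ∃ E : ℕ → Set ℂ, (∀ n, IsCompact (E n)) ∧ (∀ n, E n ⊆ D) ∧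
      ∀ K ⊆ D, IsCompact K → ∃ n0, ∀ n ≥ n0, K ⊆ E n := by
  have hne : (Dᶜ : Set ℂ).Nonempty := by
    by_contra h
    rw [not_nonempty_iff_eq_empty, compl_empty_iff] at h
    rw [h] at hDb
    exact NormedSpace.unbounded_univ ℝ ℂ hDb
  have hcD : IsCompact (closure D) := hDb.isCompact_closure
  refine ⟨fun n => closure D ∩ {z | 1 / ((n:ℝ) + 1) ≤ infDist z Dᶜ}, fun n => ?_, fun n => ?_, ?_⟩
  · exact hcD.inter_right (isClosed_le continuous_const (continuous_infDist_pt _))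
  · rintro z ⟨-, hz⟩
    by_contra hc
    have h0 : infDist z Dᶜ = 0 := infDist_zero_of_mem hc
    have hz' : 1 / ((n:ℝ) + 1) ≤ infDist z Dᶜ := hz
    have : 0 < 1 / ((n:ℝ) + 1) := by positivity
    linarith
  · intro K hKD hK
    obtain ⟨r, hr, hrD⟩ := hK.exists_cthickening_subset_open hDo hKD
    obtain ⟨n0, hn0⟩ := exists_nat_one_div_lt hr
    refine ⟨n0, fun n hn z hz => ⟨subset_closure (hKD hz), ?_⟩⟩
    have h1 : 1 / ((n:ℝ) + 1) ≤ 1 / ((n0:ℝ) + 1) := by gcongr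
    refine (h1.trans hn0.le).trans ?_
    rw [le_infDist hne]
    intro y hy
    by_contra hc
    push Not at hc
    exact hy (hrD (mem_cthickening_of_dist_le y z r K hz (by rw [dist_comm]; exact hc.le)))

lemma dep_seq {α : Type*} {good : ℕ → α → Prop} {rel : ℕ → α → α → Prop} {a : α} (h0 : good 0 a)
    (hs : ∀ n s, good n s → ∃ s', good (n + 1) s' ∧ rel n s s') :
    ∃ u : ℕ → α, u 0 = a ∧ (∀ n, good n (u n)) ∧ ∀ n, rel n (u n) (u (n + 1)) := by
  classical
  choose! nx h1 h2 using hs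
  let u : ℕ → α := fun n => Nat.rec a (fun n s => nx n s) n
  have hu : ∀ n, good n (u n) := by
    intro n
    induction n with
    | zero => exact h0
    | succ n ih => exact h1 n _ ih
  exact ⟨u, rfl, hu, fun n => h2 n _ (hu n)⟩

lemma lim_geo {α E : Type*} [NormedAddCommGroup E] [CompleteSpace E] {u : ℕ → α → E} {A : ℕ → Set α} {e : ℝ}
    (hA : ∀ n, A n ⊆ A (n + 1))
    (h : ∀ n, ∀ x ∈ A n, ‖u (n + 1) x - u n x‖ ≤ e / 2 / 2 ^ n) :
    ∃ H : α → E, ∀ n, ∀ x ∈ A n, Tendsto (fun m => u m x) atTop (nhds (H x)) ∧ ‖u n x - H x‖ ≤ e / 2 ^ n := by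
  classical
  have hAm : Monotone A := monotone_nat_of_le_succ hA
  have hd : ∀ n, ∀ x ∈ A n, ∀ k, dist (u (n + k) x) (u (n + (k + 1)) x) ≤ (e / 2 ^ n) / 2 / 2 ^ k := by
    intro n x hx k
    rw [dist_comm, dist_eq_norm]
    refine (h (n + k) x (hAm (Nat.le_add_right n k) hx)).trans (le_of_eq ?_)
    rw [pow_add]; field_simp
  have hex : ∀ x, ∃ y, ∀ n, x ∈ A n → Tendsto (fun m => u m x) atTop (nhds y) := by
    intro x
    by_cases hx : ∃ n, x ∈ A n
    · obtain ⟨n, hn⟩ := hx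
      obtain ⟨y, hy⟩ := cauchySeq_tendsto_of_complete (cauchySeq_of_le_geometric_two (hd n x hn))
      refine ⟨y, fun _ _ => ?_⟩
      rw [← tendsto_add_atTop_iff_nat n]
      simpa [add_comm] using hy
    · exact ⟨0, fun n hn => absurd ⟨n, hn⟩ hx⟩
  choose H hH using hex
  refine ⟨H, fun n x hx => ⟨hH x n hx, ?_⟩⟩
  have h1 : Tendsto (fun k => u (n + k) x) atTop (nhds (H x)) := by
    have := (tendsto_add_atTop_iff_nat n).2 (hH x n hx)
    simpa [add_comm] using this
  have := dist_le_of_le_geometric_two_of_tendsto₀ (hd n x hx) h1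
  simpa [dist_eq_norm] using this

/-- clamped reparametrisations -/
def cl (n : ℕ) (s : ℝ) : ℝ := max 0 (min 1 (((n:ℝ) + 2) * (((n:ℝ) + 1) * s - n)))

lemma cl_cont (n : ℕ) : Continuous (cl n) := by unfold cl; fun_prop

lemma cl_mem (n : ℕ) (s : ℝ) : cl n s ∈ Icc (0:ℝ) 1 :=
  ⟨le_max_left _ _, max_le zero_le_one (min_le_left _ _)⟩

lemma cl_one {n : ℕ} {s : ℝ} (h : (n:ℝ) + 1 ≤ (n + 2) * s) : cl n s = 1 := by
  unfold cl
  rw [min_eq_left, max_eq_right zero_le_one]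
  have : (0:ℝ) ≤ n := by positivity
  nlinarith

lemma cl_zero {n : ℕ} {s : ℝ} (h : ((n:ℝ) + 1) * s ≤ n) : cl n s = 0 := by
  unfold cl
  rw [max_eq_left]
  refine (min_le_right _ _).trans ?_
  have : (0:ℝ) ≤ n := by positivity
  nlinarith

lemma cl_idx {s : ℝ} (hs1 : s < 1) : ∃ n : ℕ, (∀ j < n, cl j s = 1) ∧ ∀ j > n, cl j s = 0 := by
  classical
  have hex : ∃ n : ℕ, ((n:ℝ) + 2) * s < n + 1 := by
    obtain ⟨n, hn⟩ := exists_nat_gt (1 / (1 - s))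
    refine ⟨n, ?_⟩
    rw [div_lt_iff₀ (by linarith)] at hn
    nlinarith
  refine ⟨Nat.find hex, fun j hj => ?_, fun j hj => ?_⟩
  · have := Nat.find_min hex hj
    exact cl_one (not_lt.1 this)
  · apply cl_zero
    have h1 := Nat.find_spec hex
    have h2 : ((Nat.find hex : ℕ) : ℝ) + 1 ≤ j := by exact_mod_cast hj
    nlinarith

lemma jet0 {N : ℕ} {U : Set ℂ} (hU : IsOpen U) {a : ℂ} (i : ℕ) : ∀ (n : ℕ) (F G : ℂ → Cn N),
    DifferentiableOn ℂ G U → (∀ z ∈ U, F z = (z - a) ^ (n + i) • G z) →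
    ∃ G' : ℂ → Cn N, DifferentiableOn ℂ G' U ∧ ∀ z ∈ U, iteratedDeriv i F z = (z - a) ^ n • G' z := by
  induction i with
  | zero => intro n F G hG h; exact ⟨G, hG, fun z hz => by rw [iteratedDeriv_zero]; exact h z hz⟩
  | succ i ih =>
    intro n F G hG h
    obtain ⟨G', hG', h'⟩ := ih (n + 1) F G hG (fun z hz => by rw [h z hz]; congr 2; omega)
    have hd1 : DifferentiableOn ℂ (fun z : ℂ => z - a) U := by fun_prop
    have hd2 : DifferentiableOn ℂ (fun z => (z - a) • deriv G' z) U := hd1.smul (hG'.deriv hU)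
    have hd3 : DifferentiableOn ℂ (fun z => ((n:ℂ) + 1) • G' z) U := hG'.const_smul ((n:ℂ) + 1)
    refine ⟨fun z => ((n:ℂ) + 1) • G' z + (z - a) • deriv G' z, hd3.add hd2, fun z hz => ?_⟩
    rw [iteratedDeriv_succ]
    have he : iteratedDeriv i F =ᶠ[nhds z] fun z => (z - a) ^ (n + 1) • G' z := by
      filter_upwards [hU.mem_nhds hz] with y hy using h' y hy
    rw [he.deriv_eq]
    have h1 : HasDerivAt (fun z : ℂ => (z - a) ^ (n + 1)) ((n + 1 : ℕ) * (z - a) ^ n * 1) z := by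
      exact ((hasDerivAt_id z).sub_const a).fun_pow (n + 1)
    have h2 := (hG'.differentiableAt (hU.mem_nhds hz)).hasDerivAt
    have h3 := h1.smul h2
    refine h3.deriv.trans ?_
    rw [smul_add, smul_smul, smul_smul, add_comm, pow_succ]
    push_cast
    congr 2
    ring

lemma tlu_iter {N : ℕ} {U : Set ℂ} (hU : IsOpen U) {F : ℕ → ℂ → Cn N} {g : ℂ → Cn N}
    (hF : ∀ n, DifferentiableOn ℂ (F n) U) (h : TendstoLocallyUniformlyOn F g atTop U) (i : ℕ) :
    TendstoLocallyUniformlyOn (fun n => iteratedDeriv i (F n)) (iteratedDeriv i g) atTop U ∧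
      ∀ n, DifferentiableOn ℂ (iteratedDeriv i (F n)) U := by
  induction i with
  | zero => simpa using ⟨h, hF⟩
  | succ i ih =>
    simp only [iteratedDeriv_succ]
    exact ⟨ih.1.deriv (Eventually.of_forall ih.2) hU, fun n => (ih.2 n).deriv hU⟩

lemma jets {N : ℕ} {U : Set ℂ} (hU : IsOpen U) {P : ℂ → ℂ} {f g : ℂ → Cn N} {F : ℕ → ℂ → Cn N}
    (hf : DifferentiableOn ℂ f U) (hF : ∀ n, DifferentiableOn ℂ (F n) U)
    (h : TendstoLocallyUniformlyOn F g atTop U) (hg : DifferentiableOn ℂ g U)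
    (hG : ∀ n, ∃ G : ℂ → Cn N, DifferentiableOn ℂ G U ∧ ∀ z ∈ U, F n z = f z + P z • G z)
    {a : ℂ} (ha : a ∈ U) {k : ℕ} {R : ℂ → ℂ} (hR : Differentiable ℂ R) (hPR : ∀ z, P z = (z - a) ^ (k + 1) * R z)
    {i : ℕ} (hi : i ≤ k) : iteratedDeriv i g a = iteratedDeriv i f a := by
  have e1 : ∀ n, iteratedDeriv i (F n) a = iteratedDeriv i f a := by
    intro n
    obtain ⟨G, hG1, hG2⟩ := hG n
    obtain ⟨G', -, h'⟩ := jet0 hU (a := a) i (k + 1 - i) (fun z => F n z - f z)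
      (fun z => R z • G z) (hR.differentiableOn.smul hG1) (fun z hz => by
        rw [hG2 z hz, add_sub_cancel_left, hPR, smul_smul]; congr 3; omega)
    have h0 := h' a ha
    rw [sub_self, zero_pow (by omega), zero_smul] at h0
    have c1 : ContDiffAt ℂ i (F n) a := ((hF n).analyticAt (hU.mem_nhds ha)).contDiffAt
    have c2 : ContDiffAt ℂ i f a := (hf.analyticAt (hU.mem_nhds ha)).contDiffAt
    have := iteratedDeriv_fun_sub c1 c2
    rw [h0] at this
    exact (sub_eq_zero.1 this.symm)
  have h1 := ((tlu_iter hU hF h i).1.tendsto_at ha)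
  simp only [e1] at h1
  exact (tendsto_nhds_unique h1 tendsto_const_nhds)


set_option maxHeartbeats 2000000 in
lemma main1 {N : ℕ} {X : Set (Cn N)} {D : Set ℂ} {P : ℂ → ℂ} {ρ : Cn N → ℝ} (hX : IsOpen X)
    (hρ : ContDiffOn ℝ (⊤ : ℕ∞) ρ X) (hexh : ∀ c : ℝ, IsCompact {x ∈ X | ρ x ≤ c})
    {c : ℝ} (hLevi : ∀ x ∈ X, c < ρ x → TwoPosEigen ρ x)
    (hDo : IsOpen D) (hDb : Bornology.IsBounded D) (hSB : SmoothlyBounded D)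
    (hP : Differentiable ℂ P) (hP0 : ∀ z ∈ frontier D, P z ≠ 0)
    {f : ℂ → Cn N} (hf : Adm X D f) (hfb : ∀ z ∈ frontier D, c < ρ (f z))
    {K0 : Set ℂ} (hK0D : K0 ⊆ D) (hK0 : IsCompact K0) {e : ℝ} (he : 0 < e) :
    ∃ g : ℂ → Cn N, DifferentiableOn ℂ g D ∧ (∀ z ∈ D, g z ∈ X) ∧
      (∀ K : Set (Cn N), K ⊆ X → IsCompact K → IsCompact {z ∈ D | g z ∈ K}) ∧
      HomotopicIn X D f g ∧
      (∃ F : ℕ → ℂ → Cn N, (∀ n, DifferentiableOn ℂ (F n) D) ∧ TendstoLocallyUniformlyOn F g atTop D ∧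
        ∀ n, ∃ G : ℂ → Cn N, DifferentiableOn ℂ G D ∧ ∀ z ∈ D, F n z = f z + P z • G z) ∧
      ∀ z ∈ K0, ‖g z - f z‖ ≤ e := by
  have hρc : ContinuousOn ρ X := hρ.continuousOn
  have hfc : frontier D ⊆ closure D := frontier_subset_closure
  have hcD : IsCompact (closure D) := hDb.isCompact_closure
  obtain ⟨E, hEc, hED, hEx⟩ := exhaust hDo hDb
  obtain ⟨m0, hm0⟩ : ∃ m0, ∀ z ∈ closure D, m0 ≤ ρ (f z) := by
    obtain ⟨m0, hm0⟩ := (hcD.image_of_continuousOn (hρc.comp hf.1 hf.2.2)).bddBelow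
    exact ⟨m0, fun z hz => hm0 ⟨z, hz, rfl⟩⟩
  set μ : ℕ → ℝ := fun n => if n = 0 then m0 else n with hμ
  -- the sequence
  obtain ⟨u, hu0, hgood, hrel⟩ := dep_seq (α := (ℂ → Cn N) × Set ℂ) (a := (f, K0 ∪ E 0))
    (good := fun n s => Adm X D s.1 ∧ IsCompact s.2 ∧ s.2 ⊆ D ∧ E n ⊆ s.2 ∧
      (∀ z ∈ frontier D, c < ρ (s.1 z)) ∧ ∀ z ∈ closure D \ s.2, μ n ≤ ρ (s.1 z))
    (rel := fun n s s' => s.2 ⊆ s'.2 ∧ Lk X D P s.1 s'.1 s.2 (e / 2 / 2 ^ n) ∧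
      (∀ z ∈ s.2, |ρ (s'.1 z) - ρ (s.1 z)| ≤ 1 / 2 / 2 ^ n) ∧
      ∀ z ∈ closure D \ s.2, μ n - 2 ≤ ρ (s'.1 z))
    ⟨hf, hK0.union (hEc 0), union_subset hK0D (hED 0), subset_union_right, hfb, fun z hz => by
      simpa [hμ] using hm0 z hz.1⟩ (by
    rintro n ⟨g, K⟩ ⟨hg, hK, hKD, -, hgb, hgm⟩
    dsimp only at hg hK hKD hgb hgm ⊢
    have hKc : K ⊆ closure D := hKD.trans subset_closure
    obtain ⟨η, hη, hmod⟩ := modul hX hρc (hK.image_of_continuousOn (hg.1.mono hKc)) (by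
      rintro _ ⟨z, hz, rfl⟩; exact hg.2.2 z (hKc hz)) (ε := 1 / 2 / 2 ^ n) (by positivity)
    obtain ⟨g', l1, l2, l3⟩ := lift hX hρ hexh hLevi hDo hDb hSB hP hP0 hg hgb hKD hK hgm
      (ε := min η (e / 2 / 2 ^ n)) (by positivity) (max (n + 2) (c + 1))
    have hg' := l1.adm hg hP
    have hρg : ContinuousOn (fun z => ρ (g' z)) (closure D) := hρc.comp hg'.1 hg'.2.2
    set S : Set ℂ := closure D ∩ (fun z => ρ (g' z)) ⁻¹' (Iic (n + 1)) with hS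
    have hSc : IsCompact S := by
      refine hcD.of_isClosed_subset ?_ inter_subset_left
      exact hρg.preimage_isClosed_of_isClosed isClosed_closure isClosed_Iic
    have hSD : S ⊆ D := by
      intro z hz
      by_contra hc
      have : z ∈ frontier D := by rw [hDo.frontier_eq]; exact ⟨hz.1, hc⟩
      have h1 := (le_max_left _ _).trans (l2 z this)
      have h2 : ρ (g' z) ≤ n + 1 := hz.2
      linarith
    refine ⟨(g', K ∪ E (n + 1) ∪ S), ⟨hg', (hK.union (hEc _)).union hSc,
      union_subset (union_subset hKD (hED _)) hSD, fun z hz => Or.inl (Or.inr hz), fun z hz => ?_, ?_⟩,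
      fun z hz => Or.inl (Or.inl hz), l1.mono Subset.rfl (min_le_right _ _), fun z hz => ?_, l3⟩
    · have := (le_max_right _ _).trans (l2 z hz)
      dsimp only
      linarith
    · rintro z ⟨hz, hzn⟩
      have : (n:ℝ) + 1 < ρ (g' z) := by
        by_contra hc
        exact hzn (Or.inr ⟨hz, not_lt.1 hc⟩)
      simp only [hμ, Nat.succ_ne_zero, if_false]
      push_cast
      exact this.le
    · exact (hmod (g z) ⟨z, hz, rfl⟩ (g' z) ((l1.close hKc z hz).trans (min_le_left _ _))).2)
  set F : ℕ → ℂ → Cn N := fun n => (u n).1 with hF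
  set K : ℕ → Set ℂ := fun n => (u n).2 with hK
  have hF0 : F 0 = f := by simp [hF, hu0]
  have hK00 : K0 ⊆ K 0 := by simp [hK, hu0]
  have gA : ∀ n, Adm X D (F n) := fun n => (hgood n).1
  have gK : ∀ n, IsCompact (K n) := fun n => (hgood n).2.1
  have gKD : ∀ n, K n ⊆ D := fun n => (hgood n).2.2.1
  have gE : ∀ n, E n ⊆ K n := fun n => (hgood n).2.2.2.1
  have rK : ∀ n, K n ⊆ K (n + 1) := fun n => (hrel n).1
  have rL : ∀ n, Lk X D P (F n) (F (n + 1)) (K n) (e / 2 / 2 ^ n) := fun n => (hrel n).2.1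
  have rρ : ∀ n, ∀ z ∈ K n, |ρ (F (n + 1) z) - ρ (F n z)| ≤ 1 / 2 / 2 ^ n := fun n => (hrel n).2.2.1
  have rm : ∀ n, ∀ z ∈ closure D \ K n, μ n - 2 ≤ ρ (F (n + 1) z) := fun n => (hrel n).2.2.2
  clear_value F K
  clear hgood hrel hu0 hF hK
  have hKm : Monotone K := monotone_nat_of_le_succ rK
  have hKx : ∀ S ⊆ D, IsCompact S → ∃ n0, ∀ n ≥ n0, S ⊆ K n := by
    intro S hS hSc
    obtain ⟨n0, h0⟩ := hEx S hS hSc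
    exact ⟨n0, fun n hn => (h0 n hn).trans (gE n)⟩
  have hKz : ∀ z ∈ D, ∃ n, z ∈ K n := by
    intro z hz
    obtain ⟨n0, h0⟩ := hKx {z} (by simpa using hz) isCompact_singleton
    exact ⟨n0, h0 n0 le_rfl rfl⟩
  choose Hh hH1 hH2 hH3 hH4 hH5 using fun n => (rL n).1
  set S : ℕ → ℝ × ℂ → Cn N := fun n p =>
    F 0 p.2 + ∑ j ∈ Finset.range n, (Hh j (cl j p.1, p.2) - F j p.2) with hS
  have hSs : ∀ n p, S (n + 1) p = S n p + (Hh n (cl n p.1, p.2) - F n p.2) := by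
    intro n p; simp only [hS, Finset.sum_range_succ]; abel
  have hS0 : ∀ p, S 0 p = F 0 p.2 := fun p => by simp [hS]
  have hSc : ∀ n, ContinuousOn (S n) (Icc (0:ℝ) 1 ×ˢ closure D) := by
    intro n
    have hFc : ∀ j, ContinuousOn (fun p : ℝ × ℂ => F j p.2) (Icc (0:ℝ) 1 ×ˢ closure D) := fun j =>
      (gA j).1.comp continuousOn_snd (fun p hp => hp.2)
    refine (hFc 0).add (continuousOn_finset_sum _ (fun j _ => ContinuousOn.sub ?_ (hFc j)))
    refine (hH1 j).comp ?_ (fun p hp => ⟨cl_mem j p.1, hp.2⟩)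
    exact (((cl_cont j).comp continuous_fst).prodMk continuous_snd).continuousOn
  obtain ⟨H, hH⟩ := lim_geo (u := S) (A := fun n => (univ : Set ℝ) ×ˢ K n) (e := e)
    (fun n => prod_mono_right (rK n)) (by
      rintro n ⟨s, z⟩ ⟨-, hz⟩
      rw [hSs, add_sub_cancel_left]
      exact hH5 n _ (cl_mem n s) z hz)
  have hSF : ∀ z ∈ closure D, ∀ s, ∀ n, (∀ j < n, cl j s = 1) → S n (s, z) = F n z := by
    intro z hz s n
    induction n with
    | zero => intro _; exact hS0 _
    | succ n ih =>
      intro h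
      rw [hSs, ih (fun j hj => h j (by omega))]
      dsimp only
      rw [h n (by omega), hH4 n z hz]
      abel
  have hS1 : ∀ z ∈ closure D, ∀ n, S n (1, z) = F n z := fun z hz n =>
    hSF z hz 1 n (fun j _ => cl_one (by linarith))
  set g : ℂ → Cn N := fun z => H (1, z) with hg
  have hgF : ∀ n, ∀ z ∈ K n, Tendsto (fun m => F m z) atTop (nhds (g z)) ∧ ‖F n z - g z‖ ≤ e / 2 ^ n := by
    intro n z hz
    have hzc : z ∈ closure D := subset_closure (gKD n hz)
    have := hH n (1, z) ⟨mem_univ _, hz⟩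
    simpa only [hS1 z hzc] using this
  have he0 : Tendsto (fun n : ℕ => e / 2 ^ n) atTop (nhds 0) := by
    have := (tendsto_pow_atTop_nhds_zero_of_lt_one (r := (1:ℝ) / 2) (by norm_num) (by norm_num)).const_mul e
    simpa [div_eq_mul_inv] using this
  have htlu : TendstoLocallyUniformlyOn F g atTop D := by
    rw [tendstoLocallyUniformlyOn_iff_forall_isCompact hDo]
    intro S hSD hSc
    obtain ⟨n0, h0⟩ := hKx S hSD hSc
    rw [Metric.tendstoUniformlyOn_iff]
    intro ε hε
    filter_upwards [eventually_ge_atTop n0, he0.eventually (gt_mem_nhds hε)] with n hn hlt z hz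
    rw [dist_comm, dist_eq_norm]
    exact ((hgF n z (h0 n hn hz)).2).trans_lt hlt
  have hgd : DifferentiableOn ℂ g D := htlu.differentiableOn (Eventually.of_forall (fun n => (gA n).2.1)) hDo
  -- control of ρ along the sequence
  have hρseq : ∀ n, ∀ z ∈ K n, ∀ k, |ρ (F (n + k) z) - ρ (F n z)| ≤ 1 - 1 / 2 ^ k := by
    intro n z hz k
    induction k with
    | zero => simp
    | succ k ih =>
      have h1 := rρ (n + k) z (hKm (Nat.le_add_right n k) hz)
      have h2 := abs_sub_le (ρ (F (n + k + 1) z)) (ρ (F (n + k) z)) (ρ (F n z))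
      have h3 : (1:ℝ) / 2 / 2 ^ (n + k) ≤ 1 / 2 / 2 ^ k := by
        gcongr
        · norm_num
        · omega
      have h4 : (1:ℝ) / 2 ^ (k + 1) = 1 / 2 / 2 ^ k := by rw [pow_succ]; field_simp
      have h5 : (1:ℝ) / 2 ^ k = 2 * (1 / 2 / 2 ^ k) := by field_simp
      rw [h4]
      rw [h5] at ih
      rw [← add_assoc]
      linarith
  have hgX : ∀ n, ∀ z ∈ K n, g z ∈ X ∧ ρ (F n z) - 1 ≤ ρ (g z) := by
    intro n z hz
    have hzc : z ∈ closure D := subset_closure (gKD n hz)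
    have hlim : Tendsto (fun k => F (n + k) z) atTop (nhds (g z)) := by
      have := (tendsto_add_atTop_iff_nat n).2 (hgF n z hz).1
      simpa [add_comm] using this
    have hb : ∀ k, ρ (F n z) - 1 ≤ ρ (F (n + k) z) ∧ ρ (F (n + k) z) ≤ ρ (F n z) + 1 := by
      intro k
      have h1 := abs_le.1 (hρseq n z hz k)
      have h2 : (0:ℝ) ≤ 1 / 2 ^ k := by positivity
      constructor <;> linarith [h1.1, h1.2]
    have hin : g z ∈ {x ∈ X | ρ x ≤ ρ (F n z) + 1} :=
      (hexh _).isClosed.mem_of_tendsto hlim (Eventually.of_forall (fun k => ⟨(gA _).2.2 z hzc, (hb k).2⟩))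
    refine ⟨hin.1, ?_⟩
    have hρl := ((hρc.continuousAt (hX.mem_nhds hin.1)).tendsto).comp hlim
    exact ge_of_tendsto' hρl (fun k => (hb k).1)
  have hgX' : ∀ z ∈ D, g z ∈ X := fun z hz => by
    obtain ⟨n, hn⟩ := hKz z hz
    exact (hgX n z hn).1
  have hlow : ∀ n, 0 < n → ∀ z ∈ D, z ∉ K n → (n:ℝ) - 3 ≤ ρ (g z) := by
    intro n hn z hz hzn
    classical
    have hex := hKz z hz
    have hspec := Nat.find_spec hex
    have hnl : n < Nat.find hex := by
      by_contra hc
      exact hzn (hKm (not_lt.1 hc) hspec)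
    obtain ⟨j, hj⟩ : ∃ j, Nat.find hex = j + 1 := ⟨Nat.find hex - 1, by omega⟩
    have hzj : z ∉ K j := Nat.find_min hex (by omega)
    rw [hj] at hspec
    have h1 := rm j z ⟨subset_closure hz, hzj⟩
    have h2 := (hgX (j + 1) z hspec).2
    have hμj : μ j = j := by simp only [hμ]; rw [if_neg (by omega)]
    rw [hμj] at h1
    have h3 : (n:ℝ) ≤ j := by exact_mod_cast (by omega : n ≤ j)
    linarith
  refine ⟨g, hgd, hgX', ?_, ⟨H, ?_, ?_, ?_, fun z _ => rfl⟩, ⟨F, fun n => (gA n).2.1, htlu, ?_⟩, ?_⟩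
  · intro Q hQX hQ
    obtain ⟨R, hR⟩ := (hQ.image_of_continuousOn (hρc.mono hQX)).bddAbove
    obtain ⟨n, hn⟩ := exists_nat_gt (max 0 (R + 3))
    have hn0 : (0:ℝ) < n := (le_max_left _ _).trans_lt hn
    have hn1 : R + 3 < n := (le_max_right _ _).trans_lt hn
    have e1 : {z ∈ D | g z ∈ Q} = K n ∩ g ⁻¹' Q := by
      ext z
      constructor
      · rintro ⟨hz, hzQ⟩
        refine ⟨?_, hzQ⟩
        by_contra hc
        have h1 := hlow n (by exact_mod_cast hn0) z hz hc
        have h2 : ρ (g z) ≤ R := hR ⟨_, hzQ, rfl⟩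
        linarith
      · rintro ⟨hz, hzQ⟩
        exact ⟨gKD n hz, hzQ⟩
    rw [e1]
    refine (gK n).of_isClosed_subset ?_ inter_subset_left
    exact (hgd.continuousOn.mono (gKD n)).preimage_isClosed_of_isClosed (gK n).isClosed hQ.isClosed
  · rintro ⟨s0, z0⟩ ⟨hs0, hz0⟩
    obtain ⟨r, hr, hrD⟩ := Metric.isOpen_iff.1 hDo z0 hz0
    have hbD : closedBall z0 (r / 2) ⊆ D := (closedBall_subset_ball (by linarith)).trans hrD
    obtain ⟨n0, h0⟩ := hKx _ hbD (isCompact_closedBall z0 (r / 2))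
    have hcont : ContinuousOn H (Icc (0:ℝ) 1 ×ˢ closedBall z0 (r / 2)) := by
      have htu : TendstoUniformlyOn S H atTop (Icc (0:ℝ) 1 ×ˢ closedBall z0 (r / 2)) := by
        rw [Metric.tendstoUniformlyOn_iff]
        intro ε hε
        filter_upwards [eventually_ge_atTop n0, he0.eventually (gt_mem_nhds hε)] with n hn hlt p hp
        rw [dist_comm, dist_eq_norm]
        exact ((hH n p ⟨mem_univ _, h0 n hn hp.2⟩).2).trans_lt hlt
      exact htu.continuousOn (Frequently.of_forall (fun n => (hSc n).mono
        (prod_mono_right (hbD.trans subset_closure))))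
    refine (hcont (s0, z0) ⟨hs0, mem_closedBall_self (by linarith)⟩).mono_of_mem_nhdsWithin ?_
    rw [nhdsWithin_prod_eq]
    exact prod_mem_prod self_mem_nhdsWithin (mem_nhdsWithin_of_mem_nhds (closedBall_mem_nhds z0 (by linarith)))
  · intro s hs z hz
    rcases hs.2.lt_or_eq with hlt | rfl
    · obtain ⟨n, hn1, hn2⟩ := cl_idx hlt
      have hzc : z ∈ closure D := subset_closure hz
      have hSn : ∀ k, S (n + 1 + k) (s, z) = Hh n (cl n s, z) := by
        intro k
        induction k with
        | zero =>
          rw [add_zero, hSs, hSF z hzc s n hn1]; dsimp only; abel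
        | succ k ih =>
          rw [← add_assoc, hSs, ih]
          dsimp only
          rw [hn2 (n + 1 + k) (by omega), hH3 _ z hzc, sub_self, add_zero]
      obtain ⟨n1, hz1⟩ := hKz z hz
      have h1 := (tendsto_add_atTop_iff_nat (n + 1)).2 (hH n1 (s, z) ⟨mem_univ _, hz1⟩).1
      have h2 : (fun k => S (k + (n + 1)) (s, z)) = fun _ => Hh n (cl n s, z) := by
        funext k; rw [add_comm k]; exact hSn k
      rw [h2] at h1
      have h3 := tendsto_nhds_unique h1 tendsto_const_nhds
      rw [h3]
      exact hH2 n _ (cl_mem n s) z hzc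
    · exact hgX' z hz
  · intro z hz
    have hzc : z ∈ closure D := subset_closure hz
    obtain ⟨n1, hz1⟩ := hKz z hz
    have h1 := (hH n1 (0, z) ⟨mem_univ _, hz1⟩).1
    have h2 : ∀ k, S k (0, z) = f z := by
      intro k
      induction k with
      | zero => rw [hS0, hF0]
      | succ k ih =>
        rw [hSs, ih]
        dsimp only
        rw [cl_zero (by simp), hH3 k z hzc, sub_self, add_zero]
    simp only [h2] at h1
    exact tendsto_nhds_unique h1 tendsto_const_nhds
  · intro n
    induction n with
    | zero => exact ⟨fun _ => 0, differentiableOn_const _, fun z _ => by simp [hF0]⟩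
    | succ n ih =>
      obtain ⟨G, hG, hGe⟩ := ih
      obtain ⟨G', hG', hGe'⟩ := (rL n).2
      exact ⟨fun z => G z + G' z, hG.add hG', fun z hz => by rw [hGe' z hz, hGe z hz, smul_add]; abel⟩
  · intro z hz
    have := (hgF 0 z (hK00 hz)).2
    rw [hF0, norm_sub_rev] at this
    simpa using this

/-- Main theorem for domains in `ℂ^N`: given a `C^∞` exhaustion function whose
Levi form has at least two positive eigenvalues on `{ρ > c}`, and a `C²` map
`f : D̄ → X` holomorphic in `D` with `f(∂D) ⊆ {ρ > c}`, there is a sequence of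
proper holomorphic maps `g_ν : D → X`, homotopic to `f|_D`, agreeing with `f` to
order `k` at given points, converging to `f` uniformly on compacts in `D`. -/
theorem main_theorem_domains_in_CN
    (N : ℕ) (hN : 2 ≤ N) (X : Set (Cn N)) (hXopen : IsOpen X) (hXconn : IsConnected X)
    (ρ : Cn N → ℝ) (hρ : ContDiffOn ℝ (⊤ : ℕ∞) ρ X)
    (hexh : ∀ c : ℝ, IsCompact {x ∈ X | ρ x ≤ c})
    (c : ℝ) (hLevi : ∀ x ∈ X, c < ρ x → TwoPosEigen ρ x)
    (D : Set ℂ) (hDopen : IsOpen D) (hDbdd : Bornology.IsBounded D)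
    (hDconn : IsConnected D) (hDsb : SmoothlyBounded D)
    (f : ℂ → Cn N) (hf : ClassA 2 D f) (hfX : ∀ z ∈ closure D, f z ∈ X)
    (hfbd : ∀ z ∈ frontier D, c < ρ (f z))
    (l : ℕ) (zs : Fin l → ℂ) (hzs : ∀ j, zs j ∈ D) (k : ℕ) :
    ∃ g : ℕ → ℂ → Cn N,
      (∀ ν, DifferentiableOn ℂ (g ν) D) ∧
      (∀ ν, ∀ z ∈ D, g ν z ∈ X) ∧
      (∀ ν, ∀ K : Set (Cn N), K ⊆ X → IsCompact K → IsCompact {z ∈ D | g ν z ∈ K}) ∧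
      (∀ ν, HomotopicIn X D f (g ν)) ∧
      (∀ ν, ∀ j : Fin l, ∀ i ≤ k, iteratedDeriv i (g ν) (zs j) = iteratedDeriv i f (zs j)) ∧
      (∀ K : Set ℂ, K ⊆ D → IsCompact K → TendstoUniformlyOn (fun ν => g ν) f atTop K) := by
  classical
  obtain ⟨E, hEc, hED, hEx⟩ := exhaust hDopen hDbdd
  set P : ℂ → ℂ := fun z => ∏ j : Fin l, (z - zs j) ^ (k + 1) with hPdef
  have hP : Differentiable ℂ P := by
    apply Differentiable.fun_finset_prod
    intro j _
    fun_prop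
  have hP0 : ∀ z ∈ frontier D, P z ≠ 0 := by
    intro z hz
    refine Finset.prod_ne_zero_iff.2 (fun j _ => pow_ne_zero _ (sub_ne_zero.2 ?_))
    rintro rfl
    exact (hDopen.frontier_eq ▸ hz).2 (hzs j)
  have hA : Adm X D f := ⟨hf.1, hf.2.1, hfX⟩
  choose g h1 h2 h3 h4 h5 h6 using fun ν : ℕ => main1 hXopen hρ hexh hLevi hDopen hDbdd hDsb hP hP0 hA hfbd
    (hED ν) (hEc ν) (e := 1 / ((ν:ℝ) + 1)) (by positivity)
  refine ⟨g, h1, h2, h3, h4, ?_, ?_⟩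
  · intro ν j i hi
    obtain ⟨F, hF1, hF2, hF3⟩ := h5 ν
    refine jets hDopen hf.2.1 hF1 hF2 (h1 ν) hF3 (hzs j)
      (R := fun z => ∏ j' ∈ Finset.univ.erase j, (z - zs j') ^ (k + 1)) ?_ ?_ hi
    · apply Differentiable.fun_finset_prod
      intro j _
      fun_prop
    · intro z
      exact (Finset.mul_prod_erase Finset.univ (fun j => (z - zs j) ^ (k + 1)) (Finset.mem_univ j)).symm
  · intro K hKD hK
    obtain ⟨n0, h0⟩ := hEx K hKD hK
    rw [Metric.tendstoUniformlyOn_iff]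
    intro ε hε
    have hlim : Tendsto (fun n : ℕ => 1 / ((n:ℝ) + 1)) atTop (nhds 0) := tendsto_one_div_add_atTop_nhds_zero_nat
    filter_upwards [eventually_ge_atTop n0, hlim.eventually (gt_mem_nhds hε)] with n hn hlt z hz
    rw [dist_comm, dist_eq_norm]
    exact (h6 n z (h0 n hn hz)).trans_lt hlt
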